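/- Let i ≥ 2 be such that #f_{i−1} = #f_{i+1} = 2 and #f_i = 1; write f_i = {d}, and let J be an invariant-factor count function for d. Then lim_{n→∞} ((1/n)·Σ_{m=1}^n J(m) − μ_i·log log n)/(log log n)^{1/2} = −(σ_{i−1} + σ_{i+1})/√(2π). -/

import Mathlib

open MeasureTheory ProbabilityTheory Filter

noncomputable section

/-- A key encoding the lexicographic order on pairs `(φ(q), q)`; this is a valid
encoding on prime powers since every prime power satisfies `q ≤ 2 * φ(q)`. -/
def ppKey (q : ℕ) : ℕ := 2 * Nat.totient q ^ 2 + q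

/-- The `n`-th smallest key of a prime power (0-indexed). -/
def ppNthKey (n : ℕ) : ℕ := Nat.nth (fun k => ∃ q : ℕ, IsPrimePow q ∧ ppKey q = k) n

/-- The total φ-sequence `q̃_i` (1-indexed): the enumeration of all prime powers
ordered by nondecreasing totient, with ties broken by increasing size. -/
def qt (i : ℕ) : ℕ := sInf {q : ℕ | IsPrimePow q ∧ ppKey q = ppNthKey (i - 1)}

/-- `lcm(q̃_1, …, q̃_i)`. -/
def Lseq (i : ℕ) : ℕ := (Finset.Icc 1 i).lcm qt

/-- The universal factor order set `f_i`. -/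
def UFO (i : ℕ) : Set ℕ :=
  if Nat.totient (qt i) < Nat.totient (qt (i + 1)) then {Lseq i}
  else {Lseq i, Nat.lcm (Lseq (i - 1)) (qt (i + 1))}

/-- `φ(q̃_i)` as a real number. -/
def phiQ (i : ℕ) : ℝ := (Nat.totient (qt i) : ℝ)

/-- `μ_i = 1/φ(q̃_i) − 1/φ(q̃_{i+1})`. -/
def muSeq (i : ℕ) : ℝ := 1 / phiQ i - 1 / phiQ (i + 1)

/-- `σ_i = (1/φ(q̃_i) + 1/φ(q̃_{i+1}) − 2/(φ(q̃_i)·φ(q̃_{i+1})))^{1/2}`. -/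
def sigSeq (i : ℕ) : ℝ :=
  Real.sqrt (1 / phiQ i + 1 / phiQ (i + 1) - 2 / (phiQ i * phiQ (i + 1)))

/-- `σ_{i;a,b} = (φ(q̃_i)^{−a} + φ(q̃_{i+1})^{−b} − 2/(φ(q̃_i)·φ(q̃_{i+1})))^{1/2}`. -/
def sigAB (i a b : ℕ) : ℝ :=
  Real.sqrt (1 / phiQ i ^ a + 1 / phiQ (i + 1) ^ b - 2 / (phiQ i * phiQ (i + 1)))

/-- `ν_j = (φ(q̃_j)^{−1}·(1 − φ(q̃_j)^{−1}))^{1/2}`. -/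
def nuSeq (j : ℕ) : ℝ := Real.sqrt (1 / phiQ j * (1 - 1 / phiQ j))

/-- `J` is an invariant-factor count function for `d`: whenever `(ℤ/mℤ)ˣ` is isomorphic to
a direct product of cyclic groups `ℤ/λ_1 × ⋯ × ℤ/λ_K` with `1 < λ_1 ∣ λ_2 ∣ ⋯ ∣ λ_K`,
`J m` is the number of indices `j` with `λ_j = d`. -/
def IsInvCount (d : ℕ) (J : ℕ → ℕ) : Prop :=
  ∀ m : ℕ, 1 ≤ m → ∀ K : ℕ, ∀ lam : Fin K → ℕ,
    (∀ j, 1 < lam j) →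
    (∀ j k : Fin K, j ≤ k → lam j ∣ lam k) →
    Nonempty ((ZMod m)ˣ ≃* Multiplicative (∀ j : Fin K, ZMod (lam j))) →
    J m = (Finset.univ.filter fun j : Fin K => lam j = d).card

/-- The number of `m ∈ {1, …, n}` satisfying `P`. -/
def cnt (P : ℕ → Prop) (n : ℕ) : ℕ := {m : ℕ | 1 ≤ m ∧ m ≤ n ∧ P m}.ncard

/-- The average `(1/n)·∑_{m=1}^n J(m)`. -/
def avg (J : ℕ → ℕ) (n : ℕ) : ℝ := (∑ m ∈ Finset.Icc 1 n, (J m : ℝ)) / n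

/-- `log log n`. -/
def LL (n : ℕ) : ℝ := Real.log (Real.log n)

/-- The standard normal cumulative distribution function. -/
def Phi (x : ℝ) : ℝ := (Real.sqrt (2 * Real.pi))⁻¹ * ∫ t in Set.Iic x, Real.exp (-t ^ 2 / 2)

/-- Owen's T-function. -/
def OwenT (h a : ℝ) : ℝ :=
  (2 * Real.pi)⁻¹ * ∫ t in (0:ℝ)..a, Real.exp (-(1 + t ^ 2) * h ^ 2 / 2) / (1 + t ^ 2)

/-- The skew-normal cumulative distribution function with parameter `α`. -/
def PhiSkew (x α : ℝ) : ℝ := Phi x - 2 * OwenT x α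

/-- The standard Gaussian probability measure `γ^k` on `ℝ^k`. -/
def stdGaussian (k : ℕ) : Measure (Fin k → ℝ) :=
  Measure.pi fun _ => gaussianReal 0 1

/-- `ω(m;q,1)`: the number of distinct primes `p ∣ m` with `p ≡ 1 (mod q)`. -/
def omegaQ (m q : ℕ) : ℕ := (m.primeFactors.filter fun p => p % q = 1 % q).card

/-- The correction term `Ē(m;p^α)`. -/
def Ebar (m p α : ℕ) : ℕ :=
  if p ^ α = 2 ∧ 8 ∣ m then 2
  else if p ^ α = 2 ∧ 4 ∣ m ∧ ¬(8 ∣ m) then 1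
  else if p = 2 ∧ 2 ≤ α ∧ 2 ^ (α + 2) ∣ m then 1
  else if p ≠ 2 ∧ p ^ (α + 1) ∣ m then 1
  else 0

/-- `prm(m;q)` for a prime power `q = p^α`: the unique `k` such that `p^k` is the cardinality
of the subgroup `{x ∈ (ℤ/mℤ)ˣ : x^p = 1 and x = y^{p^{α−1}} for some y}` (obtained here as the
`p`-adic valuation of that cardinality; note `p = q.minFac` and `p^{α−1} = q / p`). -/
def prm (m q : ℕ) : ℕ :=
  (Nat.card {x : (ZMod m)ˣ // x ^ q.minFac = 1 ∧ ∃ y : (ZMod m)ˣ, y ^ (q / q.minFac) = x}).factorization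
    q.minFac

/-- `m` is `y`-typical: for all prime powers `q₁, q₂` with `φ(q₁) ≤ y` and `φ(q₁) < φ(q₂)`
one has `prm(m;q₁) > prm(m;q₂)`. -/
def yTypical (y : ℝ) (m : ℕ) : Prop :=
  ∀ q₁ q₂ : ℕ, IsPrimePow q₁ → IsPrimePow q₂ →
    (Nat.totient q₁ : ℝ) ≤ y → Nat.totient q₁ < Nat.totient q₂ →
    prm m q₂ < prm m q₁

/-- The kernel whose integral over `t` represents the absolute value of `x`. -/
def absKernel (x t : ℝ) : ℝ := (1 - Real.cos (t * x)) / t ^ 2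

theorem absKernel_nonneg (x t : ℝ) : 0 ≤ absKernel x t :=
  div_nonneg (sub_nonneg.2 (Real.cos_le_one _)) (sq_nonneg t)

theorem absKernel_le (x t : ℝ) : absKernel x t ≤ (x ^ 2 / 2 + 2) * (1 + t ^ 2)⁻¹ := by
  unfold absKernel
  rcases eq_or_ne t 0 with rfl | ht
  · simp; positivity
  rw [← div_eq_mul_inv, div_le_div_iff₀ (by positivity) (by positivity)]
  have h1 := Real.one_sub_sq_div_two_le_cos (x := t * x)
  have h2 := Real.neg_one_le_cos (t * x)
  have ht2 : 0 ≤ t ^ 2 := sq_nonneg t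
  nlinarith

theorem measurable_absKernel : Measurable (Function.uncurry absKernel) := by
  unfold Function.uncurry absKernel
  fun_prop

theorem integrable_absKernel (x : ℝ) : Integrable (absKernel x) := by
  refine (integrable_inv_one_add_sq.const_mul (x ^ 2 / 2 + 2)).mono'
    (measurable_absKernel.comp measurable_prodMk_left).aestronglyMeasurable
    (Eventually.of_forall fun t => ?_)
  rw [Real.norm_of_nonneg (absKernel_nonneg x t)]
  exact absKernel_le x t

theorem integral_absKernel (x : ℝ) : ∫ t, absKernel x t = |x| * ∫ t, absKernel 1 t := by
  rcases eq_or_ne x 0 with rfl | hx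
  · simp [absKernel]
  have h : absKernel x = fun t => x ^ 2 * absKernel 1 (x * t) := by
    funext t
    unfold absKernel
    rcases eq_or_ne t 0 with rfl | ht
    · simp
    · field_simp
  rw [h, integral_const_mul, Measure.integral_comp_mul_left, smul_eq_mul, ← mul_assoc, abs_inv,
    ← sq_abs x]
  congr 1
  field_simp

theorem integral_absKernel_one_pos : 0 < ∫ t, absKernel 1 t := by
  rw [integral_pos_iff_support_of_nonneg (absKernel_nonneg 1) (integrable_absKernel 1)]
  refine lt_of_lt_of_le ?_ (measure_mono (s := Set.Ioo 0 Real.pi) fun t ht => ?_)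
  · simp [Real.pi_pos]
  · have hcos : Real.cos t < 1 := by
      rw [← Real.cos_zero]
      exact Real.cos_lt_cos_of_nonneg_of_le_pi le_rfl ht.2.le ht.1
    have : 0 < absKernel 1 t := by
      unfold absKernel
      rw [mul_one]
      exact div_pos (by linarith) (pow_pos ht.1 2)
    exact this.ne'

theorem integral_abs_gaussianReal (v : NNReal) :
    ∫ x, |x| ∂(gaussianReal 0 v) = Real.sqrt v * Real.sqrt (2 / Real.pi) := by
  rcases eq_or_ne v 0 with rfl | hv
  · simp
  have hv0 : (0 : ℝ) < v := by positivity
  rw [integral_gaussianReal_eq_integral_smul hv]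
  have h : (fun x : ℝ => gaussianPDFReal 0 v x • |x|) =
      fun x => (fun y => (Real.sqrt (2 * Real.pi * v))⁻¹ *
        (y ^ (1 : ℝ) * Real.exp (-(1 / (2 * (v : ℝ))) * y ^ (2 : ℝ)))) |x| := by
    funext x
    simp only [gaussianPDFReal, smul_eq_mul, Real.rpow_one, sub_zero, Real.rpow_two, sq_abs]
    rw [show -(1 / (2 * (v : ℝ))) * x ^ 2 = -x ^ 2 / (2 * v) by ring]
    ring
  rw [h, integral_comp_abs (f := fun y => (Real.sqrt (2 * Real.pi * v))⁻¹ *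
        (y ^ (1 : ℝ) * Real.exp (-(1 / (2 * (v : ℝ))) * y ^ (2 : ℝ)))), integral_const_mul,
    integral_rpow_mul_exp_neg_mul_rpow (by norm_num) (by norm_num) (by positivity)]
  norm_num
  rw [Real.rpow_neg_one]
  have h1 : Real.sqrt (v : ℝ) ^ 2 = v := Real.sq_sqrt hv0.le
  have h2 : Real.sqrt (2 : ℝ) ^ 2 = 2 := Real.sq_sqrt (by norm_num)
  have : 0 < Real.sqrt (v : ℝ) := Real.sqrt_pos.2 hv0
  have : 0 < Real.sqrt Real.pi := Real.sqrt_pos.2 Real.pi_pos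
  field_simp
  rw [h1, h2]; ring

theorem integral_cos_gaussianReal (v : NNReal) (t : ℝ) :
    ∫ x, Real.cos (t * x) ∂(gaussianReal 0 v) = Real.exp (-v * t ^ 2 / 2) := by
  have h := charFun_gaussianReal (μ := 0) (v := v) t
  rw [charFun_apply_real] at h
  have h2 := congrArg Complex.re h
  have hInt : Integrable (fun x : ℝ => Complex.exp (t * x * Complex.I)) (gaussianReal 0 v) := by
    refine (integrable_const (1 : ℝ)).mono' (by fun_prop) (Eventually.of_forall fun x => ?_)
    rw [← Complex.ofReal_mul, Complex.norm_exp_ofReal_mul_I]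
  have h3 := integral_re hInt
  simp only [RCLike.re_to_complex] at h3
  rw [← h3] at h2
  convert h2 using 1
  · refine integral_congr_ae (Eventually.of_forall fun x => ?_)
    simp only
    rw [← Complex.ofReal_mul, Complex.exp_ofReal_mul_I_re]
  · rw [show (t * (0 : ℝ) * Complex.I - (v : ℝ) * t ^ 2 / 2 : ℂ) =
      ((-v * t ^ 2 / 2 : ℝ) : ℂ) by push_cast; ring, Complex.exp_ofReal_re]

theorem integral_one_sub_exp_div_sq (v : NNReal) :
    ∫ t : ℝ, (1 - Real.exp (-v * t ^ 2 / 2)) / t ^ 2 =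
      (Real.sqrt v * Real.sqrt (2 / Real.pi)) * ∫ t, absKernel 1 t := by
  rw [← integral_abs_gaussianReal, ← integral_mul_const]
  simp_rw [← integral_absKernel]
  rw [integral_integral_swap]
  · refine integral_congr_ae (Eventually.of_forall fun t => ?_)
    simp only [absKernel]
    rw [integral_div, integral_sub (integrable_const _), integral_cos_gaussianReal]
    · simp
    · exact (integrable_const (1 : ℝ)).mono' (by fun_prop)
        (Eventually.of_forall fun x => Real.abs_cos_le_one _)
  · rw [integrable_prod_iff measurable_absKernel.aestronglyMeasurable]
    refine ⟨Eventually.of_forall integrable_absKernel, ?_⟩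
    have : (fun x => ∫ t, ‖Function.uncurry absKernel (x, t)‖) =
        fun x : ℝ => |x| * ∫ t, absKernel 1 t := by
      funext x
      rw [← integral_absKernel]
      refine integral_congr_ae (Eventually.of_forall fun t => ?_)
      exact Real.norm_of_nonneg (absKernel_nonneg x t)
    rw [this]
    have h1 := (memLp_id_gaussianReal (μ := 0) (v := v) 1).integrable (by norm_num)
    exact h1.abs.mul_const _

/-- The average of `f` over `{1, …, n}`. -/
def meanUpTo (f : ℕ → ℝ) (n : ℕ) : ℝ := (∑ m ∈ Finset.Icc 1 n, f m) / n

theorem tendsto_mean_abs {x : ℕ → ℕ → ℝ} {v : NNReal} {C : ℝ}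
    (hC : ∀ᶠ n in atTop, meanUpTo (fun m => x n m ^ 2) n ≤ C)
    (hcos : ∀ t : ℝ, Tendsto (fun n => meanUpTo (fun m => Real.cos (t * x n m)) n) atTop
      (nhds (Real.exp (-v * t ^ 2 / 2)))) :
    Tendsto (fun n => meanUpTo (fun m => |x n m|) n) atTop
      (nhds (Real.sqrt v * Real.sqrt (2 / Real.pi))) := by
  have hc := integral_absKernel_one_pos
  set c := ∫ t, absKernel 1 t
  have key : Tendsto (fun n => ∫ t, meanUpTo (fun m => absKernel (x n m) t) n) atTop
      (nhds (∫ t : ℝ, (1 - Real.exp (-v * t ^ 2 / 2)) / t ^ 2)) := by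
    refine tendsto_integral_filter_of_dominated_convergence
      (fun t => (C / 2 + 2) * (1 + t ^ 2)⁻¹) ?_ ?_ (integrable_inv_one_add_sq.const_mul _) ?_
    · refine Eventually.of_forall fun n => ?_
      unfold meanUpTo
      exact ((Finset.measurable_sum _ fun m _ => measurable_absKernel.comp
        (measurable_prodMk_left (x := x n m))).div_const _).aestronglyMeasurable
    · filter_upwards [hC, eventually_gt_atTop 0] with n hn hn0
      refine Eventually.of_forall fun t => ?_
      have hnr : (0 : ℝ) < n := by exact_mod_cast hn0
      have h0 : 0 ≤ meanUpTo (fun m => absKernel (x n m) t) n :=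
        div_nonneg (Finset.sum_nonneg fun m _ => absKernel_nonneg _ _) hnr.le
      rw [Real.norm_of_nonneg h0]
      have h1 : meanUpTo (fun m => absKernel (x n m) t) n ≤
          (meanUpTo (fun m => x n m ^ 2) n / 2 + 2) * (1 + t ^ 2)⁻¹ := by
        unfold meanUpTo
        rw [div_le_iff₀ hnr]
        refine (Finset.sum_le_sum fun m _ => absKernel_le (x n m) t).trans (le_of_eq ?_)
        rw [← Finset.sum_mul, Finset.sum_add_distrib, ← Finset.sum_div]
        simp only [Finset.sum_const, Nat.card_Icc, nsmul_eq_mul]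
        push_cast [Nat.add_sub_cancel]
        field_simp
      refine h1.trans ?_
      gcongr
    · refine Eventually.of_forall fun t => ?_
      have h1 := ((hcos t).const_sub 1).div_const (t ^ 2)
      refine h1.congr' ?_
      filter_upwards [eventually_gt_atTop 0] with n hn0
      have hnr : (0 : ℝ) < n := by exact_mod_cast hn0
      unfold meanUpTo absKernel
      rw [← Finset.sum_div, Finset.sum_sub_distrib]
      simp only [Finset.sum_const, Nat.card_Icc, nsmul_eq_mul]
      push_cast [Nat.add_sub_cancel]
      field_simp
  rw [integral_one_sub_exp_div_sq] at key
  have h2 := key.div_const c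
  rw [mul_div_cancel_right₀ _ hc.ne'] at h2
  refine h2.congr fun n => ?_
  unfold meanUpTo
  rw [integral_div, integral_finsetSum _ fun m _ => integrable_absKernel _,
    Finset.sum_congr rfl fun m _ => integral_absKernel (x n m), ← Finset.sum_mul]
  field_simp
  rfl

theorem sum_Icc_ite_dvd (R : Type*) [NonAssocSemiring R] (n D : ℕ) :
    ∑ m ∈ Finset.Icc 1 n, (if D ∣ m then (1 : R) else 0) = (n / D : ℕ) := by
  rw [Finset.sum_boole, ← Nat.Ioc_filter_dvd_card_eq_div]
  rfl

theorem abs_floor_div_sub_inv_le {n D : ℕ} (hn : 0 < n) (hD : 0 < D) {a : ℝ} (ha0 : 0 ≤ a)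
    (ha1 : a ≤ 1) :
    |((n / D : ℕ) : ℝ) / n - 1 / D| ≤ (D : ℝ) ^ a / D * (n : ℝ) ^ (-a) := by
  have hn' : (0 : ℝ) < n := by exact_mod_cast hn
  have hD' : (0 : ℝ) < D := by exact_mod_cast hD
  have hlow : ((n / D : ℕ) : ℝ) ≤ n / D := Nat.cast_div_le
  have hup : (n : ℝ) / D - 1 < (n / D : ℕ) := by
    have := Nat.lt_floor_add_one ((n : ℝ) / D)
    rw [Nat.floor_div_eq_div] at this
    linarith
  have hnonneg : (0 : ℝ) ≤ (n / D : ℕ) := by positivity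
  have e : ((n / D : ℕ) : ℝ) / n - 1 / D = (((n / D : ℕ) : ℝ) - n / D) / n := by field_simp
  have e2 : (D : ℝ) ^ a / D * (n : ℝ) ^ (-a) = ((n : ℝ) / D) ^ (1 - a) / n := by
    rw [Real.div_rpow hn'.le hD'.le, Real.rpow_sub hn', Real.rpow_sub hD', Real.rpow_one,
      Real.rpow_one, Real.rpow_neg hn'.le]
    field_simp
  rw [e, e2, abs_div, abs_of_pos hn', abs_of_nonpos (by linarith)]
  refine div_le_div_of_nonneg_right ?_ hn'.le
  rcases le_total 1 ((n : ℝ) / D) with h | h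
  · exact le_trans (by linarith) (Real.one_le_rpow h (by linarith))
  · have h3 := Real.rpow_le_rpow_of_exponent_ge (x := (n : ℝ) / D) (by positivity) h
      (show 1 - a ≤ 1 by linarith)
    rw [Real.rpow_one] at h3
    linarith

theorem prod_dvd_iff_of_primes {T : Finset ℕ} (hT : ∀ p ∈ T, p.Prime) (m : ℕ) :
    ∏ p ∈ T, p ∣ m ↔ ∀ p ∈ T, p ∣ m := by
  refine ⟨fun h p hp => (Finset.dvd_prod_of_mem _ hp).trans h, fun h => ?_⟩
  exact Finset.prod_primes_dvd m (fun p hp => (hT p hp).prime) h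

theorem norm_mean_prod_sub_prod_le {T : Finset ℕ} (hT : ∀ p ∈ T, p.Prime) {h : ℕ → ℂ}
    {ε u : ℝ} {n : ℕ} (hn : 1 < n) (hu0 : 0 ≤ u) (hu : u ≤ Real.log n)
    (hTu : ∀ p ∈ T, u * Real.log p ≤ Real.log n) (hh : ∀ p ∈ T, ‖h p‖ ≤ ε) (hε : 0 ≤ ε) :
    ‖(∑ m ∈ Finset.Icc 1 n, ∏ p ∈ T with p ∣ m, (1 + h p)) / n - ∏ p ∈ T, (1 + h p / p)‖ ≤
      Real.exp (-u + ε * Real.exp 1 * ∑ p ∈ T, 1 / (p : ℝ)) := by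
  have hn' : (0 : ℝ) < n := by exact_mod_cast (by omega : 0 < n)
  have hlog : 0 < Real.log n := Real.log_pos (by exact_mod_cast hn)
  set a := u / Real.log n with ha
  have ha0 : 0 ≤ a := by positivity
  have ha1 : a ≤ 1 := (div_le_one hlog).2 hu
  have h1 (m : ℕ) : ∏ p ∈ T with p ∣ m, (1 + h p) =
      ∑ D ∈ T.powerset, (∏ p ∈ D, h p) * (if ∏ p ∈ D, p ∣ m then 1 else 0) := by
    rw [Finset.prod_one_add, ← Finset.sum_filter_add_sum_filter_not T.powerset
      (fun D => ∏ p ∈ D, p ∣ m)]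
    rw [Finset.sum_eq_zero (s := T.powerset.filter fun D => ¬ ∏ p ∈ D, p ∣ m), add_zero]
    · refine Finset.sum_congr ?_ fun D hD => ?_
      · ext D
        simp only [Finset.mem_powerset, Finset.mem_filter]
        constructor
        · intro hD
          have hDT : D ⊆ T := hD.trans (Finset.filter_subset _ _)
          exact ⟨hDT, (prod_dvd_iff_of_primes (fun p hp => hT p (hDT hp)) m).2
            fun p hp => (Finset.mem_filter.1 (hD hp)).2⟩
        · rintro ⟨hDT, hD⟩ p hp
          exact Finset.mem_filter.2 ⟨hDT hp,
            (prod_dvd_iff_of_primes (fun p hp => hT p (hDT hp)) m).1 hD p hp⟩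
      · simp [(Finset.mem_filter.1 hD).2]
    · intro D hD
      simp [(Finset.mem_filter.1 hD).2]
  have h2 : (∑ m ∈ Finset.Icc 1 n, ∏ p ∈ T with p ∣ m, (1 + h p)) / n -
      ∏ p ∈ T, (1 + h p / p) = ∑ D ∈ T.powerset, (∏ p ∈ D, h p) *
        ((((n / ∏ p ∈ D, p : ℕ) : ℝ) / n - 1 / (∏ p ∈ D, p : ℕ) : ℝ) : ℂ) := by
    simp_rw [h1]
    rw [Finset.sum_comm, Finset.prod_one_add, Finset.sum_div, ← Finset.sum_sub_distrib]
    refine Finset.sum_congr rfl fun D _ => ?_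
    rw [← Finset.mul_sum, Finset.prod_div_distrib]
    rw [sum_Icc_ite_dvd]
    push_cast
    ring
  rw [h2]
  have h3 : ∀ D ∈ T.powerset, ‖(∏ p ∈ D, h p) *
        ((((n / ∏ p ∈ D, p : ℕ) : ℝ) / n - 1 / (∏ p ∈ D, p : ℕ) : ℝ) : ℂ)‖ ≤
      (n : ℝ) ^ (-a) * ∏ p ∈ D, (ε * Real.exp 1 * (1 / (p : ℝ))) := by
    intro D hD
    have hDT := Finset.mem_powerset.1 hD
    have hpos : 0 < ∏ p ∈ D, p := Finset.prod_pos fun p hp => (hT p (hDT hp)).pos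
    rw [norm_mul, Complex.norm_real, Real.norm_eq_abs, norm_prod]
    refine (mul_le_mul_of_nonneg_left (abs_floor_div_sub_inv_le (by omega) hpos ha0 ha1)
      (Finset.prod_nonneg fun p _ => norm_nonneg _)).trans ?_
    rw [← mul_assoc, mul_comm]
    refine mul_le_mul_of_nonneg_left ?_ (by positivity)
    rw [Nat.cast_prod, ← Real.finsetProd_rpow _ _ (fun p _ => Nat.cast_nonneg p),
      ← Finset.prod_div_distrib, ← Finset.prod_mul_distrib]
    refine Finset.prod_le_prod (fun p _ => by positivity) fun p hp => ?_
    have hp0 : (0 : ℝ) < p := by exact_mod_cast (hT p (hDT hp)).pos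
    have hpe : (p : ℝ) ^ a ≤ Real.exp 1 := by
      rw [Real.rpow_def_of_pos hp0]
      refine Real.exp_le_exp.2 ?_
      rw [ha, mul_div_assoc', div_le_one hlog, mul_comm]
      exact hTu p (hDT hp)
    rw [mul_assoc, mul_one_div]
    have := hh p (hDT hp)
    gcongr
  refine (norm_sum_le_of_le _ h3).trans ?_
  rw [← Finset.mul_sum, ← Finset.prod_one_add, Real.exp_add]
  have h4 : (n : ℝ) ^ (-a) = Real.exp (-u) := by
    rw [Real.rpow_def_of_pos hn', ha]
    congr 1
    field_simp
  rw [h4]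
  refine mul_le_mul_of_nonneg_left ?_ (Real.exp_pos _).le
  rw [Finset.mul_sum, Real.exp_sum]
  refine Finset.prod_le_prod (fun p _ => by positivity) fun p _ => ?_
  rw [add_comm]
  exact Real.add_one_le_exp _

theorem norm_prod_sub_prod_le_sum {ι : Type*} (s : Finset ι) (f g : ι → ℂ)
    (hf : ∀ i ∈ s, ‖f i‖ ≤ 1) (hg : ∀ i ∈ s, ‖g i‖ ≤ 1) :
    ‖∏ i ∈ s, f i - ∏ i ∈ s, g i‖ ≤ ∑ i ∈ s, ‖f i - g i‖ := by
  classical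
  induction s using Finset.induction_on with
  | empty => simp
  | insert a s ha ih =>
    rw [Finset.prod_insert ha, Finset.prod_insert ha, Finset.sum_insert ha]
    have h1 : ‖∏ i ∈ s, f i‖ ≤ 1 := by
      rw [norm_prod]
      exact Finset.prod_le_one (fun _ _ => norm_nonneg _)
        fun i hi => hf i (Finset.mem_insert_of_mem hi)
    have h2 := ih (fun i hi => hf i (Finset.mem_insert_of_mem hi))
      (fun i hi => hg i (Finset.mem_insert_of_mem hi))
    have h3 := hg a (Finset.mem_insert_self a s)
    rw [show f a * ∏ i ∈ s, f i - g a * ∏ i ∈ s, g i =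
      (f a - g a) * ∏ i ∈ s, f i + g a * (∏ i ∈ s, f i - ∏ i ∈ s, g i) by ring]
    refine (norm_add_le _ _).trans ?_
    rw [norm_mul, norm_mul]
    have := norm_nonneg (f a - g a)
    have := norm_nonneg (∏ i ∈ s, f i - ∏ i ∈ s, g i)
    nlinarith

theorem norm_prod_one_add_sub_exp_le {T : Finset ℕ} (hT : ∀ p ∈ T, 2 ≤ p) {h : ℕ → ℂ}
    {ε : ℝ} (hre : ∀ p ∈ T, ‖1 + h p‖ ≤ 1) (hh : ∀ p ∈ T, ‖h p‖ ≤ ε) (hε : ε ≤ 1) :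
    ‖∏ p ∈ T, (1 + h p / p) - Complex.exp (∑ p ∈ T, h p / p)‖ ≤
      ε ^ 2 * ∑' n : ℕ, 1 / (n : ℝ) ^ 2 := by
  rw [Complex.exp_sum]
  have hp0 : ∀ p ∈ T, (2 : ℝ) ≤ p := fun p hp => by exact_mod_cast hT p hp
  have hnorm : ∀ p ∈ T, ‖h p / p‖ ≤ ε / p := fun p hp => by
    rw [norm_div, Complex.norm_natCast]
    exact div_le_div_of_nonneg_right (hh p hp) (by positivity)
  refine (norm_prod_sub_prod_le_sum T _ _ (fun p hp => ?_) fun p hp => ?_).trans ?_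
  · have e : 1 + h p / p = ((1 - 1 / p : ℝ) : ℂ) + ((1 / p : ℝ) : ℂ) * (1 + h p) := by
      push_cast; ring
    rw [e]
    refine (norm_add_le _ _).trans ?_
    have h1 : 1 / (p : ℝ) ≤ 1 := by
      rw [div_le_one (by linarith [hp0 p hp])]; linarith [hp0 p hp]
    have h0 : 0 ≤ 1 / (p : ℝ) := by positivity
    rw [norm_mul, Complex.norm_real, Complex.norm_real, Real.norm_of_nonneg (by linarith),
      Real.norm_of_nonneg h0]
    nlinarith [hre p hp]
  · rw [Complex.norm_exp, Real.exp_le_one_iff, Complex.div_natCast_re]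
    refine div_nonpos_of_nonpos_of_nonneg ?_ (by positivity)
    have := (Complex.re_le_norm (1 + h p)).trans (hre p hp)
    simp at this
    exact this
  · have h1 : ∀ p ∈ T, ‖1 + h p / p - Complex.exp (h p / p)‖ ≤ ε ^ 2 * (1 / (p : ℝ) ^ 2) := by
      intro p hp
      have hε0 : 0 ≤ ε := (norm_nonneg _).trans (hh p hp)
      have hle : ε / p ≤ 1 := by
        rw [div_le_one (by linarith [hp0 p hp])]; linarith [hp0 p hp]
      have := Complex.norm_exp_sub_one_sub_id_le ((hnorm p hp).trans hle)
      rw [← norm_neg]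
      refine le_trans (le_of_eq ?_) (this.trans ?_)
      · congr 1; ring
      · calc ‖h p / p‖ ^ 2 ≤ (ε / p) ^ 2 := by gcongr; exact hnorm p hp
          _ = _ := by ring
    refine (Finset.sum_le_sum h1).trans ?_
    rw [← Finset.mul_sum]
    refine mul_le_mul_of_nonneg_left ?_ (sq_nonneg ε)
    exact (Real.summable_one_div_nat_pow.2 one_lt_two).sum_le_tsum _ fun _ _ => by positivity

theorem meanUpTo_add (f g : ℕ → ℝ) (n : ℕ) :
    meanUpTo (fun m => f m + g m) n = meanUpTo f n + meanUpTo g n := by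
  simp only [meanUpTo, Finset.sum_add_distrib, add_div]

theorem meanUpTo_sub (f g : ℕ → ℝ) (n : ℕ) :
    meanUpTo (fun m => f m - g m) n = meanUpTo f n - meanUpTo g n := by
  simp only [meanUpTo, Finset.sum_sub_distrib, sub_div]

theorem meanUpTo_const_mul (c : ℝ) (f : ℕ → ℝ) (n : ℕ) :
    meanUpTo (fun m => c * f m) n = c * meanUpTo f n := by
  simp only [meanUpTo, ← Finset.mul_sum, mul_div_assoc]

theorem meanUpTo_const (c : ℝ) {n : ℕ} (hn : 0 < n) : meanUpTo (fun _ => c) n = c := by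
  have : (n : ℝ) ≠ 0 := by positivity
  simp only [meanUpTo, Finset.sum_const, Nat.card_Icc, nsmul_eq_mul, Nat.add_sub_cancel]
  field_simp

theorem meanUpTo_sum {ι : Type*} (s : Finset ι) (f : ι → ℕ → ℝ) (n : ℕ) :
    meanUpTo (fun m => ∑ i ∈ s, f i m) n = ∑ i ∈ s, meanUpTo (f i) n := by
  simp only [meanUpTo]
  rw [Finset.sum_comm, Finset.sum_div]

theorem meanUpTo_mono {f g : ℕ → ℝ} {n : ℕ} (h : ∀ m, 1 ≤ m → m ≤ n → f m ≤ g m) :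
    meanUpTo f n ≤ meanUpTo g n :=
  div_le_div_of_nonneg_right (Finset.sum_le_sum fun m hm =>
    h m (Finset.mem_Icc.1 hm).1 (Finset.mem_Icc.1 hm).2) (Nat.cast_nonneg n)

theorem meanUpTo_nonneg {f : ℕ → ℝ} {n : ℕ} (h : ∀ m, 1 ≤ m → m ≤ n → 0 ≤ f m) :
    0 ≤ meanUpTo f n :=
  div_nonneg (Finset.sum_nonneg fun m hm =>
    h m (Finset.mem_Icc.1 hm).1 (Finset.mem_Icc.1 hm).2) (Nat.cast_nonneg n)

theorem meanUpTo_dvd_le (D n : ℕ) :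
    meanUpTo (fun m => if D ∣ m then 1 else 0) n ≤ 1 / D := by
  rcases Nat.eq_zero_or_pos n with rfl | hn
  · simp [meanUpTo]
  rcases Nat.eq_zero_or_pos D with rfl | hD
  · rw [meanUpTo, sum_Icc_ite_dvd]; simp
  rw [meanUpTo, sum_Icc_ite_dvd, div_le_div_iff₀ (by positivity) (by positivity), one_mul]
  exact_mod_cast Nat.div_mul_le_self n D

theorem le_meanUpTo_dvd {n : ℕ} (D : ℕ) (hn : 0 < n) :
    1 / D - 1 / n ≤ meanUpTo (fun m => if D ∣ m then 1 else 0) n := by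
  rw [meanUpTo, sum_Icc_ite_dvd]
  have hn' : (0 : ℝ) < n := by exact_mod_cast hn
  have hup := Nat.lt_floor_add_one ((n : ℝ) / D)
  rw [Nat.floor_div_eq_div] at hup
  rw [le_div_iff₀ hn', sub_mul, one_div_mul_cancel hn'.ne', one_div_mul_eq_div]
  linarith

/-- The number of elements of `T` dividing `m`. -/
def omegaIn (T : Finset ℕ) (m : ℕ) : ℕ := (T.filter (· ∣ m)).card

/-- The sum of the reciprocals of the elements of `T`. -/
def recipSum (T : Finset ℕ) : ℝ := ∑ p ∈ T, 1 / (p : ℝ)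

theorem recipSum_nonneg (T : Finset ℕ) : 0 ≤ recipSum T :=
  Finset.sum_nonneg fun _ _ => by positivity

theorem omegaIn_eq_sum (T : Finset ℕ) (m : ℕ) :
    (omegaIn T m : ℝ) = ∑ p ∈ T, if p ∣ m then 1 else 0 := by
  rw [Finset.sum_boole, omegaIn]

theorem mean_omegaIn_le (T : Finset ℕ) (n : ℕ) :
    meanUpTo (fun m => (omegaIn T m : ℝ)) n ≤ recipSum T := by
  simp_rw [omegaIn_eq_sum, meanUpTo_sum]
  exact Finset.sum_le_sum fun p _ => meanUpTo_dvd_le p n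

theorem le_mean_omegaIn (T : Finset ℕ) {n : ℕ} (hn : 0 < n) :
    recipSum T - T.card / n ≤ meanUpTo (fun m => (omegaIn T m : ℝ)) n := by
  simp_rw [omegaIn_eq_sum, meanUpTo_sum]
  have : recipSum T - T.card / n = ∑ p ∈ T, (1 / (p : ℝ) - 1 / n) := by
    rw [Finset.sum_sub_distrib, Finset.sum_const, nsmul_eq_mul, mul_one_div, recipSum]
  rw [this]
  exact Finset.sum_le_sum fun p _ => le_meanUpTo_dvd p hn

theorem abs_mean_omegaIn_sub_le {T : Finset ℕ} {n : ℕ} (hn : 0 < n)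
    (hT : T ⊆ Finset.Icc 1 n) :
    |meanUpTo (fun m => (omegaIn T m : ℝ)) n - recipSum T| ≤ 1 := by
  have h1 := mean_omegaIn_le T n
  have h2 := le_mean_omegaIn T hn
  have h3 : (T.card : ℝ) / n ≤ 1 := by
    rw [div_le_one (by exact_mod_cast hn)]
    have := Finset.card_le_card hT
    rw [Nat.card_Icc, Nat.add_sub_cancel] at this
    exact_mod_cast this
  rw [abs_le]
  constructor <;> linarith

theorem mean_omegaIn_descPochhammer_le {T : Finset ℕ} (hT : ∀ p ∈ T, p.Prime) (n : ℕ) :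
    meanUpTo (fun m => (omegaIn T m : ℝ) * (omegaIn T m - 1)) n ≤ recipSum T ^ 2 := by
  have h (m : ℕ) : (omegaIn T m : ℝ) * (omegaIn T m - 1) =
      ∑ x ∈ T.offDiag, if x.1 * x.2 ∣ m then 1 else 0 := by
    rw [Finset.sum_boole]
    have : {x ∈ T.offDiag | x.1 * x.2 ∣ m} = (T.filter (· ∣ m)).offDiag := by
      ext ⟨p, q⟩
      simp only [Finset.mem_filter, Finset.mem_offDiag]
      constructor
      · rintro ⟨⟨hp, hq, hpq⟩, hd⟩
        exact ⟨⟨hp, (dvd_mul_right _ _).trans hd⟩, ⟨hq, (dvd_mul_left _ _).trans hd⟩, hpq⟩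
      · rintro ⟨⟨hp, hpd⟩, ⟨hq, hqd⟩, hpq⟩
        exact ⟨⟨hp, hq, hpq⟩, Nat.Coprime.mul_dvd_of_dvd_of_dvd
          ((Nat.coprime_primes (hT p hp) (hT q hq)).2 hpq) hpd hqd⟩
    rw [this, Finset.offDiag_card, Nat.cast_sub (Nat.le_mul_self _), omegaIn]
    push_cast
    ring
  simp_rw [h, meanUpTo_sum]
  refine (Finset.sum_le_sum fun x _ => meanUpTo_dvd_le (x.1 * x.2) n).trans ?_
  rw [sq, recipSum, Finset.sum_mul_sum, ← Finset.sum_product']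
  refine (Finset.sum_le_sum_of_subset_of_nonneg (t := T ×ˢ T) ?_ fun _ _ _ => by positivity).trans
    (le_of_eq ?_)
  · intro x hx
    have := Finset.mem_offDiag.1 hx
    exact Finset.mem_product.2 ⟨this.1, this.2.1⟩
  · refine Finset.sum_congr rfl fun x _ => ?_
    push_cast
    ring

/-- A one-sided form of the Turán–Kubilius inequality. -/
theorem mean_sq_omegaIn_sub_le {T : Finset ℕ} (hT : ∀ p ∈ T, p.Prime) {n : ℕ} (hn : 0 < n)
    (hTn : T ⊆ Finset.Icc 1 n) :
    meanUpTo (fun m => ((omegaIn T m : ℝ) - recipSum T) ^ 2) n ≤ 3 * recipSum T := by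
  have h1 := mean_omegaIn_descPochhammer_le hT n
  have h2 := mean_omegaIn_le T n
  have h3 := (abs_le.1 (abs_mean_omegaIn_sub_le hn hTn)).1
  have h0 := recipSum_nonneg T
  set S := recipSum T
  have e : meanUpTo (fun m => ((omegaIn T m : ℝ) - S) ^ 2) n =
      meanUpTo (fun m => (omegaIn T m : ℝ) * (omegaIn T m - 1)) n +
        (1 - 2 * S) * meanUpTo (fun m => (omegaIn T m : ℝ)) n + S ^ 2 := by
    conv_rhs => rw [← meanUpTo_const (S ^ 2) hn]
    rw [← meanUpTo_const_mul, ← meanUpTo_add, ← meanUpTo_add]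
    congr 1
    funext m
    ring
  rw [e]
  nlinarith

/-- The primes `p ≤ x` with `p ≡ 1 (mod q)`. -/
def primesMod (q : ℕ) (x : ℝ) : Finset ℕ :=
  (Finset.Icc 1 ⌊x⌋₊).filter fun p => p.Prime ∧ p % q = 1 % q

theorem mem_primesMod {q p : ℕ} {x : ℝ} (hx : 0 ≤ x) :
    p ∈ primesMod q x ↔ (p : ℝ) ≤ x ∧ p.Prime ∧ p % q = 1 % q := by
  rw [primesMod, Finset.mem_filter, Finset.mem_Icc, Nat.le_floor_iff hx]
  exact ⟨fun h => ⟨h.1.2, h.2⟩, fun h => ⟨⟨h.2.1.one_lt.le, h.1⟩, h.2⟩⟩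

section Mertens

open ArithmeticFunction vonMangoldt

theorem exists_abs_tsum_residueClass_sub_le (q : ℕ) [NeZero q] :
    ∃ C : ℝ, ∀ s ∈ Set.Ioc (1 : ℝ) 2,
      |∑' n, residueClass (1 : ZMod q) n / (n : ℝ) ^ s - (q.totient : ℝ)⁻¹ / (s - 1)| ≤ C := by
  have ha : IsUnit (1 : ZMod q) := isUnit_one
  have H {x : ℝ} (hx : 1 < x) :
      ∑' n, residueClass (1 : ZMod q) n / (n : ℝ) ^ x =
        (LFunctionResidueClassAux (1 : ZMod q) x).re + (q.totient : ℝ)⁻¹ / (x - 1) := by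
    refine Complex.ofReal_injective ?_
    simp only [Complex.ofReal_tsum, Complex.ofReal_div, Complex.ofReal_cpow (Nat.cast_nonneg _),
      Complex.ofReal_natCast, Complex.ofReal_add, Complex.ofReal_inv, Complex.ofReal_sub,
      Complex.ofReal_one]
    simp_rw [← LFunctionResidueClassAux_real ha hx,
      eqOn_LFunctionResidueClassAux ha <| Set.mem_ofPred.mpr (Complex.ofReal_re x ▸ hx),
      sub_add_cancel, LSeries, LSeries.term]
    refine tsum_congr fun n => ?_
    split_ifs with hn
    · simp only [hn, residueClass_apply_zero, Complex.ofReal_zero, zero_div]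
    · rfl
  have hcont : ContinuousOn (fun x : ℝ => (LFunctionResidueClassAux (1 : ZMod q) x).re)
      (Set.Icc 1 2) :=
    Complex.continuous_re.continuousOn.comp (t := Set.univ)
      (continuousOn_LFunctionResidueClassAux 1) (fun _ _ => trivial) |>.comp
      Complex.continuous_ofReal.continuousOn fun x hx => by
        simpa only [Set.mem_ofPred_eq, Complex.ofReal_re] using hx.1
  obtain ⟨C, hC⟩ := isCompact_Icc.exists_bound_of_continuousOn hcont
  refine ⟨C, fun s hs => ?_⟩
  rw [H hs.1, add_sub_cancel_right]
  exact hC s ⟨hs.1.le, hs.2⟩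

/-- `log n` if `n` is a prime congruent to `1` modulo `q`, and `0` otherwise. -/
def logPrimeMod (q n : ℕ) : ℝ := if n.Prime ∧ n % q = 1 % q then Real.log n else 0

/-- `1` if `n` is a prime congruent to `1` modulo `q`, and `0` otherwise. -/
def indPrimeMod (q n : ℕ) : ℝ := if n.Prime ∧ n % q = 1 % q then 1 else 0

theorem logPrimeMod_nonneg (q n : ℕ) : 0 ≤ logPrimeMod q n := by
  unfold logPrimeMod
  split_ifs
  · exact Real.log_natCast_nonneg n
  · rfl

theorem indPrimeMod_nonneg (q n : ℕ) : 0 ≤ indPrimeMod q n := by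
  unfold indPrimeMod
  split_ifs <;> norm_num

theorem logPrimeMod_eq (q n : ℕ) :
    logPrimeMod q n = if n.Prime then residueClass (1 : ZMod q) n else 0 := by
  unfold logPrimeMod residueClass
  rw [Set.indicator_apply]
  have h : n ∈ {n : ℕ | (n : ZMod q) = 1} ↔ n % q = 1 % q := by
    rw [Set.mem_ofPred_eq, ← Nat.cast_one, ZMod.natCast_eq_natCast_iff]
    rfl
  by_cases hp : n.Prime
  · simp only [hp, true_and, if_true, h]
    split_ifs
    · rw [vonMangoldt_apply_prime hp]
    · rfl
  · simp [hp]

theorem summable_logPrimeMod (q : ℕ) {s : ℝ} (hs : 1 < s) :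
    Summable fun n : ℕ => logPrimeMod q n / (n : ℝ) ^ s := by
  have h := LSeries.summable_real_of_abscissaOfAbsConv_lt (f := residueClass (1 : ZMod q)) (x := s)
    ((abscissaOfAbsConv_residueClass_le_one 1).trans_lt (by exact_mod_cast hs))
  refine h.of_nonneg_of_le (fun n => div_nonneg (logPrimeMod_nonneg q n) (by positivity))
    fun n => ?_
  refine div_le_div_of_nonneg_right ?_ (by positivity)
  rw [logPrimeMod_eq]
  split_ifs
  · rfl
  · exact residueClass_nonneg _ n

theorem exists_abs_tsum_logPrimeMod_sub_le (q : ℕ) [NeZero q] :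
    ∃ C : ℝ, ∀ s ∈ Set.Ioc (1 : ℝ) 2,
      |∑' n, logPrimeMod q n / (n : ℝ) ^ s - (q.totient : ℝ)⁻¹ / (s - 1)| ≤ C := by
  obtain ⟨C, hC⟩ := exists_abs_tsum_residueClass_sub_le q
  have hsum := summable_residueClass_non_primes_div (1 : ZMod q)
  refine ⟨C + ∑' n : ℕ, (if n.Prime then 0 else residueClass (1 : ZMod q) n) / n,
    fun s hs => ?_⟩
  have h0 (n : ℕ) : 0 ≤ (if n.Prime then 0 else residueClass (1 : ZMod q) n) := by
    split_ifs
    · rfl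
    · exact residueClass_nonneg _ n
  have hle (n : ℕ) : (if n.Prime then 0 else residueClass (1 : ZMod q) n) / (n : ℝ) ^ s ≤
      (if n.Prime then 0 else residueClass (1 : ZMod q) n) / n := by
    rcases n.eq_zero_or_pos with rfl | hn
    · simp
    · refine div_le_div_of_nonneg_left (h0 n) (by exact_mod_cast hn) ?_
      conv_lhs => rw [← Real.rpow_one n]
      exact Real.rpow_le_rpow_of_exponent_le (by exact_mod_cast hn) hs.1.le
  have hnn (n : ℕ) : 0 ≤ (if n.Prime then 0 else residueClass (1 : ZMod q) n) / (n : ℝ) ^ s :=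
    div_nonneg (h0 n) (by positivity)
  have hsum2 := hsum.of_nonneg_of_le hnn hle
  have e : ∑' n, residueClass (1 : ZMod q) n / (n : ℝ) ^ s =
      ∑' n, logPrimeMod q n / (n : ℝ) ^ s +
        ∑' n : ℕ, (if n.Prime then 0 else residueClass (1 : ZMod q) n) / (n : ℝ) ^ s := by
    rw [← (summable_logPrimeMod q hs.1).tsum_add hsum2]
    refine tsum_congr fun n => ?_
    rw [← add_div, logPrimeMod_eq]
    split_ifs <;> simp
  have h1 := hsum2.tsum_le_tsum hle hsum
  have h2 : 0 ≤ ∑' n : ℕ, (if n.Prime then 0 else residueClass (1 : ZMod q) n) / (n : ℝ) ^ s :=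
    tsum_nonneg hnn
  have h3 := hC s hs
  rw [e] at h3
  rw [abs_le] at h3 ⊢
  constructor <;> linarith [h3.1, h3.2]

theorem summable_indPrimeMod (q : ℕ) {s : ℝ} (hs : 1 < s) :
    Summable fun n : ℕ => indPrimeMod q n / (n : ℝ) ^ s := by
  refine (Real.summable_one_div_nat_rpow.2 hs).of_nonneg_of_le
    (fun n => div_nonneg (indPrimeMod_nonneg q n) (by positivity)) fun n => ?_
  refine div_le_div_of_nonneg_right ?_ (by positivity)
  unfold indPrimeMod
  split_ifs <;> norm_num

theorem LSeries_ofReal_eq {f : ℕ → ℝ} (hf : f 0 = 0) (s : ℝ) :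
    LSeries (fun n => (f n : ℂ)) s = ((∑' n, f n / (n : ℝ) ^ s : ℝ) : ℂ) := by
  rw [LSeries, Complex.ofReal_tsum]
  refine tsum_congr fun n => ?_
  rw [LSeries.term]
  split_ifs with hn
  · simp [hn, hf]
  · rw [Complex.ofReal_div, Complex.ofReal_cpow (Nat.cast_nonneg _), Complex.ofReal_natCast]

theorem hasDerivAt_tsum_indPrimeMod (q : ℕ) {s : ℝ} (hs : 1 < s) :
    HasDerivAt (fun s : ℝ => ∑' n, indPrimeMod q n / (n : ℝ) ^ s)
      (-∑' n, logPrimeMod q n / (n : ℝ) ^ s) s := by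
  have hab : LSeries.abscissaOfAbsConv (fun n => (indPrimeMod q n : ℂ)) < ((s : ℂ).re : EReal) := by
    rw [Complex.ofReal_re]
    refine lt_of_le_of_lt (LSeries.abscissaOfAbsConv_le_of_le_const (f := fun n =>
      (indPrimeMod q n : ℂ)) ⟨1, fun n _ => ?_⟩) (by exact_mod_cast hs)
    rw [Complex.norm_real, Real.norm_of_nonneg (indPrimeMod_nonneg q n)]
    unfold indPrimeMod
    split_ifs <;> norm_num
  have h := (LSeries_hasDerivAt hab).real_of_complex
  have e0 : LSeries.logMul (fun n => (indPrimeMod q n : ℂ)) = fun n => (logPrimeMod q n : ℂ) := by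
    funext n
    rw [LSeries.logMul, ← Complex.natCast_log, ← Complex.ofReal_mul, logPrimeMod, indPrimeMod]
    split_ifs <;> simp
  rw [e0, LSeries_ofReal_eq (by simp [logPrimeMod, Nat.not_prime_zero])] at h
  have e1 : (fun x : ℝ => (LSeries (fun n => (indPrimeMod q n : ℂ)) x).re) =
      fun s => ∑' n, indPrimeMod q n / (n : ℝ) ^ s := by
    funext x
    rw [LSeries_ofReal_eq (by simp [indPrimeMod, Nat.not_prime_zero]), Complex.ofReal_re]
  rw [e1, ← Complex.ofReal_neg, Complex.ofReal_re] at h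
  exact h

theorem exists_abs_tsum_indPrimeMod_add_log_le (q : ℕ) [NeZero q] :
    ∃ C : ℝ, ∀ s ∈ Set.Ioc (1 : ℝ) 2,
      |∑' n, indPrimeMod q n / (n : ℝ) ^ s + (q.totient : ℝ)⁻¹ * Real.log (s - 1)| ≤ C := by
  obtain ⟨C, hC⟩ := exists_abs_tsum_logPrimeMod_sub_le q
  set H : ℝ → ℝ := fun s =>
    ∑' n, indPrimeMod q n / (n : ℝ) ^ s + (q.totient : ℝ)⁻¹ * Real.log (s - 1) with hH
  have hderiv : ∀ s ∈ Set.Ioc (1 : ℝ) 2, HasDerivWithinAt H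
      (-(∑' n, logPrimeMod q n / (n : ℝ) ^ s - (q.totient : ℝ)⁻¹ / (s - 1))) (Set.Ioc 1 2) s := by
    intro s hs
    have h1 := hasDerivAt_tsum_indPrimeMod q hs.1
    have h2 := (((hasDerivAt_id s).sub_const 1).log (sub_pos.2 hs.1).ne').const_mul
      (q.totient : ℝ)⁻¹
    refine ((h1.add h2).congr_deriv ?_).hasDerivWithinAt
    simp only [id]
    ring
  have hbound : ∀ s ∈ Set.Ioc (1 : ℝ) 2,
      ‖-(∑' n, logPrimeMod q n / (n : ℝ) ^ s - (q.totient : ℝ)⁻¹ / (s - 1))‖ ≤ C := by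
    intro s hs
    rw [norm_neg]
    exact hC s hs
  have hC0 : 0 ≤ C := (norm_nonneg _).trans (hbound 2 ⟨one_lt_two, le_rfl⟩)
  refine ⟨C + |H 2|, fun s hs => ?_⟩
  have h3 := (convex_Ioc (1 : ℝ) 2).norm_image_sub_le_of_norm_hasDerivWithin_le hderiv hbound
    (x := 2) (y := s) ⟨one_lt_two, le_rfl⟩ hs
  have h4 : ‖s - 2‖ ≤ 1 := by
    rw [Real.norm_eq_abs, abs_le]
    constructor <;> linarith [hs.1, hs.2]
  have h5 : |H s| ≤ |H s - H 2| + |H 2| := by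
    simpa using abs_add_le (H s - H 2) (H 2)
  rw [Real.norm_eq_abs] at h3
  change |H s| ≤ _
  nlinarith

theorem recipSum_primesMod_eq_tsum (q : ℕ) {x : ℝ} (hx : 0 ≤ x) :
    HasSum (fun n : ℕ => if (n : ℝ) ≤ x then indPrimeMod q n / n else 0)
      (recipSum (primesMod q x)) := by
  have : recipSum (primesMod q x) = ∑ n ∈ primesMod q x,
      if (n : ℝ) ≤ x then indPrimeMod q n / n else 0 := by
    refine Finset.sum_congr rfl fun p hp => ?_
    have := (mem_primesMod hx).1 hp
    simp [indPrimeMod, this]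
  rw [this]
  refine hasSum_sum_of_ne_finset_zero fun n hn => ?_
  rw [mem_primesMod hx] at hn
  by_cases h : (n : ℝ) ≤ x
  · simp only [h, true_and] at hn
    simp [indPrimeMod, hn]
  · simp [h]

theorem one_le_log_of_three_le {x : ℝ} (hx : 3 ≤ x) : 1 ≤ Real.log x := by
  rw [Real.le_log_iff_exp_le (by linarith)]
  exact Real.exp_one_lt_three.le.trans hx

/-- Mertens' theorem for the primes congruent to `1` modulo `q`. -/
theorem exists_abs_recipSum_primesMod_sub_le {q : ℕ} (hq : 0 < q) :
    ∃ C : ℝ, ∀ x : ℝ, 3 ≤ x →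
      |recipSum (primesMod q x) - Real.log (Real.log x) / q.totient| ≤ C := by
  have : NeZero q := ⟨hq.ne'⟩
  obtain ⟨C₁, h₁⟩ := exists_abs_tsum_logPrimeMod_sub_le q
  obtain ⟨C₂, h₂⟩ := exists_abs_tsum_indPrimeMod_add_log_le q
  refine ⟨Real.exp 1 * ((q.totient : ℝ)⁻¹ + |C₁|) + C₂, fun x hx => ?_⟩
  have hx0 : 0 < x := by linarith
  have hL := one_le_log_of_three_le hx
  set L := Real.log x with hLdef
  have hL0 : 0 < L := by linarith
  have hs : 1 + 1 / L ∈ Set.Ioc (1 : ℝ) 2 := by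
    have : 1 / L ≤ 1 := (div_le_one hL0).2 hL
    have : 0 < 1 / L := by positivity
    constructor <;> linarith
  have h₁' := h₁ _ hs
  have h₂' := h₂ _ hs
  set s := 1 + 1 / L with hsdef
  have hs1 : s - 1 = 1 / L := by rw [hsdef]; ring
  rw [hs1] at h₁' h₂'
  rw [one_div, Real.log_inv] at h₂'
  have hterm (n : ℕ) : ‖(if (n : ℝ) ≤ x then indPrimeMod q n / n else 0) -
      indPrimeMod q n / (n : ℝ) ^ s‖ ≤ Real.exp 1 / L * (logPrimeMod q n / (n : ℝ) ^ s) := by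
    by_cases hn : n.Prime ∧ n % q = 1 % q
    swap
    · simp [indPrimeMod, logPrimeMod, hn]
    have hn1 : (1 : ℝ) < n := by exact_mod_cast hn.1.one_lt
    have hn0 : (0 : ℝ) < n := by linarith
    have hlogn : 0 < Real.log n := Real.log_pos hn1
    have hns : (n : ℝ) ^ s = n * Real.exp (Real.log n / L) := by
      rw [hsdef, Real.rpow_add hn0, Real.rpow_one, Real.rpow_def_of_pos hn0, mul_one_div]
    have hexp := Real.add_one_le_exp (Real.log n / L)
    have he1 : 1 ≤ Real.exp 1 := Real.one_le_exp zero_le_one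
    simp only [indPrimeMod, logPrimeMod, if_pos hn, hns]
    have hE := Real.exp_pos (Real.log n / L)
    set E := Real.exp (Real.log n / L)
    split_ifs with hnx
    · have hln : Real.log n ≤ L := Real.log_le_log hn0 hnx
      have hEe : E ≤ Real.exp 1 := Real.exp_le_exp.2 ((div_le_one hL0).2 hln)
      have hE1 : 1 ≤ E := Real.one_le_exp (by positivity)
      have key : E - 1 ≤ Real.exp 1 * (Real.log n / L) := by
        have h6 : 1 - Real.log n / L ≤ E⁻¹ := by
          rw [← Real.exp_neg]; linarith [Real.add_one_le_exp (-(Real.log n / L))]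
        have h7 : E * (1 - Real.log n / L) ≤ 1 := by
          calc E * (1 - Real.log n / L) ≤ E * E⁻¹ := by gcongr
            _ = 1 := mul_inv_cancel₀ hE.ne'
        have : 0 ≤ Real.log n / L := by positivity
        nlinarith
      rw [Real.norm_of_nonneg]
      · rw [show (1 : ℝ) / n - 1 / (n * E) = (E - 1) / (n * E) by field_simp,
          show Real.exp 1 / L * (Real.log n / (n * E)) =
            (Real.exp 1 * (Real.log n / L)) / (n * E) by field_simp]
        gcongr
      · rw [sub_nonneg]
        exact one_div_le_one_div_of_le hn0 (le_mul_of_one_le_right hn0.le hE1)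
    · have hln : L ≤ Real.log n := Real.log_le_log hx0 (not_le.1 hnx).le
      rw [zero_sub, norm_neg, Real.norm_of_nonneg (by positivity),
        show Real.exp 1 / L * (Real.log n / (n * E)) =
            (Real.exp 1 * (Real.log n / L)) / (n * E) by field_simp]
      gcongr
      have : 1 ≤ Real.log n / L := (one_le_div hL0).2 hln
      nlinarith
  have hsumL := summable_logPrimeMod q hs.1
  have hsumI := summable_indPrimeMod q hs.1
  have hS := recipSum_primesMod_eq_tsum q hx0.le
  have hdiff : |recipSum (primesMod q x) - ∑' n, indPrimeMod q n / (n : ℝ) ^ s| ≤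
      Real.exp 1 / L * ∑' n, logPrimeMod q n / (n : ℝ) ^ s := by
    rw [← hS.tsum_eq, ← hS.summable.tsum_sub hsumI, ← tsum_mul_left]
    exact tsum_of_norm_bounded (hsumL.mul_left _).hasSum hterm
  have hF : Real.exp 1 / L * ∑' n, logPrimeMod q n / (n : ℝ) ^ s ≤
      Real.exp 1 * ((q.totient : ℝ)⁻¹ + |C₁|) := by
    rw [div_mul_eq_mul_div, mul_div_assoc]
    refine mul_le_mul_of_nonneg_left ?_ (Real.exp_pos _).le
    rw [div_le_iff₀ hL0]
    have h8 := (abs_le.1 h₁').2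
    rw [div_div_eq_mul_div, div_one] at h8
    have : |C₁| ≤ |C₁| * L := le_mul_of_one_le_right (abs_nonneg _) hL
    linarith [le_abs_self C₁]
  have e : recipSum (primesMod q x) - Real.log L / q.totient =
      (recipSum (primesMod q x) - ∑' n, indPrimeMod q n / (n : ℝ) ^ s) +
      (∑' n, indPrimeMod q n / (n : ℝ) ^ s + (q.totient : ℝ)⁻¹ * -Real.log L) := by
    ring
  rw [e]
  exact (abs_add_le _ _).trans (add_le_add (hdiff.trans hF) h₂')

end Mertens

/-- The characteristic function of the difference of two counts of prime divisors. -/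
theorem abs_mean_cos_omegaIn_sub_le {P Q : Finset ℕ} (hP : ∀ p ∈ P, p.Prime)
    (hQ : ∀ p ∈ Q, p.Prime) {θ u : ℝ} {n : ℕ} (hθ : |θ| ≤ 1) (hn : 1 < n) (hu0 : 0 ≤ u)
    (hu : u ≤ Real.log n) (hPu : ∀ p ∈ P, u * Real.log p ≤ Real.log n)
    (hQu : ∀ p ∈ Q, u * Real.log p ≤ Real.log n) :
    |meanUpTo (fun m => Real.cos (θ * ((omegaIn P m : ℝ) - omegaIn Q m))) n -
      Real.exp ((Real.cos θ - 1) * (recipSum P + recipSum Q - 2 * recipSum (P ∩ Q))) *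
        Real.cos (Real.sin θ * (recipSum P - recipSum Q))| ≤
      Real.exp (-u + |θ| * Real.exp 1 * (recipSum P + recipSum Q)) +
        |θ| ^ 2 * ∑' k : ℕ, 1 / (k : ℝ) ^ 2 := by
  set T := P ∪ Q with hTdef
  set s : ℕ → ℝ := fun p => (if p ∈ P then 1 else 0) - (if p ∈ Q then 1 else 0) with hs
  set h : ℕ → ℂ := fun p => Complex.exp (Complex.I * ((θ * s p : ℝ) : ℂ)) - 1 with hh
  have hT : ∀ p ∈ T, p.Prime := fun p hp => (Finset.mem_union.1 hp).elim (hP p) (hQ p)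
  have hTu : ∀ p ∈ T, u * Real.log p ≤ Real.log n := fun p hp =>
    (Finset.mem_union.1 hp).elim (hPu p) (hQu p)
  have hs1 (p : ℕ) : |s p| ≤ 1 := by
    simp only [hs]
    split_ifs <;> norm_num
  have hhle : ∀ p ∈ T, ‖h p‖ ≤ |θ| := fun p _ => by
    refine (Real.norm_exp_I_mul_ofReal_sub_one_le (x := θ * s p)).trans ?_
    rw [Real.norm_eq_abs, abs_mul]
    exact mul_le_of_le_one_right (abs_nonneg _) (hs1 p)
  have hh1 (p : ℕ) : 1 + h p = Complex.exp (Complex.I * ((θ * s p : ℝ) : ℂ)) := by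
    simp [hh]
  have hre : ∀ p ∈ T, ‖1 + h p‖ ≤ 1 := fun p _ => by
    rw [hh1, mul_comm, Complex.norm_exp_ofReal_mul_I]
  have hind (g : ℕ → ℝ) (U : Finset ℕ) (hU : U ⊆ T) :
      ∑ p ∈ T, (if p ∈ U then 1 else 0) * g p = ∑ p ∈ U, g p := by
    simp_rw [ite_mul, one_mul, zero_mul]
    rw [Finset.sum_ite_mem, Finset.inter_eq_right.2 hU]
  have hTP : P ⊆ T := Finset.subset_union_left
  have hTQ : Q ⊆ T := Finset.subset_union_right
  have hTI : P ∩ Q ⊆ T := Finset.inter_subset_left.trans hTP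
  have hprod (m : ℕ) : ∏ p ∈ T with p ∣ m, (1 + h p) =
      Complex.exp (Complex.I * ((θ * ((omegaIn P m : ℝ) - omegaIn Q m) : ℝ) : ℂ)) := by
    simp_rw [hh1]
    rw [← Complex.exp_sum, ← Finset.mul_sum, ← Complex.ofReal_sum, ← Finset.mul_sum]
    congr 4
    rw [Finset.sum_filter, omegaIn_eq_sum, omegaIn_eq_sum, ← hind _ P hTP, ← hind _ Q hTQ,
      ← Finset.sum_sub_distrib]
    refine Finset.sum_congr rfl fun p _ => ?_
    simp only [hs]
    split_ifs <;> simp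
  have hsum : ∑ p ∈ T, h p / p =
      (((Real.cos θ - 1) * (recipSum P + recipSum Q - 2 * recipSum (P ∩ Q)) : ℝ) : ℂ) +
        ((Real.sin θ * (recipSum P - recipSum Q) : ℝ) : ℂ) * Complex.I := by
    have e : ∀ p, h p / p = (((Real.cos θ - 1) *
        ((if p ∈ P then 1 else 0) * (1 / (p : ℝ)) + (if p ∈ Q then 1 else 0) * (1 / (p : ℝ)) -
          2 * ((if p ∈ P ∩ Q then 1 else 0) * (1 / (p : ℝ)))) : ℝ) : ℂ) +
        ((Real.sin θ * ((if p ∈ P then 1 else 0) * (1 / (p : ℝ)) -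
          (if p ∈ Q then 1 else 0) * (1 / (p : ℝ))) : ℝ) : ℂ) * Complex.I := by
      intro p
      simp only [hh, hs, Finset.mem_inter]
      rw [mul_comm Complex.I, Complex.exp_mul_I, ← Complex.ofReal_cos, ← Complex.ofReal_sin]
      by_cases h1 : p ∈ P <;> by_cases h2 : p ∈ Q <;> simp [h1, h2] <;>
        first | ring1 | (right; ring1)
    simp_rw [e]
    rw [Finset.sum_add_distrib, ← Finset.sum_mul, ← Complex.ofReal_sum, ← Complex.ofReal_sum,
      ← Finset.mul_sum, ← Finset.mul_sum, Finset.sum_sub_distrib, Finset.sum_sub_distrib,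
      Finset.sum_add_distrib, ← Finset.mul_sum, hind _ P hTP, hind _ Q hTQ, hind _ _ hTI]
    rfl
  have hrecT : ∑ p ∈ T, 1 / (p : ℝ) ≤ recipSum P + recipSum Q := by
    rw [recipSum, recipSum, ← Finset.sum_union_inter]
    exact le_add_of_nonneg_right (Finset.sum_nonneg fun _ _ => by positivity)
  have h1 := norm_mean_prod_sub_prod_le hT hn hu0 hu hTu hhle (abs_nonneg θ)
  have h2 := norm_prod_one_add_sub_exp_le (fun p hp => (hT p hp).two_le) hre hhle hθ
  simp_rw [hprod] at h1
  rw [hsum] at h2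
  have h3 : Real.exp (-u + |θ| * Real.exp 1 * ∑ p ∈ T, 1 / (p : ℝ)) ≤
      Real.exp (-u + |θ| * Real.exp 1 * (recipSum P + recipSum Q)) := by
    gcongr
  have h4 := (norm_sub_le_norm_sub_add_norm_sub _ _ _).trans (add_le_add (h1.trans h3) h2)
  refine le_trans ?_ h4
  refine le_of_eq_of_le ?_ (Complex.abs_re_le_norm _)
  congr 1
  have hexp (a b : ℝ) : (Complex.exp (a + b * Complex.I)).re = Real.exp a * Real.cos b := by
    rw [Complex.exp_re]
    simp
  rw [Complex.sub_re, hexp, meanUpTo, ← Complex.ofReal_natCast, Complex.div_ofReal_re,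
    Complex.re_sum]
  congr 2
  refine Finset.sum_congr rfl fun m _ => ?_
  rw [mul_comm Complex.I, Complex.exp_ofReal_mul_I_re]

theorem primesMod_inter {q r : ℕ} (h : q.Coprime r) (x : ℝ) :
    primesMod q x ∩ primesMod r x = primesMod (q * r) x := by
  ext p
  have : p % q = 1 % q ∧ p % r = 1 % r ↔ p % (q * r) = 1 % (q * r) :=
    Nat.modEq_and_modEq_iff_modEq_mul h
  simp only [primesMod, Finset.mem_inter, Finset.mem_filter, ← this]
  tauto

theorem prime_of_mem_primesMod {q p : ℕ} {x : ℝ} (h : p ∈ primesMod q x) : p.Prime :=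
  (Finset.mem_filter.1 h).2.1

theorem primesMod_mono (q : ℕ) {x y : ℝ} (h : x ≤ y) : primesMod q x ⊆ primesMod q y :=
  Finset.filter_subset_filter _ (Finset.Icc_subset_Icc_right (Nat.floor_mono h))

theorem primesMod_subset_Icc (q n : ℕ) : primesMod q n ⊆ Finset.Icc 1 n := by
  rw [primesMod, Nat.floor_natCast]
  exact Finset.filter_subset _ _

theorem omegaQ_eq_omegaIn {m n : ℕ} (hm : 1 ≤ m) (hmn : m ≤ n) (q : ℕ) :
    omegaQ m q = omegaIn (primesMod q n) m := by
  rw [omegaQ, omegaIn]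
  congr 1
  ext p
  simp only [primesMod, Finset.mem_filter, Nat.mem_primeFactors, Finset.mem_Icc, Nat.floor_natCast]
  constructor
  · rintro ⟨⟨hp, hd, -⟩, h⟩
    exact ⟨⟨⟨hp.one_lt.le, (Nat.le_of_dvd hm hd).trans hmn⟩, hp, h⟩, hd⟩
  · rintro ⟨⟨-, hp, h⟩, hd⟩
    exact ⟨⟨hp, hd, by omega⟩, h⟩

theorem meanUpTo_congr {f g : ℕ → ℝ} {n : ℕ} (h : ∀ m, 1 ≤ m → m ≤ n → f m = g m) :
    meanUpTo f n = meanUpTo g n :=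
  le_antisymm (meanUpTo_mono fun m h1 h2 => (h m h1 h2).le)
    (meanUpTo_mono fun m h1 h2 => (h m h1 h2).ge)

theorem tendsto_LL_atTop : Tendsto LL atTop atTop :=
  Real.tendsto_log_atTop.comp (Real.tendsto_log_atTop.comp tendsto_natCast_atTop_atTop)

theorem tendsto_log_LL_div : Tendsto (fun n => Real.log (LL n) / LL n) atTop (nhds 0) := by
  have h := Real.isLittleO_log_id_atTop.tendsto_div_nhds_zero
  exact h.comp tendsto_LL_atTop

theorem tendsto_inv_sqrt_LL : Tendsto (fun n => (Real.sqrt (LL n))⁻¹) atTop (nhds 0) :=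
  (Real.tendsto_sqrt_atTop.comp tendsto_LL_atTop).inv_tendsto_atTop

theorem log_le_two_mul_sqrt {x : ℝ} (hx : 0 < x) : Real.log x ≤ 2 * Real.sqrt x := by
  have h := Real.log_le_sub_one_of_pos (Real.sqrt_pos.2 hx)
  rw [Real.log_sqrt hx.le] at h
  linarith

/-- The truncation level `n ^ (1 / log log n)`. -/
def zLevel (n : ℕ) : ℝ := Real.exp (Real.log n / LL n)

theorem tendsto_zLevel : Tendsto zLevel atTop atTop := by
  refine Real.tendsto_exp_atTop.comp ?_
  have h1 : Tendsto (fun n : ℕ => Real.sqrt (Real.log n) / 2) atTop atTop :=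
    (Real.tendsto_sqrt_atTop.comp
      (Real.tendsto_log_atTop.comp tendsto_natCast_atTop_atTop)).atTop_div_const two_pos
  refine tendsto_atTop_mono' _ ?_ h1
  filter_upwards [tendsto_LL_atTop.eventually_gt_atTop 0,
    (Real.tendsto_log_atTop.comp tendsto_natCast_atTop_atTop).eventually_gt_atTop (0 : ℝ)]
    with n h2 h3
  simp only [Function.comp] at h3
  rw [div_le_div_iff₀ two_pos h2]
  have h4 := log_le_two_mul_sqrt h3
  have h5 := Real.mul_self_sqrt h3.le
  have h6 : LL n ≤ 2 * Real.sqrt (Real.log n) := h4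
  nlinarith [Real.sqrt_nonneg (Real.log n)]

theorem exists_abs_recipSum_zLevel_sub_le {q : ℕ} (hq : 0 < q) :
    ∃ C : ℝ, ∀ᶠ n : ℕ in atTop,
      |recipSum (primesMod q (zLevel n)) - (LL n - Real.log (LL n)) / q.totient| ≤ C := by
  obtain ⟨C, hC⟩ := exists_abs_recipSum_primesMod_sub_le hq
  refine ⟨C, ?_⟩
  filter_upwards [tendsto_zLevel.eventually_ge_atTop 3, tendsto_LL_atTop.eventually_gt_atTop 0,
    (Real.tendsto_log_atTop.comp tendsto_natCast_atTop_atTop).eventually_gt_atTop (0 : ℝ)]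
    with n h1 h2 h3
  have h := hC _ h1
  simp only [Function.comp] at h3
  rwa [zLevel, Real.log_exp, Real.log_div h3.ne' h2.ne'] at h

theorem exists_abs_recipSum_natCast_sub_le {q : ℕ} (hq : 0 < q) :
    ∃ C : ℝ, ∀ᶠ n : ℕ in atTop, |recipSum (primesMod q n) - LL n / q.totient| ≤ C := by
  obtain ⟨C, hC⟩ := exists_abs_recipSum_primesMod_sub_le hq
  refine ⟨C, ?_⟩
  filter_upwards [eventually_ge_atTop 3] with n hn
  exact hC n (by exact_mod_cast hn)

theorem tendsto_div_LL_of_abs_sub_le {f g : ℕ → ℝ} {C a : ℝ}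
    (h : ∀ᶠ n in atTop, |f n - g n| ≤ C) (hg : Tendsto (fun n => g n / LL n) atTop (nhds a)) :
    Tendsto (fun n => f n / LL n) atTop (nhds a) := by
  have h1 : Tendsto (fun n => (f n - g n) / LL n) atTop (nhds 0) := by
    have h2 : Tendsto (fun n => C / LL n) atTop (nhds 0) := tendsto_LL_atTop.const_div_atTop C
    refine squeeze_zero_norm' ?_ h2
    filter_upwards [h, tendsto_LL_atTop.eventually_gt_atTop 0] with n h3 h4
    rw [norm_div, Real.norm_eq_abs, Real.norm_of_nonneg h4.le]
    gcongr
  have h3 := h1.add hg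
  rw [zero_add] at h3
  refine h3.congr fun n => ?_
  rw [← add_div, sub_add_cancel]

theorem tendsto_recipSum_zLevel_div {q : ℕ} (hq : 0 < q) :
    Tendsto (fun n => recipSum (primesMod q (zLevel n)) / LL n) atTop
      (nhds (1 / (q.totient : ℝ))) := by
  obtain ⟨C, hC⟩ := exists_abs_recipSum_zLevel_sub_le hq
  refine tendsto_div_LL_of_abs_sub_le hC ?_
  have h := (tendsto_log_LL_div.const_sub 1).div_const (q.totient : ℝ)
  rw [sub_zero] at h
  refine h.congr' ?_
  filter_upwards [tendsto_LL_atTop.eventually_gt_atTop 0] with n hn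
  field_simp

theorem tendsto_cos_sub_one_mul (t : ℝ) :
    Tendsto (fun n => (Real.cos (t / Real.sqrt (LL n)) - 1) * LL n) atTop
      (nhds (-t ^ 2 / 2)) := by
  have h0 : Tendsto (fun n => -t ^ 2 / 2 + |t| ^ 4 * (5 / 96) / LL n) atTop
      (nhds (-t ^ 2 / 2)) := by
    simpa using (tendsto_LL_atTop.const_div_atTop (|t| ^ 4 * (5 / 96))).const_add (-t ^ 2 / 2)
  have h0' : Tendsto (fun n => -t ^ 2 / 2 - |t| ^ 4 * (5 / 96) / LL n) atTop
      (nhds (-t ^ 2 / 2)) := by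
    simpa using (tendsto_LL_atTop.const_div_atTop (|t| ^ 4 * (5 / 96))).const_sub (-t ^ 2 / 2)
  have hb : ∀ᶠ n in atTop, |(Real.cos (t / Real.sqrt (LL n)) - 1) * LL n - (-t ^ 2 / 2)| ≤
      |t| ^ 4 * (5 / 96) / LL n := by
    filter_upwards [tendsto_LL_atTop.eventually_gt_atTop 0,
      tendsto_LL_atTop.eventually_ge_atTop (t ^ 2)] with n h1 h2
    have hs : 0 < Real.sqrt (LL n) := Real.sqrt_pos.2 h1
    have hle : |t / Real.sqrt (LL n)| ≤ 1 := by
      rw [abs_div, abs_of_pos hs, div_le_one hs]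
      exact Real.abs_le_sqrt h2
    have h3 := Real.cos_bound hle
    have hsq : Real.sqrt (LL n) ^ 2 = LL n := Real.sq_sqrt h1.le
    have e : (Real.cos (t / Real.sqrt (LL n)) - 1) * LL n - (-t ^ 2 / 2) =
        (Real.cos (t / Real.sqrt (LL n)) - (1 - (t / Real.sqrt (LL n)) ^ 2 / 2)) * LL n := by
      rw [div_pow, hsq]
      field_simp
      ring
    rw [e, abs_mul, abs_of_pos h1]
    refine (mul_le_mul_of_nonneg_right h3 h1.le).trans (le_of_eq ?_)
    have hsq4 : Real.sqrt (LL n) ^ 4 = LL n ^ 2 := by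
      rw [show 4 = 2 * 2 from rfl, pow_mul, hsq]
    rw [abs_div, abs_of_pos hs, div_pow, hsq4]
    field_simp
  refine tendsto_of_tendsto_of_tendsto_of_le_of_le' h0' h0 ?_ ?_
  · filter_upwards [hb] with n hn
    linarith [(abs_le.1 hn).1]
  · filter_upwards [hb] with n hn
    linarith [(abs_le.1 hn).2]

theorem zLevel_le {n : ℕ} (hn : 0 < n) (h : 1 ≤ LL n) : zLevel n ≤ n := by
  have hn' : (0 : ℝ) < n := by exact_mod_cast hn
  calc zLevel n ≤ Real.exp (Real.log n) :=
        Real.exp_le_exp.2 (div_le_self (Real.log_natCast_nonneg n) h)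
    _ = n := Real.exp_log hn'

theorem mul_log_le_of_mem_primesMod_zLevel {q n p : ℕ} (h : 0 < LL n)
    (hp : p ∈ primesMod q (zLevel n)) : LL n * Real.log p ≤ Real.log n := by
  have hp' := (mem_primesMod (Real.exp_pos _).le).1 hp
  have h1 : Real.log p ≤ Real.log n / LL n := by
    rw [Real.log_le_iff_le_exp (by exact_mod_cast hp'.2.1.pos)]
    exact hp'.1
  rwa [le_div_iff₀ h, mul_comm] at h1

theorem tendsto_exp_neg_LL_add (c : ℝ) {f : ℕ → ℝ} {a : ℝ}
    (hf : Tendsto (fun n => f n / LL n) atTop (nhds a)) :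
    Tendsto (fun n => Real.exp (-LL n + c / Real.sqrt (LL n) * f n)) atTop (nhds 0) := by
  have h1 : Tendsto (fun n => -1 + c * (Real.sqrt (LL n))⁻¹ * (f n / LL n)) atTop (nhds (-1)) := by
    simpa using ((tendsto_inv_sqrt_LL.const_mul c).mul hf).const_add (-1)
  refine Real.tendsto_exp_atBot.comp ?_
  refine (tendsto_LL_atTop.atTop_mul_neg (by norm_num) h1).congr' ?_
  filter_upwards [tendsto_LL_atTop.eventually_gt_atTop 0] with n hn
  field_simp

theorem tendsto_mean_cos_zLevel {q r : ℕ} (hq : 0 < q) (hr : 0 < r) (hqr : q.Coprime r)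
    (hφ : q.totient = r.totient) (t : ℝ) :
    Tendsto (fun n => meanUpTo (fun m => Real.cos (t * (((omegaIn (primesMod q (zLevel n)) m : ℝ) -
      omegaIn (primesMod r (zLevel n)) m) / Real.sqrt (LL n)))) n) atTop
      (nhds (Real.exp (-(1 / (q.totient : ℝ) + 1 / r.totient - 2 / (q.totient * r.totient)) *
        t ^ 2 / 2))) := by
  set S : ℕ → ℕ → ℝ := fun q n => recipSum (primesMod q (zLevel n)) with hS
  have hSq : Tendsto (fun n => S q n / LL n) atTop (nhds (1 / (q.totient : ℝ))) :=
    tendsto_recipSum_zLevel_div hq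
  have hSr : Tendsto (fun n => S r n / LL n) atTop (nhds (1 / (r.totient : ℝ))) :=
    tendsto_recipSum_zLevel_div hr
  have hSqr := tendsto_recipSum_zLevel_div (Nat.mul_pos hq hr)
  rw [Nat.totient_mul hqr] at hSqr
  push_cast at hSqr
  have hdiff : ∃ C, ∀ᶠ n in atTop, |S q n - S r n| ≤ C := by
    obtain ⟨C₁, h₁⟩ := exists_abs_recipSum_zLevel_sub_le hq
    obtain ⟨C₂, h₂⟩ := exists_abs_recipSum_zLevel_sub_le hr
    refine ⟨C₁ + C₂, ?_⟩
    filter_upwards [h₁, h₂] with n h₁ h₂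
    rw [hφ] at h₁
    rw [abs_le] at *
    constructor <;> simp only [hS] <;> linarith [h₁.1, h₁.2, h₂.1, h₂.2]
  obtain ⟨C, hC⟩ := hdiff
  set θ : ℕ → ℝ := fun n => t / Real.sqrt (LL n) with hθdef
  have hθ : Tendsto θ atTop (nhds 0) := by
    simpa [hθdef, div_eq_mul_inv] using tendsto_inv_sqrt_LL.const_mul t
  have hmain : Tendsto (fun n => Real.exp ((Real.cos (θ n) - 1) * (S q n + S r n -
      2 * S (q * r) n)) * Real.cos (Real.sin (θ n) * (S q n - S r n))) atTop
      (nhds (Real.exp (-(1 / (q.totient : ℝ) + 1 / r.totient - 2 / (q.totient * r.totient)) *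
        t ^ 2 / 2) * Real.cos 0)) := by
    refine Tendsto.mul ?_ ?_
    · refine (Real.continuous_exp.tendsto _).comp ?_
      have := (tendsto_cos_sub_one_mul t).mul ((hSq.add hSr).sub (hSqr.const_mul 2))
      refine (this.congr' ?_).trans (le_of_eq ?_)
      · filter_upwards [tendsto_LL_atTop.eventually_gt_atTop 0] with n hn
        simp only [hS, hθdef]
        field_simp
      · congr 1
        ring
    · refine (Real.continuous_cos.tendsto _).comp ?_
      have hsin : Tendsto (fun n => |Real.sin (θ n)| * C) atTop (nhds 0) := by
        simpa using ((Real.continuous_sin.tendsto 0).comp hθ).abs.mul_const C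
      refine squeeze_zero_norm' ?_ hsin
      filter_upwards [hC] with n hn
      rw [norm_mul, Real.norm_eq_abs, Real.norm_eq_abs]
      gcongr
  rw [Real.cos_zero, mul_one] at hmain
  have herr : Tendsto (fun n => Real.exp (-LL n + |θ n| * Real.exp 1 * (S q n + S r n)) +
      |θ n| ^ 2 * ∑' k : ℕ, 1 / (k : ℝ) ^ 2) atTop (nhds 0) := by
    have h1 := tendsto_exp_neg_LL_add (|t| * Real.exp 1)
      ((hSq.add hSr).congr fun n => (add_div _ _ _).symm)
    have h2 : Tendsto (fun n => |θ n| ^ 2 * ∑' k : ℕ, 1 / (k : ℝ) ^ 2) atTop (nhds 0) := by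
      have := (hθ.abs.pow 2).mul_const (∑' k : ℕ, 1 / (k : ℝ) ^ 2)
      rwa [abs_zero, zero_pow two_ne_zero, zero_mul] at this
    rw [← add_zero (0 : ℝ)]
    refine Tendsto.add (h1.congr fun n => ?_) h2
    simp only [hθdef, abs_div, abs_of_nonneg (Real.sqrt_nonneg _)]
    ring_nf
  rw [← sub_zero (Real.exp _)]
  have hsub : Tendsto (fun n => meanUpTo (fun m => Real.cos (t *
      (((omegaIn (primesMod q (zLevel n)) m : ℝ) -
      omegaIn (primesMod r (zLevel n)) m) / Real.sqrt (LL n)))) n -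
      Real.exp ((Real.cos (θ n) - 1) * (S q n + S r n -
      2 * S (q * r) n)) * Real.cos (Real.sin (θ n) * (S q n - S r n))) atTop (nhds 0) := by
    refine squeeze_zero_norm' ?_ herr
    filter_upwards [tendsto_LL_atTop.eventually_ge_atTop 1, eventually_gt_atTop 1,
      hθ.abs.eventually (ge_mem_nhds (by simp : |(0 : ℝ)| < 1))] with n h1 h2 h3
    have hlog : 0 < Real.log n := Real.log_pos (by exact_mod_cast h2)
    have := abs_mean_cos_omegaIn_sub_le (P := primesMod q (zLevel n))
      (Q := primesMod r (zLevel n)) (u := LL n) (fun _ => prime_of_mem_primesMod)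
      (fun _ => prime_of_mem_primesMod) h3 h2 (by linarith)
      (show LL n ≤ _ from (Real.log_le_sub_one_of_pos hlog).trans (by linarith))
      (fun _ => mul_log_le_of_mem_primesMod_zLevel (by linarith))
      (fun _ => mul_log_le_of_mem_primesMod_zLevel (by linarith))
    rw [primesMod_inter hqr] at this
    rw [Real.norm_eq_abs]
    refine le_of_eq_of_le ?_ this
    congr 3
    funext m
    congr 1
    simp only [hθdef]
    ring
  have := hsub.add hmain
  simpa using this

theorem eventually_mean_sq_zLevel_le {q r : ℕ} (hq : 0 < q) (hr : 0 < r)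
    (hφ : q.totient = r.totient) :
    ∃ C : ℝ, ∀ᶠ n in atTop, meanUpTo (fun m => (((omegaIn (primesMod q (zLevel n)) m : ℝ) -
      omegaIn (primesMod r (zLevel n)) m) / Real.sqrt (LL n)) ^ 2) n ≤ C := by
  obtain ⟨C₁, h₁⟩ := exists_abs_recipSum_zLevel_sub_le hq
  obtain ⟨C₂, h₂⟩ := exists_abs_recipSum_zLevel_sub_le hr
  have hSq := tendsto_recipSum_zLevel_div hq
  have hSr := tendsto_recipSum_zLevel_div hr
  refine ⟨3 * (3 * (1 / (q.totient : ℝ) + 1) + 3 * (1 / (r.totient : ℝ) + 1) + (C₁ + C₂) ^ 2), ?_⟩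
  filter_upwards [h₁, h₂, hSq.eventually_le_const (lt_add_one _),
    hSr.eventually_le_const (lt_add_one _), tendsto_LL_atTop.eventually_ge_atTop 1,
    eventually_gt_atTop 0] with n h₁ h₂ h3 h4 h5 h6
  have hL : 0 < LL n := by linarith
  have hsub (q : ℕ) : primesMod q (zLevel n) ⊆ Finset.Icc 1 n :=
    (primesMod_mono q (zLevel_le h6 h5)).trans (primesMod_subset_Icc q n)
  have hv₁ := mean_sq_omegaIn_sub_le (fun _ => prime_of_mem_primesMod) h6 (hsub q)
  have hv₂ := mean_sq_omegaIn_sub_le (fun _ => prime_of_mem_primesMod) h6 (hsub r)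
  rw [div_le_iff₀ hL] at h3 h4
  set P := primesMod q (zLevel n)
  set R := primesMod r (zLevel n)
  have hD : (recipSum P - recipSum R) ^ 2 ≤ (C₁ + C₂) ^ 2 := by
    rw [hφ] at h₁
    rw [sq_le_sq]
    refine le_trans ?_ (le_abs_self _)
    rw [abs_le] at *
    constructor <;> linarith [h₁.1, h₁.2, h₂.1, h₂.2]
  have hle : meanUpTo (fun m => ((omegaIn P m : ℝ) - omegaIn R m) ^ 2) n ≤
      3 * (3 * recipSum P + 3 * recipSum R + (C₁ + C₂) ^ 2) := by
    calc meanUpTo (fun m => ((omegaIn P m : ℝ) - omegaIn R m) ^ 2) n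
        ≤ meanUpTo (fun m => 3 * (((omegaIn P m : ℝ) - recipSum P) ^ 2 +
            ((omegaIn R m : ℝ) - recipSum R) ^ 2 + (C₁ + C₂) ^ 2)) n := by
          refine meanUpTo_mono fun m _ _ => ?_
          refine le_trans ?_ (mul_le_mul_of_nonneg_left (add_le_add_right hD _) three_pos.le)
          generalize (omegaIn P m : ℝ) = a
          generalize (omegaIn R m : ℝ) = b
          generalize recipSum P = c
          generalize recipSum R = d
          nlinarith [sq_nonneg ((a - c) + (b - d)), sq_nonneg ((a - c) - (c - d)),
            sq_nonneg ((b - d) + (c - d))]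
      _ ≤ _ := by
          rw [meanUpTo_const_mul, meanUpTo_add, meanUpTo_add, meanUpTo_const _ h6]
          linarith
  have e : meanUpTo (fun m => (((omegaIn P m : ℝ) - omegaIn R m) / Real.sqrt (LL n)) ^ 2) n =
      (LL n)⁻¹ * meanUpTo (fun m => ((omegaIn P m : ℝ) - omegaIn R m) ^ 2) n := by
    rw [← meanUpTo_const_mul]
    congr 1
    funext m
    rw [div_pow, Real.sq_sqrt hL.le, div_eq_inv_mul]
  rw [e, inv_mul_le_iff₀ hL]
  refine hle.trans ?_
  have : (C₁ + C₂) ^ 2 ≤ LL n * (C₁ + C₂) ^ 2 := le_mul_of_one_le_left (sq_nonneg _) h5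
  linarith

theorem abs_omegaIn_sub_omegaIn_eq {S T : Finset ℕ} (h : S ⊆ T) (m : ℕ) :
    |(omegaIn T m : ℝ) - omegaIn S m| = omegaIn (T \ S) m := by
  rw [omegaIn_eq_sum, omegaIn_eq_sum, omegaIn_eq_sum, ← Finset.sum_sdiff h, add_sub_cancel_right,
    abs_of_nonneg (Finset.sum_nonneg fun _ _ => by split_ifs <;> norm_num)]

theorem recipSum_sdiff {S T : Finset ℕ} (h : S ⊆ T) :
    recipSum (T \ S) = recipSum T - recipSum S := by
  rw [recipSum, recipSum, recipSum, ← Finset.sum_sdiff h, add_sub_cancel_right]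

theorem exists_mean_abs_omegaQ_sub_zLevel_le {q : ℕ} (hq : 0 < q) :
    ∃ C : ℝ, ∀ᶠ n in atTop, meanUpTo (fun m => |(omegaQ m q : ℝ) -
      omegaIn (primesMod q (zLevel n)) m|) n ≤ Real.log (LL n) / q.totient + C := by
  obtain ⟨C₁, h₁⟩ := exists_abs_recipSum_zLevel_sub_le hq
  obtain ⟨C₂, h₂⟩ := exists_abs_recipSum_natCast_sub_le hq
  refine ⟨C₁ + C₂, ?_⟩
  filter_upwards [h₁, h₂, tendsto_LL_atTop.eventually_ge_atTop 1,
    eventually_gt_atTop 0] with n h₁ h₂ h3 h4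
  have hsub := primesMod_mono q (zLevel_le h4 h3)
  have h5 := mean_omegaIn_le (primesMod q n \ primesMod q (zLevel n)) n
  rw [recipSum_sdiff hsub] at h5
  rw [meanUpTo_congr (g := fun m =>
    (omegaIn (primesMod q n \ primesMod q (zLevel n)) m : ℝ)) fun m hm hmn => by
      rw [omegaQ_eq_omegaIn hm hmn, abs_omegaIn_sub_omegaIn_eq hsub]]
  rw [sub_div] at h₁
  linarith [(abs_le.1 h₁).1, (abs_le.1 h₂).2]

theorem tendsto_log_LL_div_sqrt : Tendsto (fun n => Real.log (LL n) / Real.sqrt (LL n)) atTop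
    (nhds 0) := by
  have h := (Real.isLittleO_log_id_atTop.tendsto_div_nhds_zero.comp
    (Real.tendsto_sqrt_atTop.comp tendsto_LL_atTop)).const_mul 2
  rw [mul_zero] at h
  refine h.congr' ?_
  filter_upwards [tendsto_LL_atTop.eventually_gt_atTop 0] with n hn
  simp only [Function.comp, id]
  rw [Real.log_sqrt hn.le]
  ring

/-- The mean absolute difference of two of the counting functions `omegaQ`. -/
theorem tendsto_mean_abs_omegaQ_sub {q r : ℕ} (hq : 0 < q) (hr : 0 < r) (hqr : q.Coprime r)
    (hφ : q.totient = r.totient) :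
    Tendsto (fun n => meanUpTo (fun m => |(omegaQ m q : ℝ) - omegaQ m r|) n / Real.sqrt (LL n))
      atTop (nhds (Real.sqrt (1 / (q.totient : ℝ) + 1 / r.totient -
        2 / (q.totient * r.totient)) * Real.sqrt (2 / Real.pi))) := by
  set v : ℝ := 1 / (q.totient : ℝ) + 1 / r.totient - 2 / (q.totient * r.totient) with hv
  have hv0 : 0 ≤ v := by
    have h1 : (1 : ℝ) ≤ q.totient := by exact_mod_cast Nat.totient_pos.2 hq
    have h2 : (1 : ℝ) ≤ r.totient := by exact_mod_cast Nat.totient_pos.2 hr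
    have : v = (q.totient + r.totient - 2) / (q.totient * r.totient) := by
      rw [hv]
      field_simp
      ring
    rw [this]
    exact div_nonneg (by linarith) (by positivity)
  obtain ⟨C, hC⟩ := eventually_mean_sq_zLevel_le hq hr hφ
  have hmain := tendsto_mean_abs (v := v.toNNReal) hC fun t => by
    rw [Real.coe_toNNReal v hv0]
    exact tendsto_mean_cos_zLevel hq hr hqr hφ t
  rw [Real.coe_toNNReal v hv0] at hmain
  obtain ⟨C₁, h₁⟩ := exists_mean_abs_omegaQ_sub_zLevel_le hq
  obtain ⟨C₂, h₂⟩ := exists_mean_abs_omegaQ_sub_zLevel_le hr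
  have herr : Tendsto (fun n => (Real.log (LL n) / q.totient + C₁ +
      (Real.log (LL n) / r.totient + C₂)) / Real.sqrt (LL n)) atTop (nhds 0) := by
    have := (tendsto_log_LL_div_sqrt.const_mul (1 / (q.totient : ℝ) + 1 / r.totient)).add
      (tendsto_inv_sqrt_LL.const_mul (C₁ + C₂))
    rw [mul_zero, mul_zero, add_zero] at this
    refine this.congr fun n => ?_
    ring
  have hdiff : Tendsto (fun n => meanUpTo (fun m => |(omegaQ m q : ℝ) - omegaQ m r|) n /
      Real.sqrt (LL n) - meanUpTo (fun m => |((omegaIn (primesMod q (zLevel n)) m : ℝ) -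
      omegaIn (primesMod r (zLevel n)) m) / Real.sqrt (LL n)|) n) atTop (nhds 0) := by
    refine squeeze_zero_norm' ?_ herr
    filter_upwards [h₁, h₂, tendsto_LL_atTop.eventually_gt_atTop 0] with n h₁ h₂ h3
    have hs := Real.sqrt_pos.2 h3
    set P := primesMod q (zLevel n)
    set R := primesMod r (zLevel n)
    have e : meanUpTo (fun m => |((omegaIn P m : ℝ) - omegaIn R m) / Real.sqrt (LL n)|) n =
        meanUpTo (fun m => |(omegaIn P m : ℝ) - omegaIn R m|) n / Real.sqrt (LL n) := by
      rw [div_eq_inv_mul, ← meanUpTo_const_mul]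
      congr 1
      funext m
      rw [abs_div, abs_of_pos hs, div_eq_inv_mul]
    rw [e, ← sub_div, norm_div, Real.norm_of_nonneg hs.le]
    refine div_le_div_of_nonneg_right (le_trans ?_ (add_le_add h₁ h₂)) hs.le
    rw [Real.norm_eq_abs, abs_le, ← meanUpTo_sub, ← meanUpTo_add, neg_eq_neg_one_mul,
      ← meanUpTo_const_mul]
    refine ⟨meanUpTo_mono fun m _ _ => ?_, meanUpTo_mono fun m _ _ => ?_⟩
    all_goals
      have h4 := abs_sub_abs_le_abs_sub ((omegaQ m q : ℝ) - omegaQ m r)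
        ((omegaIn P m : ℝ) - omegaIn R m)
      have h5 := abs_sub_abs_le_abs_sub ((omegaIn P m : ℝ) - omegaIn R m)
        ((omegaQ m q : ℝ) - omegaQ m r)
      rw [abs_sub_comm ((omegaIn P m : ℝ) - omegaIn R m)] at h5
      have h6 := abs_sub ((omegaQ m q : ℝ) - omegaIn P m) ((omegaQ m r : ℝ) - omegaIn R m)
      rw [sub_sub_sub_comm] at h6
      linarith
  have := hdiff.add hmain
  simpa using this

theorem ordCompl_factorial_dvd_prod {l : ℕ} (hl : l.Prime) (N : ℕ) :
    ordCompl[l] N.factorial ∣ ∏ k ∈ Finset.range N, (1 + (k + 1) * l) := by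
  set M := ordCompl[l] N.factorial with hM
  have hcop : l.Coprime M := Nat.coprime_ordCompl hl N.factorial_ne_zero
  have hM0 : M ≠ 0 := (Nat.ordCompl_pos l N.factorial_ne_zero).ne'
  obtain ⟨g, hg⟩ : ∃ g, l * g ≡ 1 [MOD M] := by
    rcases Nat.eq_or_lt_of_le (Nat.one_le_iff_ne_zero.2 hM0) with h | h
    · exact ⟨0, h ▸ Nat.modEq_one⟩
    · exact (Nat.exists_mul_mod_eq_one_of_coprime hcop h).imp fun g hg => by
        rw [Nat.ModEq, hg.2, Nat.mod_eq_of_lt h]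
  have hgcop : M.Coprime g := by
    have : Nat.gcd (l * g) M = 1 := by rw [hg.gcd_eq, Nat.gcd_one_left]
    exact (Nat.Coprime.coprime_mul_left this).symm
  have h1 : M ∣ (g + 1).ascFactorial N :=
    (Nat.ordCompl_dvd _ _).trans (Nat.factorial_dvd_ascFactorial _ _)
  have h2 : (g + 1).ascFactorial N ≡ g ^ N * ∏ k ∈ Finset.range N, (1 + (k + 1) * l) [MOD M] := by
    rw [Nat.ascFactorial_eq_prod_range, ← Finset.card_range N, ← Finset.prod_const,
      Finset.card_range, ← Finset.prod_mul_distrib]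
    refine Nat.ModEq.prod fun k _ => ?_
    calc g + 1 + k = g + (k + 1) * 1 := by ring
      _ ≡ g + (k + 1) * (l * g) [MOD M] := (hg.symm.mul_left _).add_left _
      _ = g * (1 + (k + 1) * l) := by ring
  have h3 : M ∣ g ^ N * ∏ k ∈ Finset.range N, (1 + (k + 1) * l) := (h2.dvd_iff dvd_rfl).1 h1
  exact (hgcop.pow_right N).dvd_of_dvd_mul_left h3

/-- A Chebyshev-type bound for primes congruent to `1` modulo a prime. -/
theorem sum_log_le_of_primes_mod {l N : ℕ} (hl : l.Prime) {T : Finset ℕ}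
    (hT : ∀ p ∈ T, p.Prime ∧ p % l = 1 ∧ N < p ∧ p ≤ N * l + 1) :
    ∑ p ∈ T, Real.log p ≤ 3 * N * Real.log l := by
  set A := ∏ k ∈ Finset.range N, (1 + (k + 1) * l) with hA
  set M := ordCompl[l] N.factorial with hM
  have hl0 : 0 < l := hl.pos
  have hA0 : 0 < A := Finset.prod_pos fun _ _ => by positivity
  have hM0 : 0 < M := Nat.ordCompl_pos l N.factorial_ne_zero
  have hprod : ∏ p ∈ T, p ∣ A := by
    refine Finset.prod_primes_dvd A (fun p hp => (hT p hp).1.prime) fun p hp => ?_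
    obtain ⟨hpp, hmod, hlow, hup⟩ := hT p hp
    have e := Nat.div_add_mod p l
    rw [hmod] at e
    have hk0 : p / l ≠ 0 := by
      intro h
      rw [h, mul_zero] at e
      exact hpp.one_lt.ne e
    have hkN : p / l ≤ N := by
      have : l * (p / l) ≤ l * N := by rw [mul_comm l N]; omega
      exact Nat.le_of_mul_le_mul_left this hl0
    have : 1 + (p / l - 1 + 1) * l = p := by
      rw [Nat.sub_add_cancel (Nat.one_le_iff_ne_zero.2 hk0), mul_comm, add_comm, e]
    rw [← this]
    exact Finset.dvd_prod_of_mem (fun k => 1 + (k + 1) * l) 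
      (Finset.mem_range.2 (Nat.sub_one_lt_of_le (Nat.pos_of_ne_zero hk0) hkN))
  have hcop : (∏ p ∈ T, p).Coprime M := by
    refine Nat.Coprime.prod_left fun p hp => ?_
    obtain ⟨hpp, -, hlow, -⟩ := hT p hp
    rw [hpp.coprime_iff_not_dvd]
    intro h
    exact hlow.not_ge ((hpp.dvd_factorial).1 (h.trans (Nat.ordCompl_dvd _ _)))
  have hdvd := Nat.le_of_dvd hA0
    (hcop.mul_dvd_of_dvd_of_dvd hprod (ordCompl_factorial_dvd_prod hl N))
  have hAle : A ≤ (N + 1).factorial * l ^ N := by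
    rw [← Finset.prod_range_add_one_eq_factorial, Finset.prod_range_succ', zero_add, mul_one,
      ← Finset.card_range N, ← Finset.prod_const, Finset.card_range, ← Finset.prod_mul_distrib]
    refine Finset.prod_le_prod' fun k _ => ?_
    rw [add_mul (k + 1), one_mul, add_comm]
    exact Nat.add_le_add_left hl.one_lt.le _
  have hMle : N.factorial ≤ l ^ N * M := by
    conv_lhs => rw [← Nat.ordProj_mul_ordCompl_eq_self N.factorial l]
    refine Nat.mul_le_mul_right _ (Nat.pow_le_pow_right hl0 ?_)
    rw [Nat.factorization_def _ hl]
    have : Fact l.Prime := ⟨hl⟩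
    have h1 := sub_one_mul_padicValNat_factorial (p := l) N
    have h2 : padicValNat l N.factorial ≤ (l - 1) * padicValNat l N.factorial :=
      Nat.le_mul_of_pos_left _ (Nat.sub_pos_of_lt hl.one_lt)
    omega
  have hfin : ∏ p ∈ T, p ≤ l ^ (3 * N) := by
    have h1 : (∏ p ∈ T, p) * M * l ^ N ≤ (l ^ (3 * N)) * (M * l ^ N) := by
      calc (∏ p ∈ T, p) * M * l ^ N ≤ A * l ^ N := by gcongr
        _ ≤ ((N + 1).factorial * l ^ N) * l ^ N := by gcongr
        _ = (N + 1) * N.factorial * (l ^ N * l ^ N) := by rw [Nat.factorial_succ]; ring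
        _ ≤ l ^ N * (l ^ N * M) * (l ^ N * l ^ N) := by
            gcongr
            exact Nat.lt_pow_self hl.one_lt
        _ = _ := by ring
    rw [mul_assoc] at h1
    exact Nat.le_of_mul_le_mul_right h1 (by positivity)
  have hTpos : ∀ p ∈ T, (p : ℝ) ≠ 0 := fun p hp => by exact_mod_cast (hT p hp).1.ne_zero
  rw [← Real.log_prod hTpos, ← Nat.cast_prod]
  have h4 : Real.log ((∏ p ∈ T, p : ℕ) : ℝ) ≤ Real.log ((l ^ (3 * N) : ℕ) : ℝ) := by
    refine Real.log_le_log ?_ (by exact_mod_cast hfin)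
    exact_mod_cast Finset.prod_pos fun p hp => (hT p hp).1.pos
  refine h4.trans (le_of_eq ?_)
  rw [Nat.cast_pow, Real.log_pow]
  push_cast
  ring

theorem recipSum_block_le {l k : ℕ} (hl : l.Prime) (hl3 : 3 ≤ l) (hk : 1 ≤ k) {T : Finset ℕ}
    (hT : ∀ p ∈ T, p.Prime ∧ p % l = 1 ∧ Nat.log 2 p = k) :
    recipSum T ≤ 6 / Real.log 2 * (Real.log l / l) * (1 / k) := by
  have hlog2 : 0 < Real.log 2 := Real.log_pos one_lt_two
  have hk' : (0 : ℝ) < k := by exact_mod_cast hk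
  have hl' : (0 : ℝ) < l := by exact_mod_cast hl.pos
  have hlow : ∀ p ∈ T, 2 ^ k ≤ p := fun p hp => by
    rw [← (hT p hp).2.2]
    exact Nat.pow_log_le_self 2 (hT p hp).1.ne_zero
  have hup : ∀ p ∈ T, p < 2 ^ (k + 1) := fun p hp => by
    rw [← (hT p hp).2.2]
    exact Nat.lt_pow_succ_log_self one_lt_two p
  have hsum : ∑ p ∈ T, Real.log p ≤ 3 * (2 ^ (k + 1) / l : ℕ) * Real.log l := by
    refine sum_log_le_of_primes_mod hl fun p hp => ⟨(hT p hp).1, (hT p hp).2.1, ?_, ?_⟩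
    · refine lt_of_lt_of_le ?_ (hlow p hp)
      rw [Nat.div_lt_iff_lt_mul hl.pos, pow_succ]
      exact Nat.mul_lt_mul_of_pos_left (by omega) (by positivity)
    · have h1 := hup p hp
      have h2 := Nat.div_add_mod p l
      rw [(hT p hp).2.1] at h2
      have h3 : p / l ≤ 2 ^ (k + 1) / l := Nat.div_le_div_right h1.le
      have h4 := Nat.mul_le_mul_left l h3
      rw [mul_comm _ l]
      omega
  have hterm : recipSum T ≤ ∑ p ∈ T, 1 / (2 ^ k * (k * Real.log 2)) * Real.log p := by
    refine Finset.sum_le_sum fun p hp => ?_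
    have h1 : (2 : ℝ) ^ k ≤ p := by exact_mod_cast hlow p hp
    have h2 : k * Real.log 2 ≤ Real.log p := by
      rw [← Real.log_pow]
      exact Real.log_le_log (by positivity) h1
    have h3 : (0 : ℝ) < 2 ^ k := by positivity
    rw [div_mul_eq_mul_div, one_mul, div_le_div_iff₀ (by linarith) (by positivity), one_mul,
      mul_comm]
    gcongr
  rw [← Finset.mul_sum] at hterm
  refine hterm.trans ?_
  have h5 : ((2 ^ (k + 1) / l : ℕ) : ℝ) ≤ 2 ^ (k + 1) / l := by
    refine Nat.cast_div_le.trans (le_of_eq ?_)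
    push_cast
    rfl
  have hlogl : 0 ≤ Real.log l := Real.log_natCast_nonneg l
  calc 1 / (2 ^ k * (k * Real.log 2)) * ∑ p ∈ T, Real.log p
      ≤ 1 / (2 ^ k * (k * Real.log 2)) * (3 * (2 ^ (k + 1) / l) * Real.log l) := by
        refine mul_le_mul_of_nonneg_left (hsum.trans ?_) (by positivity)
        gcongr
    _ = _ := by
        field_simp
        ring

/-- A uniform upper bound for the sum of reciprocals of the primes congruent to `1` modulo a
prime. -/
theorem recipSum_primesMod_le {l n : ℕ} (hl : l.Prime) (hl3 : 3 ≤ l) (hn : 3 ≤ n) :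
    recipSum (primesMod l n) ≤ 6 / Real.log 2 * (Real.log l / l) * (LL n + 2) := by
  have hlog2 : 0 < Real.log 2 := Real.log_pos one_lt_two
  have hmap : ∀ p ∈ primesMod l n, Nat.log 2 p ∈ Finset.Icc 1 (Nat.log 2 n) := fun p hp => by
    have h1 := Finset.mem_Icc.1 (primesMod_subset_Icc l n hp)
    have h2 := (prime_of_mem_primesMod hp).two_le
    exact Finset.mem_Icc.2 ⟨Nat.log_pos one_lt_two h2, Nat.log_mono_right h1.2⟩
  have h1 : recipSum (primesMod l n) = ∑ k ∈ Finset.Icc 1 (Nat.log 2 n),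
      recipSum ((primesMod l n).filter fun p => Nat.log 2 p = k) :=
    (Finset.sum_fiberwise_of_maps_to hmap _).symm
  rw [h1]
  refine (Finset.sum_le_sum fun k hk => recipSum_block_le hl hl3 (Finset.mem_Icc.1 hk).1
    fun p hp => ?_).trans ?_
  · have h2 := Finset.mem_filter.1 hp
    refine ⟨prime_of_mem_primesMod h2.1, ?_, h2.2⟩
    have h3 := (Finset.mem_filter.1 h2.1).2.2
    rwa [Nat.one_mod_eq_one.2 hl.one_lt.ne'] at h3
  · rw [← Finset.mul_sum]
    refine mul_le_mul_of_nonneg_left ?_ (by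
      have := Real.log_natCast_nonneg l
      positivity)
    have h4 := harmonic_le_one_add_log (Nat.log 2 n)
    rw [harmonic_eq_sum_Icc] at h4
    push_cast at h4
    simp_rw [one_div]
    refine h4.trans ?_
    have h5 : 1 ≤ Nat.log 2 n := Nat.log_pos one_lt_two (by omega)
    have h6 : (Nat.log 2 n : ℝ) ≤ Real.log n / Real.log 2 := by
      rw [le_div_iff₀ hlog2, ← Real.log_pow]
      refine Real.log_le_log (by positivity) ?_
      exact_mod_cast Nat.pow_log_le_self 2 (by omega)
    have hlogn : 1 ≤ Real.log n := one_le_log_of_three_le (by exact_mod_cast hn)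
    have h7 : Real.log (Nat.log 2 n) ≤ LL n - Real.log (Real.log 2) := by
      rw [LL, ← Real.log_div (by linarith) hlog2.ne']
      exact Real.log_le_log (by exact_mod_cast h5) h6
    have h8 : -1 ≤ Real.log (Real.log 2) := by
      rw [Real.le_log_iff_exp_le hlog2, Real.exp_neg]
      have h9 := Real.exp_one_gt_d9
      have h10 := Real.log_two_gt_d9
      refine (inv_anti₀ (by norm_num) h9.le).trans (le_trans ?_ h10.le)
      norm_num
    linarith

theorem max_le_sq_div {u b : ℝ} (hb : 0 < b) : max u 0 ≤ (u + b) ^ 2 / (4 * b) := by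
  rw [max_le_iff, le_div_iff₀ (by positivity)]
  exact ⟨by nlinarith [sq_nonneg (u - b)], by positivity⟩

theorem mean_max_omegaIn_sub_le_of_lt {T : Finset ℕ} (hT : ∀ p ∈ T, p.Prime) {n : ℕ} (hn : 0 < n)
    (hTn : T ⊆ Finset.Icc 1 n) {a : ℝ} (ha : recipSum T < a) :
    meanUpTo (fun m => max ((omegaIn T m : ℝ) - a) 0) n ≤
      3 * recipSum T / (4 * (a - recipSum T)) := by
  have hpos : 0 < a - recipSum T := sub_pos.2 ha
  have h := mean_sq_omegaIn_sub_le hT hn hTn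
  calc meanUpTo (fun m => max ((omegaIn T m : ℝ) - a) 0) n
      ≤ meanUpTo (fun m => (4 * (a - recipSum T))⁻¹ * ((omegaIn T m : ℝ) - recipSum T) ^ 2) n := by
        refine meanUpTo_mono fun m _ _ => ?_
        have := max_le_sq_div (u := (omegaIn T m : ℝ) - a) hpos
        rwa [sub_add_sub_cancel, div_eq_inv_mul] at this
    _ ≤ _ := by
        rw [meanUpTo_const_mul, div_eq_inv_mul]
        gcongr

theorem mean_max_omegaIn_sub_le {T : Finset ℕ} (hT : ∀ p ∈ T, p.Prime) (n : ℕ) {a : ℝ}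
    (ha : 1 ≤ a) :
    meanUpTo (fun m => max ((omegaIn T m : ℝ) - a) 0) n ≤ recipSum T ^ 2 / a := by
  have h := mean_omegaIn_descPochhammer_le hT n
  calc meanUpTo (fun m => max ((omegaIn T m : ℝ) - a) 0) n
      ≤ meanUpTo (fun m => a⁻¹ * ((omegaIn T m : ℝ) * (omegaIn T m - 1))) n := by
        refine meanUpTo_mono fun m _ _ => ?_
        rw [← div_eq_inv_mul, le_div_iff₀ (by linarith)]
        rcases Nat.eq_zero_or_pos (omegaIn T m) with h0 | h0
        · rw [h0, max_eq_right (by push_cast; linarith)]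
          simp
        · have h1 : (1 : ℝ) ≤ omegaIn T m := by exact_mod_cast h0
          rcases le_total ((omegaIn T m : ℝ) - a) 0 with h2 | h2
          · rw [max_eq_right h2]
            nlinarith
          · rw [max_eq_left h2]
            nlinarith
    _ ≤ _ := by
        rw [meanUpTo_const_mul, div_eq_inv_mul]
        gcongr

theorem min_le_rpow_mul_rpow {x L : ℝ} (hx : 0 < x) (hL : 0 < L) :
    min x (x ^ 2 * L) ≤ x ^ (5 / 4 : ℝ) * L ^ (1 / 4 : ℝ) := by
  have e : x ^ (5 / 4 : ℝ) * L ^ (1 / 4 : ℝ) = x * (x * L) ^ (1 / 4 : ℝ) := by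
    rw [Real.mul_rpow hx.le hL.le, ← mul_assoc, show (5 / 4 : ℝ) = 1 + 1 / 4 by norm_num,
      Real.rpow_add hx, Real.rpow_one]
  rw [e]
  have hxL : 0 < x * L := mul_pos hx hL
  rcases le_total 1 (x * L) with h | h
  · refine (min_le_left _ _).trans (le_mul_of_one_le_right hx.le ?_)
    exact Real.one_le_rpow h (by norm_num)
  · refine (min_le_right _ _).trans ?_
    rw [sq, mul_assoc]
    refine mul_le_mul_of_nonneg_left ?_ hx.le
    conv_lhs => rw [← Real.rpow_one (x * L)]
    exact Real.rpow_le_rpow_of_exponent_ge hxL h (by norm_num)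

theorem exists_recipSum_primesMod_le_rpow : ∃ K : ℝ, 0 < K ∧ ∀ l n : ℕ, l.Prime → 3 ≤ l → 3 ≤ n →
    1 ≤ LL n → recipSum (primesMod l n) ≤ K * (l : ℝ) ^ (-(9 / 10) : ℝ) * LL n := by
  have hlog2 : 0 < Real.log 2 := Real.log_pos one_lt_two
  refine ⟨180 / Real.log 2, by positivity, fun l n hl hl3 hn hL => ?_⟩
  have hl0 : (0 : ℝ) < l := by exact_mod_cast hl.pos
  refine (recipSum_primesMod_le hl hl3 hn).trans ?_
  have h1 : Real.log l / l ≤ 10 * (l : ℝ) ^ (-(9 / 10) : ℝ) := by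
    have h2 := Real.log_le_rpow_div hl0.le (show (0 : ℝ) < 1 / 10 by norm_num)
    rw [div_le_iff₀ hl0]
    refine h2.trans (le_of_eq ?_)
    rw [mul_assoc]
    nth_rw 3 [← Real.rpow_one (l : ℝ)]
    rw [← Real.rpow_add hl0, div_div_eq_mul_div, div_one, mul_comm]
    norm_num
  calc 6 / Real.log 2 * (Real.log l / l) * (LL n + 2)
      ≤ 6 / Real.log 2 * (10 * (l : ℝ) ^ (-(9 / 10) : ℝ)) * (3 * LL n) := by
        gcongr
        linarith
    _ = _ := by ring

/-- The contribution of the primes `l` for which `omegaQ m l` is unusually large. -/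
theorem exists_tendsto_mean_sum_max_omegaQ_sub {c : ℝ} (hc : 0 < c) :
    ∃ l₀ : ℕ, Tendsto (fun n => meanUpTo (fun m => ∑ l ∈ Finset.Icc l₀ n with l.Prime,
      max ((omegaQ m l : ℝ) - c * LL n) 0) n / Real.sqrt (LL n)) atTop (nhds 0) := by
  obtain ⟨K, hK0, hK⟩ := exists_recipSum_primesMod_le_rpow
  have hx : Tendsto (fun l : ℕ => K * (l : ℝ) ^ (-(9 / 10) : ℝ)) atTop (nhds 0) := by
    simpa using ((tendsto_rpow_neg_atTop (by norm_num : (0 : ℝ) < 9 / 10)).comp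
      tendsto_natCast_atTop_atTop).const_mul K
  obtain ⟨l₁, hl₁⟩ := eventually_atTop.1
    (hx.eventually_le_const (show 0 < c / 2 by positivity))
  refine ⟨max 3 l₁, ?_⟩
  set M := max (3 * K / (2 * c)) (K ^ 2 / c) with hM
  have hM0 : 0 ≤ M := le_max_of_le_left (by positivity)
  set B := M * ∑' l : ℕ, (l : ℝ) ^ (-(9 / 8) : ℝ) with hB
  have hsumm : Summable fun l : ℕ => (l : ℝ) ^ (-(9 / 8) : ℝ) :=
    Real.summable_nat_rpow.2 (by norm_num)
  have hlim : Tendsto (fun n => B * (LL n) ^ (-(1 / 4) : ℝ)) atTop (nhds 0) := by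
    simpa using ((tendsto_rpow_neg_atTop (by norm_num : (0 : ℝ) < 1 / 4)).comp
      tendsto_LL_atTop).const_mul B
  refine tendsto_of_tendsto_of_tendsto_of_le_of_le' tendsto_const_nhds hlim
    (Eventually.of_forall fun n => div_nonneg (meanUpTo_nonneg fun m _ _ =>
      Finset.sum_nonneg fun _ _ => le_max_right _ _) (Real.sqrt_nonneg _)) ?_
  filter_upwards [eventually_ge_atTop 3, tendsto_LL_atTop.eventually_ge_atTop 1,
    tendsto_LL_atTop.eventually_ge_atTop (1 / c)] with n hn hL hLc
  have hL0 : 0 < LL n := by linarith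
  have hcL : 1 ≤ c * LL n := by
    rw [div_le_iff₀ hc] at hLc
    linarith
  have hterm : ∀ l ∈ (Finset.Icc (max 3 l₁) n).filter Nat.Prime,
      meanUpTo (fun m => max ((omegaQ m l : ℝ) - c * LL n) 0) n ≤
        M * (l : ℝ) ^ (-(9 / 8) : ℝ) * (LL n) ^ (1 / 4 : ℝ) := by
    intro l hl
    obtain ⟨hl1, hlp⟩ := Finset.mem_filter.1 hl
    have hl2 := (Finset.mem_Icc.1 hl1).1
    have hl3 : 3 ≤ l := (le_max_left _ _).trans hl2
    have hl0 : (0 : ℝ) < l := by exact_mod_cast hlp.pos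
    set x := (l : ℝ) ^ (-(9 / 10) : ℝ) with hxdef
    have hx0 : 0 < x := Real.rpow_pos_of_pos hl0 _
    have hS := hK l n hlp hl3 hn hL
    have hxc : K * x ≤ c / 2 := hl₁ l ((le_max_right _ _).trans hl2)
    have hS0 := recipSum_nonneg (primesMod l n)
    have hSc : recipSum (primesMod l n) ≤ c / 2 * LL n := hS.trans (by gcongr)
    have hprime : ∀ p ∈ primesMod l n, p.Prime := fun _ => prime_of_mem_primesMod
    have hb1 := mean_max_omegaIn_sub_le_of_lt hprime (by omega) (primesMod_subset_Icc l n)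
      (a := c * LL n) (by nlinarith)
    have hb2 := mean_max_omegaIn_sub_le hprime n hcL
    rw [meanUpTo_congr (g := fun m => max ((omegaIn (primesMod l n) m : ℝ) - c * LL n) 0)
      fun m h1 h2 => by rw [omegaQ_eq_omegaIn h1 h2]]
    have hc1 : 3 * recipSum (primesMod l n) / (4 * (c * LL n - recipSum (primesMod l n))) ≤
        M * x := by
      refine le_trans ?_ (mul_le_mul_of_nonneg_right (le_max_left _ _) hx0.le)
      calc _ ≤ 3 * (K * x * LL n) / (4 * (c * LL n - c / 2 * LL n)) := by
            refine div_le_div₀ (by positivity) (by linarith) ?_ (by linarith)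
            nlinarith
        _ = _ := by
            field_simp
            ring
    have hc2 : recipSum (primesMod l n) ^ 2 / (c * LL n) ≤ M * (x ^ 2 * LL n) := by
      refine le_trans ?_ (mul_le_mul_of_nonneg_right (le_max_right _ _) (by positivity))
      calc _ ≤ (K * x * LL n) ^ 2 / (c * LL n) := by gcongr
        _ = _ := by field_simp
    have h4 := (le_min (hb1.trans hc1) (hb2.trans hc2))
    rw [← mul_min_of_nonneg _ _ hM0] at h4
    refine h4.trans ?_
    rw [mul_assoc]
    refine mul_le_mul_of_nonneg_left ((min_le_rpow_mul_rpow hx0 hL0).trans (le_of_eq ?_)) hM0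
    rw [hxdef, ← Real.rpow_mul hl0.le]
    norm_num
  rw [meanUpTo_sum, div_le_iff₀ (Real.sqrt_pos.2 hL0), Real.sqrt_eq_rpow]
  refine (Finset.sum_le_sum hterm).trans ?_
  rw [mul_assoc, ← Real.rpow_add hL0, ← Finset.sum_mul, ← Finset.mul_sum, hB]
  have h5 : ∑ l ∈ (Finset.Icc (max 3 l₁) n).filter Nat.Prime, (l : ℝ) ^ (-(9 / 8) : ℝ) ≤
      ∑' l : ℕ, (l : ℝ) ^ (-(9 / 8) : ℝ) :=
    hsumm.sum_le_tsum _ fun l _ => Real.rpow_nonneg (Nat.cast_nonneg l) _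
  norm_num
  norm_num at h5
  gcongr

theorem nonempty_pi_addEquiv_comp {ι κ : Type*} {Z : ι → Type*} [∀ i, AddCommGroup (Z i)]
    {g : κ → ι} (hg : Function.Injective g) (hZ : ∀ i, i ∉ Set.range g → Subsingleton (Z i)) :
    Nonempty ((∀ i, Z i) ≃+ ∀ k, Z (g k)) := by
  let f : (∀ i, Z i) →+ ∀ k, Z (g k) := ⟨⟨fun x k => x (g k), rfl⟩, fun _ _ => rfl⟩
  refine ⟨AddEquiv.ofBijective f ⟨fun x y hxy => funext fun i => ?_, fun y => ?_⟩⟩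
  · by_cases hi : i ∈ Set.range g
    · obtain ⟨k, rfl⟩ := hi
      exact congrFun hxy k
    · exact (hZ i hi).elim _ _
  · have h : ∀ i, ∃ z : Z i, ∀ k (h : g k = i), h ▸ y k = z := by
      intro i
      by_cases hi : i ∈ Set.range g
      · obtain ⟨k, rfl⟩ := hi
        refine ⟨y k, fun l hl => ?_⟩
        obtain rfl := hg hl
        rfl
      · exact ⟨0, fun k hk => (hi ⟨k, hk⟩).elim⟩
    choose x hx using h
    exact ⟨x, funext fun k => (hx (g k) k rfl).symm⟩

theorem nonempty_pi_addEquiv_pi_fiber {ι κ : Type*} (Z : ι → Type*) [∀ i, AddCommGroup (Z i)]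
    (r : ι → κ) : Nonempty ((∀ i, Z i) ≃+ ∀ k, ∀ i : {i // r i = k}, Z i) :=
  ⟨{ toFun := fun f _ i => f i
     invFun := fun g i => g (r i) ⟨i, rfl⟩
     left_inv := fun _ => rfl
     right_inv := fun g => by
       funext k i
       obtain ⟨i, rfl⟩ := i
       rfl
     map_add' := fun _ _ => rfl }⟩

/-- Product of the prime powers `p i ^ e i` over a fibre of `r`, when `r` separates equal primes. -/
theorem nonempty_pi_zmod_addEquiv_fiberProd {ι κ : Type*} [Fintype ι] [DecidableEq κ]
    {p : ι → ℕ} (hp : ∀ i, (p i).Prime) (e : ι → ℕ) (r : ι → κ)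
    (hr : ∀ i j, p i = p j → r i = r j → i = j) :
    Nonempty ((∀ i, ZMod (p i ^ e i)) ≃+ ∀ k, ZMod (∏ i : {i // r i = k}, p i ^ e i)) := by
  obtain ⟨E⟩ := nonempty_pi_addEquiv_pi_fiber (fun i => ZMod (p i ^ e i)) r
  refine ⟨E.trans (AddEquiv.piCongrRight fun k => ?_)⟩
  refine (ZMod.prodEquivPi (fun i : {i // r i = k} => p i ^ e i) fun i j hij => ?_).symm.toAddEquiv
  refine Nat.Coprime.pow _ _ ((Nat.coprime_primes (hp _) (hp _)).2 fun h => hij ?_)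
  exact Subtype.ext (hr _ _ h (i.2.trans j.2.symm))

theorem exists_rank_of_antitone {n : ℕ} (p e : Fin n → ℕ) (he : Antitone e) :
    ∃ r : Fin n → Fin n, (∀ i j, p i = p j → r i = r j → i = j) ∧
      ∀ i k, k ≤ r i → ∃ j, r j = k ∧ p j = p i ∧ e i ≤ e j := by
  classical
  let P : ℕ → ℕ → Prop := fun a k => ∃ h : k < n, p ⟨k, h⟩ = a
  have hP : ∀ i : Fin n, P (p i) i := fun i => ⟨i.2, rfl⟩
  refine ⟨fun i => ⟨Nat.count (P (p i)) i, (Nat.count_le (P (p i))).trans_lt i.2⟩,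
    fun i j hij h => ?_,
    fun i k hk => ?_⟩
  · simp only [Fin.mk.injEq] at h
    rw [← hij] at h
    exact Fin.ext (Nat.count_injective (hP i) (hij ▸ hP j) h)
  · have hk' : (k : ℕ) ≤ Nat.count (P (p i)) i := hk
    have hcard : ∀ hf : (Set.ofPred (P (p i))).Finite, (k : ℕ) < hf.toFinset.card := by
      intro hf
      refine hk'.trans_lt ?_
      rw [Nat.count_eq_card_filter_range]
      refine Finset.card_lt_card (Finset.ssubset_iff.2 ⟨i, by simp, fun x hx => ?_⟩)
      rw [Finset.mem_insert] at hx
      rcases hx with rfl | hx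
      · simpa using hP i
      · simpa using (Finset.mem_filter.1 hx).2
    obtain ⟨hlt, hpj⟩ := Nat.nth_mem _ hcard
    have hle : Nat.nth (P (p i)) k ≤ i := by
      by_contra! hcon
      have := Nat.count_strict_mono (hP i) hcon
      rw [Nat.count_nth hcard] at this
      omega
    refine ⟨⟨_, hlt⟩, Fin.ext ?_, hpj, he hle⟩
    simp only [hpj]
    exact Nat.count_nth hcard

theorem exists_invariantFactors (G : Type*) [AddCommGroup G] [Finite G] :
    ∃ (K : ℕ) (lam : Fin K → ℕ), (∀ j, 1 < lam j) ∧ (∀ j k, j ≤ k → lam j ∣ lam k) ∧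
      Nonempty (G ≃+ ∀ j, ZMod (lam j)) := by
  classical
  obtain ⟨ι, _, p, hp, e, ⟨E⟩⟩ := AddCommGroup.equiv_directSum_zmod_of_finite G
  let n := Fintype.card ι
  let s₀ : Fin n ≃ ι := (Fintype.equivFin ι).symm
  let s : Fin n ≃ ι := (Tuple.sort fun i => OrderDual.toDual (e (s₀ i))).trans s₀
  have hs : Antitone fun i => e (s i) := fun i j hij =>
    Tuple.monotone_sort (fun i => OrderDual.toDual (e (s₀ i))) hij
  obtain ⟨r, hr, hr'⟩ := exists_rank_of_antitone (fun i => p (s i)) _ hs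
  obtain ⟨E₁⟩ := nonempty_pi_addEquiv_comp (Z := fun i => ZMod (p i ^ e i)) s.injective
    fun i hi => (hi (s.surjective i)).elim
  obtain ⟨E₂⟩ := nonempty_pi_zmod_addEquiv_fiberProd (fun i => hp (s i)) (fun i => e (s i))
    (fun i => Fin.rev (r i)) fun i j hij h => hr i j hij (Fin.rev_injective h)
  set L : Fin n → ℕ := fun k => ∏ i : {i // Fin.rev (r i) = k}, p (s i) ^ e (s i) with hL
  have hL0 : ∀ k, 0 < L k := fun k => Finset.prod_pos fun i _ => pow_pos (hp _).pos _
  have hdvd : ∀ j k, j ≤ k → L j ∣ L k := by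
    intro j k hjk
    refine Finset.prod_dvd_of_isRelPrime (fun a _ b _ hab => ?_) fun a _ => ?_
    · rw [Function.onFun, ← Nat.coprime_iff_isRelPrime]
      refine Nat.Coprime.pow _ _ ((Nat.coprime_primes (hp _) (hp _)).2 fun h => hab ?_)
      exact Subtype.ext (hr _ _ h (Fin.rev_injective (a.2.trans b.2.symm)))
    · obtain ⟨b, hb, hpb, heb⟩ := hr' a (Fin.rev k) (by
        rw [← Fin.rev_le_rev, Fin.rev_rev, a.2]; exact hjk)
      have hb' : Fin.rev (r b) = k := by rw [hb, Fin.rev_rev]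
      refine dvd_trans ?_ (Finset.dvd_prod_of_mem _
        (Finset.mem_univ (⟨b, hb'⟩ : {i // Fin.rev (r i) = k})))
      simp only [hpb]
      exact pow_dvd_pow _ heb
  let S := Finset.univ.filter fun k => L k ≠ 1
  let o := S.orderIsoOfFin rfl
  obtain ⟨E₃⟩ := nonempty_pi_addEquiv_comp (Z := fun k => ZMod (L k))
    (g := fun k => (o k : Fin n)) (Subtype.val_injective.comp o.injective) fun k hk => by
      have h1 : L k = 1 := by
        by_contra h
        exact hk ⟨o.symm ⟨k, by simpa [S] using h⟩, by simp⟩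
      rw [h1]
      infer_instance
  refine ⟨S.card, fun k => L (o k), fun k => ?_, fun j k hjk => hdvd _ _ (o.monotone hjk),
    ⟨(E.trans (DirectSum.addEquivProd _)).trans (E₁.trans (E₂.trans E₃))⟩⟩
  have h1 : L (o k) ≠ 1 := (Finset.mem_filter.1 (o k).2).2
  exact (Nat.one_lt_iff_ne_zero_and_ne_one).2 ⟨(hL0 _).ne', h1⟩

/-- The number of solutions of `x ^ n = 1` in `G`. -/
def torsionCard (G : Type*) [CommGroup G] (n : ℕ) : ℕ := Nat.card {x : G // x ^ n = 1}

theorem torsionCard_congr {G H : Type*} [CommGroup G] [CommGroup H] (e : G ≃* H) (n : ℕ) :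
    torsionCard G n = torsionCard H n :=
  Nat.card_congr (e.toEquiv.subtypeEquiv fun x => by
    simp [← map_pow])

theorem torsionCard_pi {ι : Type*} [Fintype ι] (G : ι → Type*) [∀ i, CommGroup (G i)] (n : ℕ) :
    torsionCard (∀ i, G i) n = ∏ i, torsionCard (G i) n := by
  simp only [torsionCard]
  rw [← Nat.card_pi]
  refine Nat.card_congr (Equiv.trans (Equiv.subtypeEquivRight fun x => ?_)
    Equiv.subtypePiEquivPi)
  rw [funext_iff]
  rfl

theorem torsionCard_of_isCyclic (G : Type*) [CommGroup G] [Finite G] [IsCyclic G] (n : ℕ) :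
    torsionCard G n = (Nat.card G).gcd n :=
  IsCyclic.card_powMonoidHom_ker G n

theorem torsionCard_pos (G : Type*) [CommGroup G] [Finite G] (n : ℕ) : 0 < torsionCard G n :=
  Nat.card_pos_iff.2 ⟨⟨1, one_pow n⟩, inferInstance⟩

theorem torsionCard_le_of_dvd (G : Type*) [CommGroup G] [Finite G] {m n : ℕ} (h : m ∣ n) :
    torsionCard G m ≤ torsionCard G n := by
  obtain ⟨k, rfl⟩ := h
  exact Nat.card_le_card_of_injective (fun x => ⟨x.1, by rw [pow_mul, x.2, one_pow]⟩)
    fun x y hxy => Subtype.ext (Subtype.mk.inj hxy)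

theorem torsionCard_mul_le (G : Type*) [CommGroup G] [Finite G] (m n : ℕ) :
    torsionCard G (m * n) ≤ torsionCard G m * torsionCard G n := by
  have hs : ∀ y : G, ∃ z : G, ∀ x : G, x ^ m = y → z ^ m = y := fun y => by
    by_cases h : ∃ x : G, x ^ m = y
    · obtain ⟨x, hx⟩ := h
      exact ⟨x, fun _ _ => hx⟩
    · exact ⟨1, fun x hx => (h ⟨x, hx⟩).elim⟩
  choose s hs using hs
  rw [torsionCard, torsionCard, torsionCard, ← Nat.card_prod]
  refine Nat.card_le_card_of_injective (fun x =>
    (⟨x.1 / s (x.1 ^ m), by rw [div_pow, hs _ x.1 rfl, div_self']⟩,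
      ⟨x.1 ^ m, by rw [← pow_mul, x.2]⟩)) fun x y hxy => ?_
  simp only [Prod.mk.injEq, Subtype.mk.injEq] at hxy
  obtain ⟨h1, h2⟩ := hxy
  rw [h2] at h1
  exact Subtype.ext (div_left_injective h1)

theorem torsionCard_eq_one_of_coprime (G : Type*) [CommGroup G] [Finite G] {n : ℕ}
    (h : (Nat.card G).Coprime n) : torsionCard G n = 1 := by
  refine Nat.card_eq_one_iff_unique.2 ⟨⟨fun x y => Subtype.ext ?_⟩, ⟨1, one_pow n⟩⟩
  exact h.pow_left_bijective.injective (x.2.trans y.2.symm)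

theorem gcd_prime_pow_succ {p : ℕ} (hp : p.Prime) (N a : ℕ) :
    N.gcd (p ^ (a + 1)) = N.gcd (p ^ a) * p ^ (if p ^ (a + 1) ∣ N then 1 else 0) := by
  split_ifs with h
  · rw [Nat.gcd_eq_right h, Nat.gcd_eq_right ((pow_dvd_pow p a.le_succ).trans h), pow_one, pow_succ]
  · rw [pow_zero, mul_one]
    refine Nat.dvd_antisymm (Nat.dvd_gcd (Nat.gcd_dvd_left _ _) ?_)
      (Nat.gcd_dvd_gcd_of_dvd_right _ (pow_dvd_pow p a.le_succ))
    obtain ⟨j, hj, hj'⟩ := (Nat.dvd_prime_pow hp).1 (Nat.gcd_dvd_right N (p ^ (a + 1)))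
    rw [hj']
    refine pow_dvd_pow p (Nat.lt_succ_iff.1 (lt_of_le_of_ne hj ?_))
    rintro rfl
    exact h (hj' ▸ Nat.gcd_dvd_left _ _)

theorem torsionCard_units_two_pow_le (k : ℕ) : torsionCard (ZMod (2 ^ k))ˣ 2 ≤ 4 := by
  have hcard : Nat.card (ZMod (2 ^ k))ˣ = (2 ^ k).totient := by
    have : NeZero (2 ^ k) := ⟨by positivity⟩
    rw [Nat.card_eq_fintype_card, ZMod.card_units_eq_totient]
  rcases lt_or_ge k 2 with hk | hk
  · have : Nat.card (ZMod (2 ^ k))ˣ ≤ 4 := by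
      rw [hcard]
      interval_cases k <;> decide
    exact (Finite.card_subtype_le _).trans this
  · obtain ⟨k, rfl⟩ := Nat.exists_eq_add_of_le' hk
    set H := (ZMod (2 ^ (k + 2)))ˣ
    have h5 : Nat.Coprime 5 (2 ^ (k + 2)) := Nat.Coprime.pow_right _ (by norm_num)
    let u : H := ZMod.unitOfCoprime 5 h5
    have hu : orderOf u = 2 ^ k := by
      rw [← orderOf_units, ZMod.coe_unitOfCoprime, ← ZMod.orderOf_five k]
      norm_num
    have h1 := Subgroup.card_mul_index (powMonoidHom 2 : H →* H).ker
    rw [Subgroup.index_ker, hcard, Nat.totient_prime_pow Nat.prime_two (by omega)] at h1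
    have h2 : 2 ^ k ≤ 2 * Nat.card (powMonoidHom 2 : H →* H).range := by
      have h3 : Nat.card (Subgroup.zpowers (u ^ 2)) ≤
          Nat.card (powMonoidHom 2 : H →* H).range :=
        Subgroup.card_le_of_le (by
          rw [Subgroup.zpowers_le]
          exact ⟨u, rfl⟩)
      rw [Nat.card_zpowers, orderOf_pow, hu] at h3
      have h4 : (2 ^ k).gcd 2 ≤ 2 := Nat.gcd_le_right _ (by norm_num)
      have h5 := Nat.div_mul_cancel (Nat.gcd_dvd_left (2 ^ k) 2)
      nlinarith
    have h6 : torsionCard H 2 * 2 ^ k ≤ 4 * 2 ^ k := by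
      calc torsionCard H 2 * 2 ^ k
          ≤ torsionCard H 2 * (2 * Nat.card (powMonoidHom 2 : H →* H).range) :=
            Nat.mul_le_mul_left _ h2
        _ = 2 * (Nat.card (powMonoidHom 2 : H →* H).ker *
              Nat.card (powMonoidHom 2 : H →* H).range) := by
            rw [mul_left_comm]; rfl
        _ = 4 * 2 ^ k := by rw [h1, show k + 2 - 1 = k + 1 by omega, pow_succ]; ring
    exact Nat.le_of_mul_le_mul_right h6 (by positivity)

theorem torsionCard_units_prime_pow_succ {r p : ℕ} (hr : r.Prime) (hp : p.Prime) {k : ℕ}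
    (hk : 0 < k) (a : ℕ) :
    torsionCard (ZMod (r ^ k))ˣ (p ^ a) * p ^ (if p ^ (a + 1) ∣ r - 1 then 1 else 0) ≤
        torsionCard (ZMod (r ^ k))ˣ (p ^ (a + 1)) ∧
      torsionCard (ZMod (r ^ k))ˣ (p ^ (a + 1)) ≤
        torsionCard (ZMod (r ^ k))ˣ (p ^ a) *
          p ^ ((if p ^ (a + 1) ∣ r - 1 then 1 else 0) + if r = p then 2 else 0) := by
  have : NeZero (r ^ k) := ⟨pow_ne_zero _ hr.ne_zero⟩
  have hcard : Nat.card (ZMod (r ^ k))ˣ = r ^ (k - 1) * (r - 1) := by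
    rw [Nat.card_eq_fintype_card, ZMod.card_units_eq_totient, Nat.totient_prime_pow hr hk]
  by_cases hr2 : r = 2
  · subst hr2
    have h1 : ¬ p ^ (a + 1) ∣ 2 - 1 := fun h =>
      (Nat.one_lt_pow a.succ_ne_zero hp.one_lt).ne' (Nat.dvd_one.1 h)
    rw [if_neg h1, pow_zero, mul_one, zero_add]
    refine ⟨torsionCard_le_of_dvd _ (pow_dvd_pow _ a.le_succ), ?_⟩
    rw [pow_succ]
    refine (torsionCard_mul_le _ _ _).trans (Nat.mul_le_mul_left _ ?_)
    split_ifs with h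
    · subst h
      exact torsionCard_units_two_pow_le k
    · rw [pow_zero]
      refine (torsionCard_eq_one_of_coprime _ ?_).le
      rw [hcard]
      simpa using Nat.Coprime.pow_left _ ((Nat.coprime_primes Nat.prime_two hp).2 h)
  · have := ZMod.isCyclic_units_of_prime_pow r hr hr2 k
    rw [torsionCard_of_isCyclic, torsionCard_of_isCyclic, gcd_prime_pow_succ hp, hcard]
    refine ⟨Nat.mul_le_mul_left _ (Nat.pow_le_pow_right hp.pos ?_),
      Nat.mul_le_mul_left _ (Nat.pow_le_pow_right hp.pos ?_)⟩
    · split_ifs with h1 h2 h2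
      · exact le_rfl
      · exact (h2 (h1.mul_left _)).elim
      · exact Nat.zero_le _
      · exact le_rfl
    · by_cases hrp : r = p
      · rw [if_pos hrp]
        split_ifs <;> omega
      · rw [if_neg hrp, add_zero]
        have hc : Nat.Coprime (p ^ (a + 1)) (r ^ (k - 1)) :=
          Nat.Coprime.pow _ _ ((Nat.coprime_primes hp hr).2 (Ne.symm hrp))
        simp only [hc.dvd_mul_left, le_refl]

theorem torsionCard_units_eq_prod {m : ℕ} (hm : m ≠ 0) (n : ℕ) :
    torsionCard (ZMod m)ˣ n =
      ∏ r : m.primeFactors, torsionCard (ZMod ((r : ℕ) ^ m.factorization r))ˣ n := by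
  rw [torsionCard_congr ((Units.mapEquiv (ZMod.equivPi m hm).toMulEquiv).trans MulEquiv.piUnits),
    torsionCard_pi]

theorem sum_ite_dvd_sub_one_eq_omegaQ (m q : ℕ) :
    ∑ r : m.primeFactors, (if q ∣ (r : ℕ) - 1 then 1 else 0) = omegaQ m q := by
  rw [Finset.sum_coe_sort m.primeFactors fun r => if q ∣ r - 1 then 1 else 0,
    Finset.sum_boole, omegaQ, Nat.cast_id]
  congr 1
  refine Finset.filter_congr fun r hr => ?_
  rw [← Nat.modEq_iff_dvd' (Nat.prime_of_mem_primeFactors hr).one_le]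
  exact eq_comm

theorem torsionCard_units_succ {m p : ℕ} (hm : m ≠ 0) (hp : p.Prime) (a : ℕ) :
    torsionCard (ZMod m)ˣ (p ^ a) * p ^ omegaQ m (p ^ (a + 1)) ≤
        torsionCard (ZMod m)ˣ (p ^ (a + 1)) ∧
      torsionCard (ZMod m)ˣ (p ^ (a + 1)) ≤
        torsionCard (ZMod m)ˣ (p ^ a) * p ^ (omegaQ m (p ^ (a + 1)) + 2) := by
  have hloc := fun r : m.primeFactors =>
    torsionCard_units_prime_pow_succ (Nat.prime_of_mem_primeFactors r.2) hp
      (Nat.Prime.factorization_pos_of_dvd (Nat.prime_of_mem_primeFactors r.2) hm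
        (Nat.dvd_of_mem_primeFactors r.2)) a
  simp only [torsionCard_units_eq_prod hm]
  rw [← sum_ite_dvd_sub_one_eq_omegaQ]
  constructor
  · rw [← Finset.prod_pow_eq_pow_sum, ← Finset.prod_mul_distrib]
    exact Finset.prod_le_prod' fun r _ => (hloc r).1
  · refine (Finset.prod_le_prod' fun r _ => (hloc r).2).trans ?_
    rw [Finset.prod_mul_distrib, Finset.prod_pow_eq_pow_sum, Finset.sum_add_distrib]
    refine Nat.mul_le_mul_left _ (Nat.pow_le_pow_right hp.pos (Nat.add_le_add_left ?_ _))
    rw [Finset.sum_coe_sort m.primeFactors fun r => if r = p then 2 else 0,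
      Finset.sum_ite_eq']
    split_ifs <;> omega

theorem omegaQ_le_card_dvd_le {m K : ℕ} (hm : m ≠ 0) {lam : Fin K → ℕ} (hlam : ∀ j, 1 < lam j)
    (e : (ZMod m)ˣ ≃* Multiplicative (∀ j, ZMod (lam j))) {q : ℕ} (hq : IsPrimePow q) :
    omegaQ m q ≤ (Finset.univ.filter fun j => q ∣ lam j).card ∧
      (Finset.univ.filter fun j => q ∣ lam j).card ≤ omegaQ m q + 2 := by
  obtain ⟨p, b, hp, hb, rfl⟩ := hq
  rw [← Nat.prime_iff] at hp
  obtain ⟨a, rfl⟩ := Nat.exists_eq_add_of_lt hb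
  rw [zero_add]
  have : ∀ j, NeZero (lam j) := fun j => ⟨(hlam j).ne_bot⟩
  have ht : ∀ n, torsionCard (ZMod m)ˣ n = ∏ j, (lam j).gcd n := fun n => by
    rw [torsionCard_congr (e.trans (MulEquiv.piMultiplicative _)), torsionCard_pi]
    refine Finset.prod_congr rfl fun j _ => ?_
    rw [torsionCard_of_isCyclic]
    simp
  have : NeZero m := ⟨hm⟩
  have hpos := torsionCard_pos (ZMod m)ˣ (p ^ a)
  have hstep : torsionCard (ZMod m)ˣ (p ^ (a + 1)) = torsionCard (ZMod m)ˣ (p ^ a) *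
      p ^ (Finset.univ.filter fun j => p ^ (a + 1) ∣ lam j).card := by
    rw [ht, ht, Finset.card_filter, ← Finset.prod_pow_eq_pow_sum, ← Finset.prod_mul_distrib]
    exact Finset.prod_congr rfl fun j _ => gcd_prime_pow_succ hp _ _
  obtain ⟨h1, h2⟩ := torsionCard_units_succ hm hp a
  rw [hstep] at h1 h2
  exact ⟨(Nat.pow_le_pow_iff_right hp.one_lt).1 (Nat.le_of_mul_le_mul_left h1 hpos),
    (Nat.pow_le_pow_iff_right hp.one_lt).1 (Nat.le_of_mul_le_mul_left h2 hpos)⟩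

theorem exists_invariantFactors_units {m : ℕ} (hm : m ≠ 0) :
    ∃ (K : ℕ) (lam : Fin K → ℕ), (∀ j, 1 < lam j) ∧ (∀ j k, j ≤ k → lam j ∣ lam k) ∧
      Nonempty ((ZMod m)ˣ ≃* Multiplicative (∀ j, ZMod (lam j))) := by
  have : NeZero m := ⟨hm⟩
  obtain ⟨K, lam, h1, h2, ⟨e⟩⟩ := exists_invariantFactors (Additive (ZMod m)ˣ)
  exact ⟨K, lam, h1, h2, ⟨AddEquiv.toMultiplicativeRight e⟩⟩

theorem IsPrimePow.exists_prime_pow_succ {q : ℕ} (hq : IsPrimePow q) :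
    ∃ p a : ℕ, p.Prime ∧ q = p ^ (a + 1) ∧ q.totient = p ^ a * (p - 1) := by
  obtain ⟨p, b, hp, hb, rfl⟩ := hq
  rw [← Nat.prime_iff] at hp
  obtain ⟨a, rfl⟩ := Nat.exists_eq_add_of_lt hb
  rw [zero_add]
  exact ⟨p, a, hp, rfl, Nat.totient_prime_pow_succ hp a⟩

theorem coprime_of_totient_eq {q r : ℕ} (hq : IsPrimePow q) (hr : IsPrimePow r) (hqr : q ≠ r)
    (h : q.totient = r.totient) : q.Coprime r := by
  obtain ⟨p, a, hp, rfl, hqa⟩ := hq.exists_prime_pow_succ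
  obtain ⟨p', b, hp', rfl, hrb⟩ := hr.exists_prime_pow_succ
  refine Nat.Coprime.pow _ _ ((Nat.coprime_primes hp hp').2 ?_)
  rintro rfl
  rw [hqa, hrb] at h
  have := Nat.eq_of_mul_eq_mul_right (Nat.sub_pos_of_lt hp.one_lt) h
  exact hqr (by rw [pow_succ, pow_succ, this])

theorem prime_or_prime_of_totient_eq {q r : ℕ} (hq : IsPrimePow q) (hr : IsPrimePow r)
    (hqr : q ≠ r) (h : q.totient = r.totient) : q.Prime ∨ r.Prime := by
  have hc := coprime_of_totient_eq hq hr hqr h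
  obtain ⟨p, a, hp, rfl, hqa⟩ := hq.exists_prime_pow_succ
  obtain ⟨p', b, hp', rfl, hrb⟩ := hr.exists_prime_pow_succ
  have hpp : p ≠ p' := by
    rintro rfl
    exact hp.ne_one (Nat.eq_one_of_dvd_coprimes hc (dvd_pow_self p a.succ_ne_zero)
      (dvd_pow_self p b.succ_ne_zero))
  rcases Nat.eq_zero_or_pos a with rfl | ha
  · exact Or.inl (by simpa using hp)
  rcases Nat.eq_zero_or_pos b with rfl | hb
  · exact Or.inr (by simpa using hp')
  have key : ∀ {s t c e : ℕ}, s.Prime → t.Prime → s ≠ t → 0 < c →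
      s ^ c * (s - 1) = t ^ e * (t - 1) → s ≤ t - 1 := by
    intro s t c e hs ht hst hc hE
    have hdvd : s ∣ t ^ e * (t - 1) := hE ▸ (dvd_pow_self s hc.ne').mul_right _
    rcases hs.dvd_mul.1 hdvd with h' | h'
    · exact (hst ((Nat.prime_dvd_prime_iff_eq hs ht).1 (hs.dvd_of_dvd_pow h'))).elim
    · exact Nat.le_of_dvd (Nat.sub_pos_of_lt ht.one_lt) h'
  rw [hqa, hrb] at h
  have h1 := key hp hp' hpp ha h
  have h2 := key hp' hp hpp.symm hb h.symm
  have := hp.two_le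
  omega

theorem eq_or_eq_of_totient_eq {q r s : ℕ} (hq : IsPrimePow q) (hr : IsPrimePow r)
    (hs : IsPrimePow s) (hqr : q ≠ r) (h : q.totient = r.totient) (h' : s.totient = q.totient) :
    s = q ∨ s = r := by
  by_contra! hcon
  have hprime : ∀ {a b : ℕ}, a.Prime → b.Prime → a.totient = b.totient → a = b := by
    intro a b ha hb hab
    rw [Nat.totient_prime ha, Nat.totient_prime hb] at hab
    have := ha.pos
    have := hb.pos
    omega
  rcases prime_or_prime_of_totient_eq hq hr hqr h with h1 | h1
  · rcases prime_or_prime_of_totient_eq hs hr hcon.2 (h'.trans h) with h2 | h2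
    · exact hcon.1 (hprime h2 h1 h')
    · exact hqr (hprime h1 h2 h)
  · rcases prime_or_prime_of_totient_eq hs hq hcon.1 h' with h2 | h2
    · exact hcon.2 (hprime h2 h1 (h'.trans h))
    · exact hqr (hprime h2 h1 h)

theorem eq_of_dvd_of_totient_le {q r : ℕ} (hq : IsPrimePow q) (hr : IsPrimePow r) (hdvd : q ∣ r)
    (h : r.totient ≤ q.totient) : q = r := by
  by_contra hne
  have hle := Nat.le_of_dvd (Nat.totient_pos.2 hr.pos) (Nat.totient_dvd_of_dvd hdvd)
  have hc := coprime_of_totient_eq hq hr hne (le_antisymm hle h)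
  exact hq.ne_one (Nat.eq_one_of_dvd_coprimes hc dvd_rfl hdvd)

theorem IsPrimePow.le_two_mul_totient {q : ℕ} (hq : IsPrimePow q) : q ≤ 2 * q.totient := by
  obtain ⟨p, a, hp, rfl, hqa⟩ := hq.exists_prime_pow_succ
  rw [hqa, pow_succ, mul_left_comm]
  have := hp.two_le
  exact Nat.mul_le_mul_left _ (by omega)

theorem totient_le_of_ppKey_le {q r : ℕ} (hr : IsPrimePow r) (h : ppKey q ≤ ppKey r) :
    q.totient ≤ r.totient := by
  by_contra! hlt
  have := hr.le_two_mul_totient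
  simp only [ppKey] at h
  nlinarith

theorem ppKey_injOn {q r : ℕ} (hq : IsPrimePow q) (hr : IsPrimePow r) (h : ppKey q = ppKey r) :
    q = r := by
  have h1 := le_antisymm (totient_le_of_ppKey_le hr h.le) (totient_le_of_ppKey_le hq h.ge)
  simp only [ppKey, h1] at h
  omega

theorem infinite_ppKey : {k | ∃ q, IsPrimePow q ∧ ppKey q = k}.Infinite := by
  refine Set.infinite_of_injective_forall_mem (f := fun n => ppKey (Nat.nth Nat.Prime n))
    (fun m n h => ?_) fun n => ⟨_, (Nat.prime_nth_prime n).isPrimePow, rfl⟩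
  exact Nat.nth_injective Nat.infinite_setOfPred_prime
    (ppKey_injOn (Nat.prime_nth_prime m).isPrimePow (Nat.prime_nth_prime n).isPrimePow h)

theorem qt_mem (i : ℕ) : IsPrimePow (qt i) ∧ ppKey (qt i) = ppNthKey (i - 1) :=
  Nat.sInf_mem (s := {q | IsPrimePow q ∧ ppKey q = ppNthKey (i - 1)})
    (Nat.nth_mem_of_infinite infinite_ppKey (i - 1))

theorem isPrimePow_qt (i : ℕ) : IsPrimePow (qt i) := (qt_mem i).1

theorem ppKey_qt_lt {i j : ℕ} (hi : 1 ≤ i) (hij : i < j) : ppKey (qt i) < ppKey (qt j) := by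
  rw [(qt_mem i).2, (qt_mem j).2]
  exact Nat.nth_strictMono infinite_ppKey (by omega)

theorem qt_ne {i j : ℕ} (hi : 1 ≤ i) (hij : i < j) : qt i ≠ qt j := fun h =>
  (ppKey_qt_lt hi hij).ne (congrArg ppKey h)

theorem totient_qt_le {i j : ℕ} (hi : 1 ≤ i) (hij : i ≤ j) :
    (qt i).totient ≤ (qt j).totient := by
  rcases hij.eq_or_lt with rfl | hij
  · exact le_rfl
  · exact totient_le_of_ppKey_le (isPrimePow_qt j) (ppKey_qt_lt hi hij).le

theorem exists_qt_eq {q : ℕ} (hq : IsPrimePow q) : ∃ j, 1 ≤ j ∧ qt j = q := by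
  classical
  refine ⟨Nat.count (fun k => ∃ q, IsPrimePow q ∧ ppKey q = k) (ppKey q) + 1, by omega,
    ppKey_injOn (isPrimePow_qt _) hq ?_⟩
  rw [(qt_mem _).2, Nat.add_sub_cancel]
  exact Nat.nth_count ⟨q, hq, rfl⟩

theorem IsPrimePow.dvd_lcm_iff {q a b : ℕ} (hq : IsPrimePow q) (ha : a ≠ 0) (hb : b ≠ 0) :
    q ∣ Nat.lcm a b ↔ q ∣ a ∨ q ∣ b := by
  obtain ⟨p, k, hp, rfl, -⟩ := hq.exists_prime_pow_succ
  rw [hp.pow_dvd_iff_le_factorization (Nat.lcm_ne_zero ha hb),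
    hp.pow_dvd_iff_le_factorization ha, hp.pow_dvd_iff_le_factorization hb,
    Nat.factorization_lcm ha hb, Finsupp.sup_apply, le_sup_iff]

theorem IsPrimePow.dvd_finset_lcm {ι : Type*} {q : ℕ} (hq : IsPrimePow q) {s : Finset ι}
    {f : ι → ℕ} (hf : ∀ i ∈ s, f i ≠ 0) (h : q ∣ s.lcm f) : ∃ i ∈ s, q ∣ f i := by
  classical
  induction s using Finset.induction_on with
  | empty => exact (hq.ne_one (Nat.dvd_one.1 (by simpa using h))).elim
  | insert i s hi ih =>
    rw [Finset.lcm_insert] at h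
    have hs : s.lcm f ≠ 0 := by
      rw [Ne, Finset.lcm_eq_zero_iff]
      rintro ⟨j, hj, hj0⟩
      exact hf j (Finset.mem_insert_of_mem hj) hj0
    rcases (hq.dvd_lcm_iff (hf i (Finset.mem_insert_self _ _)) hs).1 h with h | h
    · exact ⟨i, Finset.mem_insert_self _ _, h⟩
    · obtain ⟨j, hj, hjq⟩ := ih (fun j hj => hf j (Finset.mem_insert_of_mem hj)) h
      exact ⟨j, Finset.mem_insert_of_mem hj, hjq⟩

theorem dvd_Lseq_iff {i q : ℕ} (hq : IsPrimePow q) :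
    q ∣ Lseq i ↔ ∃ j, 1 ≤ j ∧ j ≤ i ∧ q ∣ qt j := by
  refine ⟨fun h => ?_, fun ⟨j, hj, hji, h⟩ =>
    h.trans (Finset.dvd_lcm (Finset.mem_Icc.2 ⟨hj, hji⟩))⟩
  obtain ⟨j, hj, h⟩ := hq.dvd_finset_lcm (fun j _ => (isPrimePow_qt j).ne_zero) h
  exact ⟨j, (Finset.mem_Icc.1 hj).1, (Finset.mem_Icc.1 hj).2, h⟩

theorem Lseq_ne_zero (i : ℕ) : Lseq i ≠ 0 := by
  rw [Lseq, Ne, Finset.lcm_eq_zero_iff]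
  rintro ⟨j, -, hj⟩
  exact (isPrimePow_qt j).ne_zero hj

theorem totient_qt_eq_of_ncard_UFO {i : ℕ} (hi : 1 ≤ i) (h : (UFO i).ncard = 2) :
    (qt i).totient = (qt (i + 1)).totient := by
  refine le_antisymm (totient_qt_le hi i.le_succ) (not_lt.1 fun hlt => ?_)
  rw [UFO, if_pos hlt, Set.ncard_singleton] at h
  omega

theorem totient_qt_lt_of_ncard_UFO {i : ℕ} (h : (UFO i).ncard = 1) :
    (qt i).totient < (qt (i + 1)).totient := by
  by_contra hlt
  rw [UFO, if_neg hlt] at h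
  have hL : Lseq i = Nat.lcm (Lseq (i - 1)) (qt (i + 1)) := by
    by_contra hne
    rw [Set.ncard_pair hne] at h
    omega
  have hdvd : qt (i + 1) ∣ Lseq i := hL ▸ Nat.dvd_lcm_right _ _
  obtain ⟨j, hj, hji, h'⟩ := (dvd_Lseq_iff (isPrimePow_qt _)).1 hdvd
  exact (qt_ne hj (Nat.lt_succ_of_le hji)).symm (eq_of_dvd_of_totient_le (isPrimePow_qt _)
    (isPrimePow_qt _) h' (totient_qt_le hj (by omega)))

theorem dvd_Lseq_iff_totient_le {i q : ℕ}
    (h : (qt i).totient < (qt (i + 1)).totient) (hq : IsPrimePow q) :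
    q ∣ Lseq i ↔ q.totient ≤ (qt i).totient := by
  rw [dvd_Lseq_iff hq]
  constructor
  · rintro ⟨j, hj, hji, hqj⟩
    exact (Nat.le_of_dvd (Nat.totient_pos.2 (isPrimePow_qt j).pos)
      (Nat.totient_dvd_of_dvd hqj)).trans (totient_qt_le hj hji)
  · intro hle
    obtain ⟨j, hj, rfl⟩ := exists_qt_eq hq
    refine ⟨j, hj, not_lt.1 fun hij => ?_, dvd_rfl⟩
    have := totient_qt_le (by omega : 1 ≤ i + 1) hij
    omega

theorem totient_qt_succ_le {i q : ℕ} (hq : IsPrimePow q)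
    (h : (qt i).totient < q.totient) : (qt (i + 1)).totient ≤ q.totient := by
  obtain ⟨j, hj, rfl⟩ := exists_qt_eq hq
  refine totient_qt_le (by omega) (not_lt.1 fun hij => h.not_ge (totient_qt_le hj (by omega)))

theorem mean_max_sub_omegaIn_le_of_lt {T : Finset ℕ} (hT : ∀ p ∈ T, p.Prime) {n : ℕ} (hn : 0 < n)
    (hTn : T ⊆ Finset.Icc 1 n) {a : ℝ} (ha : a < recipSum T) :
    meanUpTo (fun m => max (a - (omegaIn T m : ℝ)) 0) n ≤
      3 * recipSum T / (4 * (recipSum T - a)) := by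
  have hpos : 0 < recipSum T - a := sub_pos.2 ha
  have h := mean_sq_omegaIn_sub_le hT hn hTn
  calc meanUpTo (fun m => max (a - (omegaIn T m : ℝ)) 0) n
      ≤ meanUpTo (fun m => (4 * (recipSum T - a))⁻¹ * ((omegaIn T m : ℝ) - recipSum T) ^ 2) n := by
        refine meanUpTo_mono fun m _ _ => ?_
        have := max_le_sq_div (u := a - (omegaIn T m : ℝ)) hpos
        rwa [show (a - (omegaIn T m : ℝ) + (recipSum T - a)) ^ 2 =
          ((omegaIn T m : ℝ) - recipSum T) ^ 2 by ring, div_eq_inv_mul] at this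
    _ ≤ _ := by
        rw [meanUpTo_const_mul, div_eq_inv_mul]
        gcongr

theorem tendsto_div_sqrt_LL_of_abs_le {f : ℕ → ℝ} {C : ℝ} (h : ∀ᶠ n in atTop, |f n| ≤ C) :
    Tendsto (fun n => f n / Real.sqrt (LL n)) atTop (nhds 0) := by
  refine squeeze_zero_norm' (a := fun n => C * (Real.sqrt (LL n))⁻¹) ?_
    (by simpa using tendsto_inv_sqrt_LL.const_mul C)
  filter_upwards [h] with n hn
  rw [Real.norm_eq_abs, abs_div, abs_of_nonneg (Real.sqrt_nonneg _), div_eq_mul_inv]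
  exact mul_le_mul_of_nonneg_right hn (inv_nonneg.2 (Real.sqrt_nonneg _))

theorem eventually_abs_recipSum_sub_le {q : ℕ} (hq : 0 < q) {δ : ℝ} (hδ : 0 < δ) :
    ∀ᶠ n : ℕ in atTop, 0 < δ * LL n ∧
      |recipSum (primesMod q n) - LL n / q.totient| ≤ δ * LL n := by
  obtain ⟨C, hC⟩ := exists_abs_recipSum_natCast_sub_le hq
  filter_upwards [hC, tendsto_LL_atTop.eventually_ge_atTop (C / δ),
    tendsto_LL_atTop.eventually_gt_atTop 0] with n h1 h2 h3
  rw [div_le_iff₀ hδ] at h2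
  exact ⟨mul_pos hδ h3, h1.trans (by linarith)⟩

theorem three_mul_div_le {S L δ t b : ℝ} (hδL : 0 < δ * L) (hδ : 0 < δ)
    (hS : |S - L / t| ≤ δ * L) (hb : δ * L ≤ b) :
    3 * S / (4 * b) ≤ 3 * |t⁻¹ + δ| / (4 * δ) := by
  have hL : 0 < L := (mul_pos_iff_of_pos_left hδ).1 hδL
  rw [div_le_div_iff₀ (by linarith) (by positivity)]
  have h1 := (abs_le.1 hS).2
  have h2 : S ≤ |t⁻¹ + δ| * L := by
    have := le_abs_self (t⁻¹ + δ)
    rw [div_eq_mul_inv] at h1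
    nlinarith
  have h3 : |t⁻¹ + δ| * (δ * L) ≤ |t⁻¹ + δ| * b := mul_le_mul_of_nonneg_left hb (abs_nonneg _)
  nlinarith

theorem tendsto_mean_max_omegaQ_sub {q : ℕ} (hq : 0 < q) {c : ℝ} (hc : 1 / (q.totient : ℝ) < c) :
    Tendsto (fun n => meanUpTo (fun m => max ((omegaQ m q : ℝ) - c * LL n) 0) n /
      Real.sqrt (LL n)) atTop (nhds 0) := by
  obtain ⟨δ, hδ⟩ : ∃ δ, c = 1 / (q.totient : ℝ) + 2 * δ := ⟨(c - 1 / (q.totient : ℝ)) / 2, by ring⟩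
  have hδ0 : 0 < δ := by linarith
  refine tendsto_div_sqrt_LL_of_abs_le (C := 3 * |(q.totient : ℝ)⁻¹ + δ| / (4 * δ)) ?_
  filter_upwards [eventually_abs_recipSum_sub_le hq hδ0, eventually_gt_atTop 0] with n h1 hn
  have hgap : δ * LL n ≤ c * LL n - recipSum (primesMod q n) := by
    have := (abs_le.1 h1.2).2
    rw [hδ, add_mul, one_div_mul_eq_div]
    linarith
  rw [abs_of_nonneg (meanUpTo_nonneg fun _ _ _ => le_max_right _ _),
    meanUpTo_congr (g := fun m => max ((omegaIn (primesMod q n) m : ℝ) - c * LL n) 0)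
      fun m h1 h2 => by rw [omegaQ_eq_omegaIn h1 h2]]
  exact (mean_max_omegaIn_sub_le_of_lt (fun _ => prime_of_mem_primesMod) hn
    (primesMod_subset_Icc q n) (by linarith [h1.1])).trans (three_mul_div_le h1.1 hδ0 h1.2 hgap)

theorem tendsto_mean_max_sub_omegaQ {q : ℕ} (hq : 0 < q) {c : ℝ} (hc : c < 1 / (q.totient : ℝ)) :
    Tendsto (fun n => meanUpTo (fun m => max (c * LL n - (omegaQ m q : ℝ)) 0) n /
      Real.sqrt (LL n)) atTop (nhds 0) := by
  obtain ⟨δ, hδ⟩ : ∃ δ, c = 1 / (q.totient : ℝ) - 2 * δ := ⟨(1 / (q.totient : ℝ) - c) / 2, by ring⟩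
  have hδ0 : 0 < δ := by linarith
  refine tendsto_div_sqrt_LL_of_abs_le (C := 3 * |(q.totient : ℝ)⁻¹ + δ| / (4 * δ)) ?_
  filter_upwards [eventually_abs_recipSum_sub_le hq hδ0, eventually_gt_atTop 0] with n h1 hn
  have hgap : δ * LL n ≤ recipSum (primesMod q n) - c * LL n := by
    have := (abs_le.1 h1.2).1
    rw [hδ, sub_mul, one_div_mul_eq_div]
    linarith
  rw [abs_of_nonneg (meanUpTo_nonneg fun _ _ _ => le_max_right _ _),
    meanUpTo_congr (g := fun m => max (c * LL n - (omegaIn (primesMod q n) m : ℝ)) 0)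
      fun m h1 h2 => by rw [omegaQ_eq_omegaIn h1 h2]]
  exact (mean_max_sub_omegaIn_le_of_lt (fun _ => prime_of_mem_primesMod) hn
    (primesMod_subset_Icc q n) (by linarith [h1.1])).trans (three_mul_div_le h1.1 hδ0 h1.2 hgap)

theorem tendsto_mean_max_omegaQ_sub_omegaQ {q r : ℕ} (hq : 0 < q) (hr : 0 < r)
    (h : r.totient < q.totient) :
    Tendsto (fun n => meanUpTo (fun m => max ((omegaQ m q : ℝ) - omegaQ m r) 0) n /
      Real.sqrt (LL n)) atTop (nhds 0) := by
  have hφ : 1 / (q.totient : ℝ) < 1 / (r.totient : ℝ) :=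
    one_div_lt_one_div_of_lt (by exact_mod_cast Nat.totient_pos.2 hr) (by exact_mod_cast h)
  obtain ⟨c, hc1, hc2⟩ := exists_between hφ
  have hlim := (tendsto_mean_max_omegaQ_sub hq hc1).add (tendsto_mean_max_sub_omegaQ hr hc2)
  rw [add_zero] at hlim
  refine squeeze_zero (fun n => div_nonneg (meanUpTo_nonneg fun _ _ _ => le_max_right _ _)
    (Real.sqrt_nonneg _)) (fun n => ?_) hlim
  rw [← add_div, ← meanUpTo_add]
  refine div_le_div_of_nonneg_right (meanUpTo_mono fun m _ _ => ?_) (Real.sqrt_nonneg _)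
  refine max_le ?_ (add_nonneg (le_max_right _ _) (le_max_right _ _))
  have h1 := le_max_left ((omegaQ m q : ℝ) - c * LL n) 0
  have h2 := le_max_left (c * LL n - (omegaQ m r : ℝ)) 0
  linarith

theorem tendsto_mean_omegaQ_sub {q : ℕ} (hq : 0 < q) :
    Tendsto (fun n => (meanUpTo (fun m => (omegaQ m q : ℝ)) n - LL n / q.totient) /
      Real.sqrt (LL n)) atTop (nhds 0) := by
  obtain ⟨C, hC⟩ := exists_abs_recipSum_natCast_sub_le hq
  refine tendsto_div_sqrt_LL_of_abs_le (C := 1 + C) ?_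
  filter_upwards [hC, eventually_gt_atTop 0] with n h1 hn
  rw [meanUpTo_congr (g := fun m => (omegaIn (primesMod q n) m : ℝ))
      fun m h1 h2 => by rw [omegaQ_eq_omegaIn h1 h2]]
  exact (abs_sub_le _ _ _).trans (add_le_add
    (abs_mean_omegaIn_sub_le hn (primesMod_subset_Icc q n)) h1)

/-- The number of terms of `lam` which are divisible by `q`. -/
def dvdCount {K : ℕ} (lam : Fin K → ℕ) (q : ℕ) : ℕ :=
  (Finset.univ.filter fun j => q ∣ lam j).card

section Chain

variable {K : ℕ} {lam : Fin K → ℕ}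

theorem filter_dvd_total (hlam : ∀ j k, j ≤ k → lam j ∣ lam k) (q r : ℕ) :
    (Finset.univ.filter fun j => q ∣ lam j) ⊆ (Finset.univ.filter fun j => r ∣ lam j) ∨
      (Finset.univ.filter fun j => r ∣ lam j) ⊆ (Finset.univ.filter fun j => q ∣ lam j) := by
  by_contra! h
  obtain ⟨h1, h2⟩ := h
  simp only [Finset.not_subset, Finset.mem_filter, Finset.mem_univ, true_and] at h1 h2
  obtain ⟨j, hqj, hrj⟩ := h1
  obtain ⟨k, hrk, hqk⟩ := h2
  rcases le_total j k with hjk | hjk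
  · exact hqk (hqj.trans (hlam _ _ hjk))
  · exact hrj (hrk.trans (hlam _ _ hjk))

theorem card_filter_dvd_sdiff_le (hlam : ∀ j k, j ≤ k → lam j ∣ lam k) (q r : ℕ) :
    (((Finset.univ.filter fun j => q ∣ lam j) \ Finset.univ.filter fun j => r ∣ lam j).card : ℝ) ≤
      max ((dvdCount lam q : ℝ) - dvdCount lam r) 0 := by
  rcases filter_dvd_total hlam q r with h | h
  · rw [Finset.sdiff_eq_empty_iff_subset.2 h, Finset.card_empty, Nat.cast_zero]
    exact le_max_right _ _
  · rw [Finset.cast_card_sdiff h]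
    exact le_max_left _ _

theorem card_filter_eq_le (hlam : ∀ j k, j ≤ k → lam j ∣ lam k) {d q r : ℕ} (hq : q ∣ d)
    (hr : ¬ r ∣ d) :
    ((Finset.univ.filter fun j => lam j = d).card : ℝ) ≤
      max ((dvdCount lam q : ℝ) - dvdCount lam r) 0 := by
  refine le_trans ?_ (card_filter_dvd_sdiff_le hlam q r)
  refine Nat.cast_le.2 (Finset.card_le_card fun j hj => ?_)
  obtain rfl := (Finset.mem_filter.1 hj).2
  simp [hq, hr]

theorem min_le_card_filter_inter (hlam : ∀ j k, j ≤ k → lam j ∣ lam k) (q r : ℕ) :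
    min (dvdCount lam q : ℝ) (dvdCount lam r) ≤
      ((Finset.univ.filter fun j => q ∣ lam j) ∩ Finset.univ.filter fun j => r ∣ lam j).card := by
  rcases filter_dvd_total hlam q r with h | h
  · rw [Finset.inter_eq_left.2 h]
    exact min_le_left _ _
  · rw [Finset.inter_eq_right.2 h]
    exact min_le_right _ _

theorem card_filter_union_le_max (hlam : ∀ j k, j ≤ k → lam j ∣ lam k) (q r : ℕ) :
    (((Finset.univ.filter fun j => q ∣ lam j) ∪ Finset.univ.filter fun j => r ∣ lam j).card : ℝ) ≤
      max (dvdCount lam q : ℝ) (dvdCount lam r) := by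
  rcases filter_dvd_total hlam q r with h | h
  · rw [Finset.union_eq_right.2 h]
    exact le_max_right _ _
  · rw [Finset.union_eq_left.2 h]
    exact le_max_left _ _

theorem card_filter_exists_dvd_le (hlam : ∀ j k, j ≤ k → lam j ∣ lam k) {P : ℕ → Prop} {r : ℕ}
    {E : ℝ} (hE : 0 ≤ E) (h : ∀ l, P l → (dvdCount lam l : ℝ) - dvdCount lam r ≤ E)
    {S : Finset (Fin K)} (hS : ∀ j ∈ S, ¬ r ∣ lam j ∧ ∃ l, P l ∧ l ∣ lam j) : (S.card : ℝ) ≤ E := by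
  rcases S.eq_empty_or_nonempty with rfl | hne
  · simpa using hE
  obtain ⟨-, l, hl, hlj⟩ := hS _ (S.min'_mem hne)
  refine le_trans ?_ ((card_filter_dvd_sdiff_le hlam l r).trans (max_le (h l hl) hE))
  refine Nat.cast_le.2 (Finset.card_le_card fun j hj => ?_)
  simp only [Finset.mem_sdiff, Finset.mem_filter, Finset.mem_univ, true_and]
  exact ⟨hlj.trans (hlam _ _ (S.min'_le _ hj)), (hS j hj).1⟩

end Chain

/-- The prime power divisors of `d` other than `q₁` and `q₂`. -/
def otherDivisors (d q₁ q₂ : ℕ) : Finset ℕ := by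
  classical exact d.divisors.filter fun q => IsPrimePow q ∧ q ≠ q₁ ∧ q ≠ q₂

/-- The prime powers up to `b` other than `q₃` and `q₄` which do not divide `d`. -/
def otherNonDivisors (d q₃ q₄ b : ℕ) : Finset ℕ := by
  classical exact (Finset.range (b + 1)).filter fun q => IsPrimePow q ∧ ¬ q ∣ d ∧ q ≠ q₃ ∧ q ≠ q₄

theorem mem_otherDivisors {d q₁ q₂ q : ℕ} :
    q ∈ otherDivisors d q₁ q₂ ↔ (q ∣ d ∧ d ≠ 0) ∧ IsPrimePow q ∧ q ≠ q₁ ∧ q ≠ q₂ := by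
  rw [otherDivisors, Finset.mem_filter, Nat.mem_divisors]

theorem mem_otherNonDivisors {d q₃ q₄ b q : ℕ} :
    q ∈ otherNonDivisors d q₃ q₄ b ↔ q ≤ b ∧ IsPrimePow q ∧ ¬ q ∣ d ∧ q ≠ q₃ ∧ q ≠ q₄ := by
  rw [otherNonDivisors, Finset.mem_filter, Finset.mem_range, Nat.lt_succ_iff]

theorem exists_obstruction_of_ne {d q₁ q₂ q₃ q₄ N : ℕ} (hd : d ≠ 0) (l₀ : ℕ) (hN : N ≠ d)
    (h1 : q₁ ∣ N) (h2 : q₂ ∣ N) (h3 : ¬ q₃ ∣ N) (h4 : ¬ q₄ ∣ N) :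
    (∃ q ∈ otherDivisors d q₁ q₂, ¬ q ∣ N) ∨
      (∃ q ∈ otherNonDivisors d q₃ q₄ (l₀ * d), q ∣ N) ∨ ∃ l, (l.Prime ∧ l₀ ≤ l) ∧ l ∣ N := by
  by_cases hdN : d ∣ N
  · have hNd : ¬ N ∣ d := fun h => hN (Nat.dvd_antisymm h hdN)
    rw [Nat.dvd_iff_prime_pow_dvd_dvd] at hNd
    push Not at hNd
    obtain ⟨p, k, hp, hkN, hkd⟩ := hNd
    have hk : k ≠ 0 := by
      rintro rfl
      exact hkd (by simp)
    rcases le_or_gt l₀ p with hl | hl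
    · exact Or.inr (Or.inr ⟨p, ⟨hp, hl⟩, (dvd_pow_self p hk).trans hkN⟩)
    · have hex : ∃ a, ¬ p ^ a ∣ d := ⟨k, hkd⟩
      classical
      obtain ⟨a, ha⟩ : ∃ a, Nat.find hex = a + 1 :=
        Nat.exists_eq_succ_of_ne_zero fun h0 => Nat.find_spec hex (by rw [h0]; simp)
      have ha1 : ¬ p ^ (a + 1) ∣ d := ha ▸ Nat.find_spec hex
      have ha2 : p ^ a ∣ d := not_not.1 (Nat.find_min hex (by omega))
      have hdvd : p ^ (a + 1) ∣ N := (pow_dvd_pow p (ha ▸ Nat.find_min' hex hkd)).trans hkN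
      refine Or.inr (Or.inl ⟨p ^ (a + 1), mem_otherNonDivisors.2 ⟨?_,
        hp.isPrimePow.pow a.succ_ne_zero,
        ha1, ?_, ?_⟩, hdvd⟩)
      · rw [pow_succ']
        exact Nat.mul_le_mul hl.le (Nat.le_of_dvd (Nat.pos_of_ne_zero hd) ha2)
      · rintro rfl
        exact h3 hdvd
      · rintro rfl
        exact h4 hdvd
  · rw [Nat.dvd_iff_prime_pow_dvd_dvd] at hdN
    push Not at hdN
    obtain ⟨p, k, hp, hkd, hkN⟩ := hdN
    have hk : k ≠ 0 := by
      rintro rfl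
      exact hkN (by simp)
    refine Or.inl ⟨p ^ k, mem_otherDivisors.2 ⟨⟨hkd, hd⟩, hp.isPrimePow.pow hk, ?_, ?_⟩, hkN⟩
    · rintro rfl
      exact hkN h1
    · rintro rfl
      exact hkN h2

theorem le_card_filter_eq {K : ℕ} {lam : Fin K → ℕ} (hlam : ∀ j k, j ≤ k → lam j ∣ lam k)
    {d : ℕ} (hd : d ≠ 0) (q₁ q₂ q₃ q₄ l₀ : ℕ) {E : ℝ} (hE : 0 ≤ E)
    (h : ∀ l, l.Prime ∧ l₀ ≤ l → (dvdCount lam l : ℝ) - dvdCount lam q₃ ≤ E) :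
    min (dvdCount lam q₁ : ℝ) (dvdCount lam q₂) - max (dvdCount lam q₃ : ℝ) (dvdCount lam q₄) -
        ∑ q ∈ otherDivisors d q₁ q₂, max ((dvdCount lam q₁ : ℝ) - dvdCount lam q) 0 -
        ∑ q ∈ otherNonDivisors d q₃ q₄ (l₀ * d), max ((dvdCount lam q : ℝ) - dvdCount lam q₃) 0 -
        E ≤ (Finset.univ.filter fun j => lam j = d).card := by
  classical
  let U : ℕ → Finset (Fin K) := fun q => Finset.univ.filter fun j => q ∣ lam j
  let S : Finset (Fin K) := Finset.univ.filter fun j =>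
    ¬ q₃ ∣ lam j ∧ ∃ l, (l.Prime ∧ l₀ ≤ l) ∧ l ∣ lam j
  have hcover : U q₁ ∩ U q₂ ⊆ (Finset.univ.filter fun j => lam j = d) ∪ ((U q₃ ∪ U q₄) ∪
      ((otherDivisors d q₁ q₂).biUnion (fun q => U q₁ \ U q) ∪
        ((otherNonDivisors d q₃ q₄ (l₀ * d)).biUnion (fun q => U q \ U q₃) ∪ S))) := by
    intro j hj
    simp only [U, S, Finset.mem_inter, Finset.mem_union, Finset.mem_biUnion, Finset.mem_sdiff,
      Finset.mem_filter, Finset.mem_univ, true_and] at hj ⊢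
    by_contra! hcon
    obtain ⟨hne, ⟨h3, h4⟩, hD, hF, hS⟩ := hcon
    rcases exists_obstruction_of_ne hd l₀ hne hj.1 hj.2 h3 h4 with ⟨q, hq, hqN⟩ | ⟨q, hq, hqN⟩ |
      ⟨l, hl, hlN⟩
    · exact hqN (hD q hq hj.1)
    · exact h3 (hF q hq hqN)
    · exact hS h3 l hl hlN
  have hcard : ((U q₁ ∩ U q₂).card : ℝ) ≤ (Finset.univ.filter fun j => lam j = d).card +
      ((U q₃ ∪ U q₄).card + ((∑ q ∈ otherDivisors d q₁ q₂, (U q₁ \ U q).card) +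
        ((∑ q ∈ otherNonDivisors d q₃ q₄ (l₀ * d), (U q \ U q₃).card) + S.card))) := by
    norm_cast
    refine (Finset.card_le_card hcover).trans ?_
    refine (Finset.card_union_le _ _).trans (Nat.add_le_add_left ?_ _)
    refine (Finset.card_union_le _ _).trans (Nat.add_le_add_left ?_ _)
    refine (Finset.card_union_le _ _).trans (Nat.add_le_add Finset.card_biUnion_le ?_)
    exact (Finset.card_union_le _ _).trans (Nat.add_le_add_right Finset.card_biUnion_le _)
  push_cast at hcard
  have hS := card_filter_exists_dvd_le hlam hE h (S := S) fun j hj => (Finset.mem_filter.1 hj).2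
  have h12 := min_le_card_filter_inter hlam q₁ q₂
  have h34 := card_filter_union_le_max hlam q₃ q₄
  have hD : ∑ q ∈ otherDivisors d q₁ q₂, ((U q₁ \ U q).card : ℝ) ≤ _ :=
    Finset.sum_le_sum fun q _ => card_filter_dvd_sdiff_le hlam q₁ q
  have hF : ∑ q ∈ otherNonDivisors d q₃ q₄ (l₀ * d), ((U q \ U q₃).card : ℝ) ≤ _ :=
    Finset.sum_le_sum fun q _ => card_filter_dvd_sdiff_le hlam q q₃
  linarith

theorem card_filter_eq_le_max {K : ℕ} {lam : Fin K → ℕ} (hlam : ∀ j k, j ≤ k → lam j ∣ lam k)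
    {d q₁ q₂ q₃ q₄ : ℕ} (h1 : q₁ ∣ d) (h2 : q₂ ∣ d) (h3 : ¬ q₃ ∣ d) (h4 : ¬ q₄ ∣ d) :
    ((Finset.univ.filter fun j => lam j = d).card : ℝ) ≤
      max (min (dvdCount lam q₁ : ℝ) (dvdCount lam q₂) -
        max (dvdCount lam q₃ : ℝ) (dvdCount lam q₄)) 0 := by
  rcases min_choice (dvdCount lam q₁ : ℝ) (dvdCount lam q₂) with hm | hm <;>
    rcases max_choice (dvdCount lam q₃ : ℝ) (dvdCount lam q₄) with hM | hM <;>
    rw [hm, hM] <;> apply card_filter_eq_le hlam <;> assumption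

theorem omegaQ_eq_zero_of_lt {m q : ℕ} (hq : 1 < q) (h : m < q + 1) : omegaQ m q = 0 := by
  rw [omegaQ, Finset.card_eq_zero, Finset.filter_eq_empty_iff]
  intro p hp hpq
  have hpp := Nat.prime_of_mem_primeFactors hp
  have hdvd : q ∣ p - 1 := (Nat.modEq_iff_dvd' hpp.one_le).1 (Eq.symm hpq)
  have h1 := Nat.le_of_dvd (Nat.sub_pos_of_lt hpp.one_lt) hdvd
  have h2 := Nat.le_of_mem_primeFactors hp
  omega

theorem max_sub_zero_le_add_two {u v x y : ℝ} (hu : u ≤ x + 2) (hv : y ≤ v) :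
    max (u - v) 0 ≤ max (x - y) 0 + 2 :=
  max_le (by linarith [le_max_left (x - y) 0]) (by linarith [le_max_right (x - y) 0])

theorem max_min_sub_max_zero_le (x y z w : ℝ) :
    max (min x y - max z w) 0 ≤ min x y - max z w + (max (z - x) 0 + max (z - y) 0 +
      max (w - x) 0 + max (w - y) 0) := by
  have h1 := le_max_left (z - x) 0
  have h2 := le_max_left (z - y) 0
  have h3 := le_max_left (w - x) 0
  have h4 := le_max_left (w - y) 0
  have h1' := le_max_right (z - x) 0
  have h2' := le_max_right (z - y) 0
  have h3' := le_max_right (w - x) 0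
  have h4' := le_max_right (w - y) 0
  refine max_le (by linarith) ?_
  rcases min_choice x y with h | h <;> rcases max_choice z w with h' | h' <;> rw [h, h'] <;>
    linarith

theorem abs_sub_le_of_isInvCount {d : ℕ} {J : ℕ → ℕ} (hJ : IsInvCount d J) (hd : d ≠ 0)
    {q₁ q₂ q₃ q₄ : ℕ} (hq₁ : IsPrimePow q₁) (hq₂ : IsPrimePow q₂) (hq₃ : IsPrimePow q₃)
    (hq₄ : IsPrimePow q₄) (h₁ : q₁ ∣ d) (h₂ : q₂ ∣ d) (h₃ : ¬ q₃ ∣ d) (h₄ : ¬ q₄ ∣ d) (l₀ : ℕ)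
    (b : ℝ) {m n : ℕ} (hm : 1 ≤ m) (hmn : m ≤ n) :
    |(J m : ℝ) - (min (omegaQ m q₁ : ℝ) (omegaQ m q₂) - max (omegaQ m q₃ : ℝ) (omegaQ m q₄))| ≤
      (4 + 2 * (otherDivisors d q₁ q₂).card + 2 * (otherNonDivisors d q₃ q₄ (l₀ * d)).card) +
      (max ((omegaQ m q₃ : ℝ) - omegaQ m q₁) 0 + max ((omegaQ m q₃ : ℝ) - omegaQ m q₂) 0 +
        max ((omegaQ m q₄ : ℝ) - omegaQ m q₁) 0 + max ((omegaQ m q₄ : ℝ) - omegaQ m q₂) 0) +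
      (∑ q ∈ otherDivisors d q₁ q₂, max ((omegaQ m q₁ : ℝ) - omegaQ m q) 0 +
        ∑ q ∈ otherNonDivisors d q₃ q₄ (l₀ * d), max ((omegaQ m q : ℝ) - omegaQ m q₃) 0) +
      (∑ l ∈ Finset.Icc l₀ n with l.Prime, max ((omegaQ m l : ℝ) - b) 0 +
        max (b - omegaQ m q₃) 0) := by
  obtain ⟨K, lam, hlam1, hlam, ⟨e⟩⟩ := exists_invariantFactors_units (Nat.pos_iff_ne_zero.1 hm)
  have hJm := hJ m hm K lam hlam1 hlam ⟨e⟩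
  have hu : ∀ q, IsPrimePow q → (omegaQ m q : ℝ) ≤ dvdCount lam q ∧
      (dvdCount lam q : ℝ) ≤ omegaQ m q + 2 := fun q hq => by
    have h := omegaQ_le_card_dvd_le (Nat.pos_iff_ne_zero.1 hm) hlam1 e hq
    exact ⟨by exact_mod_cast h.1, by exact_mod_cast h.2⟩
  obtain ⟨l1, u1⟩ := hu q₁ hq₁
  obtain ⟨l2, u2⟩ := hu q₂ hq₂
  obtain ⟨l3, u3⟩ := hu q₃ hq₃
  obtain ⟨l4, u4⟩ := hu q₄ hq₄
  have hupper := card_filter_eq_le_max hlam h₁ h₂ h₃ h₄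
  set SL := ∑ l ∈ Finset.Icc l₀ n with l.Prime, max ((omegaQ m l : ℝ) - b) 0
  have hSL : 0 ≤ SL := Finset.sum_nonneg fun _ _ => le_max_right _ _
  have hb0 := le_max_right (b - omegaQ m q₃) 0
  have hb1 := le_max_left (b - omegaQ m q₃) 0
  have hlower := le_card_filter_eq hlam hd q₁ q₂ q₃ q₄ l₀
    (E := 2 + SL + max (b - omegaQ m q₃) 0) (by linarith) (by
      rintro l ⟨hl, hl₀⟩
      have hul := (hu l hl.isPrimePow).2
      rcases le_or_gt l n with hln | hln
      · have hsl : max ((omegaQ m l : ℝ) - b) 0 ≤ SL :=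
          Finset.single_le_sum (f := fun l => max ((omegaQ m l : ℝ) - b) 0)
            (fun _ _ => le_max_right _ _)
            (Finset.mem_filter.2 ⟨Finset.mem_Icc.2 ⟨hl₀, hln⟩, hl⟩)
        linarith [le_max_left ((omegaQ m l : ℝ) - b) 0]
      · rw [omegaQ_eq_zero_of_lt hl.one_lt (by omega), Nat.cast_zero] at hul
        linarith [Nat.cast_nonneg (α := ℝ) (omegaQ m q₃)])
  have hD : ∑ q ∈ otherDivisors d q₁ q₂, max ((dvdCount lam q₁ : ℝ) - dvdCount lam q) 0 ≤
      ∑ q ∈ otherDivisors d q₁ q₂, max ((omegaQ m q₁ : ℝ) - omegaQ m q) 0 +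
        2 * (otherDivisors d q₁ q₂).card := by
    rw [mul_comm (2 : ℝ), ← nsmul_eq_mul, ← Finset.sum_const, ← Finset.sum_add_distrib]
    exact Finset.sum_le_sum fun q hq =>
      max_sub_zero_le_add_two u1 (hu q (mem_otherDivisors.1 hq).2.1).1
  have hF : ∑ q ∈ otherNonDivisors d q₃ q₄ (l₀ * d),
        max ((dvdCount lam q : ℝ) - dvdCount lam q₃) 0 ≤
      ∑ q ∈ otherNonDivisors d q₃ q₄ (l₀ * d), max ((omegaQ m q : ℝ) - omegaQ m q₃) 0 +
        2 * (otherNonDivisors d q₃ q₄ (l₀ * d)).card := by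
    rw [mul_comm (2 : ℝ), ← nsmul_eq_mul, ← Finset.sum_const, ← Finset.sum_add_distrib]
    exact Finset.sum_le_sum fun q hq =>
      max_sub_zero_le_add_two (hu q (mem_otherNonDivisors.1 hq).2.1).2 l3
  have hD0 : 0 ≤ ∑ q ∈ otherDivisors d q₁ q₂, max ((omegaQ m q₁ : ℝ) - omegaQ m q) 0 :=
    Finset.sum_nonneg fun _ _ => le_max_right _ _
  have hF0 : 0 ≤ ∑ q ∈ otherNonDivisors d q₃ q₄ (l₀ * d),
      max ((omegaQ m q : ℝ) - omegaQ m q₃) 0 := Finset.sum_nonneg fun _ _ => le_max_right _ _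
  have hmin1 := min_le_min l1 l2
  have hmax1 := max_le_max l3 l4
  have hmin2 : min (dvdCount lam q₁ : ℝ) (dvdCount lam q₂) ≤
      min (omegaQ m q₁ : ℝ) (omegaQ m q₂) + 2 :=
    (min_le_min u1 u2).trans (min_add_add_right _ _ _).le
  have hmax2 : max (dvdCount lam q₃ : ℝ) (dvdCount lam q₄) ≤
      max (omegaQ m q₃ : ℝ) (omegaQ m q₄) + 2 :=
    (max_le_max u3 u4).trans (max_add_add_right _ _ _).le
  have hT := max_min_sub_max_zero_le (omegaQ m q₁ : ℝ) (omegaQ m q₂) (omegaQ m q₃) (omegaQ m q₄)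
  have hup2 : max (min (dvdCount lam q₁ : ℝ) (dvdCount lam q₂) -
      max (dvdCount lam q₃ : ℝ) (dvdCount lam q₄)) 0 ≤ _ := max_sub_zero_le_add_two hmin2 hmax1
  have hp1 := le_max_right ((omegaQ m q₃ : ℝ) - omegaQ m q₁) 0
  have hp2 := le_max_right ((omegaQ m q₃ : ℝ) - omegaQ m q₂) 0
  have hp3 := le_max_right ((omegaQ m q₄ : ℝ) - omegaQ m q₁) 0
  have hp4 := le_max_right ((omegaQ m q₄ : ℝ) - omegaQ m q₂) 0
  have hDc : (0 : ℝ) ≤ (otherDivisors d q₁ q₂).card := Nat.cast_nonneg _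
  have hFc : (0 : ℝ) ≤ (otherNonDivisors d q₃ q₄ (l₀ * d)).card := Nat.cast_nonneg _
  rw [← hJm] at hupper hlower
  rw [abs_le]
  constructor <;> linarith

/-- The mean of `f n` over `1, …, n` is of smaller order than `√(log log n)`. -/
def MeanNegligible (f : ℕ → ℕ → ℝ) : Prop :=
  Tendsto (fun n => meanUpTo (f n) n / Real.sqrt (LL n)) atTop (nhds 0)

theorem MeanNegligible.add {f g : ℕ → ℕ → ℝ} (hf : MeanNegligible f) (hg : MeanNegligible g) :
    MeanNegligible fun n m => f n m + g n m := by
  simpa only [MeanNegligible, meanUpTo_add, add_div, add_zero] using Tendsto.add hf hg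

theorem MeanNegligible.sum {ι : Type*} {s : Finset ι} {f : ι → ℕ → ℕ → ℝ}
    (h : ∀ i ∈ s, MeanNegligible (f i)) : MeanNegligible fun n m => ∑ i ∈ s, f i n m := by
  simpa only [MeanNegligible, meanUpTo_sum, Finset.sum_div, Finset.sum_const_zero] using
    tendsto_finsetSum s h

theorem meanNegligible_const (C : ℝ) : MeanNegligible fun _ _ => C := by
  refine tendsto_div_sqrt_LL_of_abs_le (C := |C|) ?_
  filter_upwards [eventually_gt_atTop 0] with n hn
  rw [meanUpTo_const C hn]

theorem MeanNegligible.of_abs_le {f g : ℕ → ℕ → ℝ} (hg : MeanNegligible g)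
    (h : ∀ n m, 1 ≤ m → m ≤ n → |f n m| ≤ g n m) : MeanNegligible f := by
  refine squeeze_zero_norm (fun n => ?_) hg
  rw [Real.norm_eq_abs, abs_div, abs_of_nonneg (Real.sqrt_nonneg (LL n))]
  refine div_le_div_of_nonneg_right (abs_le.2 ⟨?_, meanUpTo_mono fun m h1 h2 =>
    (le_abs_self _).trans (h n m h1 h2)⟩) (Real.sqrt_nonneg _)
  rw [← neg_one_mul, ← meanUpTo_const_mul]
  exact meanUpTo_mono fun m h1 h2 => by linarith [(abs_le.1 (h n m h1 h2)).1]

theorem meanNegligible_sub_of_isInvCount {d : ℕ} {J : ℕ → ℕ} (hJ : IsInvCount d J) (hd : d ≠ 0)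
    {q₁ q₂ q₃ q₄ : ℕ} (hq₁ : IsPrimePow q₁) (hq₂ : IsPrimePow q₂) (hq₃ : IsPrimePow q₃)
    (hq₄ : IsPrimePow q₄) (h12 : q₁ ≠ q₂) (h34 : q₃ ≠ q₄) (hφ12 : q₁.totient = q₂.totient)
    (hφ34 : q₃.totient = q₄.totient) (hlt : q₁.totient < q₃.totient)
    (hdvd : ∀ q : ℕ, IsPrimePow q → (q ∣ d ↔ q.totient ≤ q₁.totient))
    (hgap : ∀ q : ℕ, IsPrimePow q → q₁.totient < q.totient → q₃.totient ≤ q.totient) :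
    MeanNegligible fun _ m => (J m : ℝ) -
      (min (omegaQ m q₁ : ℝ) (omegaQ m q₂) - max (omegaQ m q₃ : ℝ) (omegaQ m q₄)) := by
  have hφ₃ : (0 : ℝ) < q₃.totient := Nat.cast_pos.2 (Nat.totient_pos.2 hq₃.pos)
  have hc : 1 / (2 * (q₃.totient : ℝ)) < 1 / q₃.totient :=
    one_div_lt_one_div_of_lt hφ₃ (by linarith)
  obtain ⟨l₀, hl₀⟩ := exists_tendsto_mean_sum_max_omegaQ_sub
    (c := 1 / (2 * (q₃.totient : ℝ))) (by positivity)
  have hpair : ∀ {q r : ℕ}, IsPrimePow q → IsPrimePow r → r.totient < q.totient →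
      MeanNegligible fun _ m => max ((omegaQ m q : ℝ) - omegaQ m r) 0 := fun hq hr h =>
    tendsto_mean_max_omegaQ_sub_omegaQ hq.pos hr.pos h
  have hD : ∀ q ∈ otherDivisors d q₁ q₂, MeanNegligible fun _ m =>
      max ((omegaQ m q₁ : ℝ) - omegaQ m q) 0 := fun q hq => by
    obtain ⟨⟨hqd, -⟩, hqp, hq1, hq2⟩ := mem_otherDivisors.1 hq
    refine hpair hq₁ hqp (lt_of_le_of_ne ((hdvd q hqp).1 hqd) fun h => ?_)
    rcases eq_or_eq_of_totient_eq hq₁ hq₂ hqp h12 hφ12 h with h | h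
    · exact hq1 h
    · exact hq2 h
  have hF : ∀ q ∈ otherNonDivisors d q₃ q₄ (l₀ * d), MeanNegligible fun _ m =>
      max ((omegaQ m q : ℝ) - omegaQ m q₃) 0 := fun q hq => by
    obtain ⟨-, hqp, hqd, hq3, hq4⟩ := mem_otherNonDivisors.1 hq
    rw [hdvd q hqp, not_le] at hqd
    refine hpair hqp hq₃ (lt_of_le_of_ne (hgap q hqp hqd) fun h => ?_)
    rcases eq_or_eq_of_totient_eq hq₃ hq₄ hqp h34 hφ34 h.symm with h | h
    · exact hq3 h
    · exact hq4 h
  have hbound := (((meanNegligible_const (4 + 2 * (otherDivisors d q₁ q₂).card +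
      2 * (otherNonDivisors d q₃ q₄ (l₀ * d)).card)).add
    ((((hpair hq₃ hq₁ hlt).add (hpair hq₃ hq₂ (hφ12 ▸ hlt))).add
      (hpair hq₄ hq₁ (hφ34 ▸ hlt))).add (hpair hq₄ hq₂ (hφ12 ▸ hφ34 ▸ hlt)))).add
    ((MeanNegligible.sum hD).add (MeanNegligible.sum hF))).add
    (MeanNegligible.add hl₀ (tendsto_mean_max_sub_omegaQ hq₃.pos hc))
  exact hbound.of_abs_le fun n m h1 h2 => abs_sub_le_of_isInvCount hJ hd hq₁ hq₂ hq₃ hq₄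
    ((hdvd q₁ hq₁).2 le_rfl) ((hdvd q₂ hq₂).2 hφ12.ge)
    (fun h => hlt.not_ge ((hdvd q₃ hq₃).1 h))
    (fun h => hlt.not_ge (hφ34 ▸ (hdvd q₄ hq₄).1 h)) l₀ _ h1 h2

theorem tendsto_mean_min_omegaQ {q r : ℕ} (hq : 0 < q) (hr : 0 < r) (hqr : q.Coprime r)
    (hφ : q.totient = r.totient) :
    Tendsto (fun n => (meanUpTo (fun m => min (omegaQ m q : ℝ) (omegaQ m r)) n -
      LL n / q.totient) / Real.sqrt (LL n)) atTop (nhds (-(Real.sqrt (1 / (q.totient : ℝ) +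
        1 / r.totient - 2 / (q.totient * r.totient)) / Real.sqrt (2 * Real.pi)))) := by
  have h := (((tendsto_mean_omegaQ_sub hq).add (tendsto_mean_omegaQ_sub hr)).sub
    (tendsto_mean_abs_omegaQ_sub hq hr hqr hφ)).const_mul (1 / 2)
  refine (h.congr fun n => ?_).trans_eq ?_
  · rw [← hφ]
    have hmin : meanUpTo (fun m => min (omegaQ m q : ℝ) (omegaQ m r)) n =
        1 / 2 * (meanUpTo (fun m => (omegaQ m q : ℝ)) n + meanUpTo (fun m => (omegaQ m r : ℝ)) n -
          meanUpTo (fun m => |(omegaQ m q : ℝ) - omegaQ m r|) n) := by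
      rw [← meanUpTo_add, ← meanUpTo_sub, ← meanUpTo_const_mul]
      refine meanUpTo_congr fun m _ _ => ?_
      rw [← max_sub_min_eq_abs', ← min_add_max (omegaQ m q : ℝ) (omegaQ m r)]
      ring
    rw [hmin]
    ring
  · have h2 : Real.sqrt (2 / Real.pi) = 2 / Real.sqrt (2 * Real.pi) := by
      rw [eq_div_iff (Real.sqrt_pos.2 (by positivity)).ne', ← Real.sqrt_mul (by positivity),
        show 2 / Real.pi * (2 * Real.pi) = 2 ^ 2 by field_simp]
      exact Real.sqrt_sq (by norm_num)
    rw [h2]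
    congr 1
    ring

theorem tendsto_mean_max_omegaQ {q r : ℕ} (hq : 0 < q) (hr : 0 < r) (hqr : q.Coprime r)
    (hφ : q.totient = r.totient) :
    Tendsto (fun n => (meanUpTo (fun m => max (omegaQ m q : ℝ) (omegaQ m r)) n -
      LL n / q.totient) / Real.sqrt (LL n)) atTop (nhds (Real.sqrt (1 / (q.totient : ℝ) +
        1 / r.totient - 2 / (q.totient * r.totient)) / Real.sqrt (2 * Real.pi))) := by
  have h := ((tendsto_mean_omegaQ_sub hq).add (tendsto_mean_omegaQ_sub hr)).sub
    (tendsto_mean_min_omegaQ hq hr hqr hφ)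
  rw [add_zero, zero_sub, neg_neg] at h
  refine h.congr fun n => ?_
  have hmax : meanUpTo (fun m => max (omegaQ m q : ℝ) (omegaQ m r)) n =
      meanUpTo (fun m => (omegaQ m q : ℝ)) n + meanUpTo (fun m => (omegaQ m r : ℝ)) n -
        meanUpTo (fun m => min (omegaQ m q : ℝ) (omegaQ m r)) n := by
    rw [← meanUpTo_add, ← meanUpTo_sub]
    exact meanUpTo_congr fun m _ _ => eq_sub_of_add_eq' (min_add_max _ _)
  rw [hmax, ← hφ]
  ring

theorem statement6 (i : ℕ) (hi : 2 ≤ i)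
    (h1 : (UFO (i - 1)).ncard = 2) (h2 : (UFO i).ncard = 1) (h3 : (UFO (i + 1)).ncard = 2)
    (d : ℕ) (hd : UFO i = {d}) (J : ℕ → ℕ) (hJ : IsInvCount d J) :
    Filter.Tendsto (fun n : ℕ => (avg J n - muSeq i * LL n) / Real.sqrt (LL n))
      Filter.atTop (nhds (-(sigSeq (i - 1) + sigSeq (i + 1)) / Real.sqrt (2 * Real.pi))) := by
  have hi1 : 1 ≤ i - 1 := by omega
  have hi' : i - 1 + 1 = i := by omega
  have h12 := qt_ne hi1 (show i - 1 < i by omega)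
  have h34 := qt_ne (show 1 ≤ i + 1 by omega) (show i + 1 < i + 1 + 1 by omega)
  have hφ12 : (qt (i - 1)).totient = (qt i).totient := by
    simpa only [hi'] using totient_qt_eq_of_ncard_UFO hi1 h1
  have hφ34 := totient_qt_eq_of_ncard_UFO (show 1 ≤ i + 1 by omega) h3
  have hlt := totient_qt_lt_of_ncard_UFO h2
  have hdL : d = Lseq i := by
    rw [UFO, if_pos hlt] at hd
    exact (Set.singleton_injective hd).symm
  have hq := isPrimePow_qt
  have herr : MeanNegligible _ := meanNegligible_sub_of_isInvCount hJ (hdL ▸ Lseq_ne_zero i)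
    (hq (i - 1)) (hq i) (hq (i + 1)) (hq (i + 1 + 1)) h12 h34 hφ12 hφ34 (hφ12 ▸ hlt)
    (fun q hq => by rw [hdL, hφ12]; exact dvd_Lseq_iff_totient_le hlt hq)
    (fun q hq h => totient_qt_succ_le hq (hφ12 ▸ h))
  have hmin := tendsto_mean_min_omegaQ (hq (i - 1)).pos (hq i).pos
    (coprime_of_totient_eq (hq _) (hq _) h12 hφ12) hφ12
  have hmax := tendsto_mean_max_omegaQ (hq (i + 1)).pos (hq (i + 1 + 1)).pos
    (coprime_of_totient_eq (hq _) (hq _) h34 hφ34) hφ34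
  refine ((Tendsto.add herr (hmin.sub hmax)).congr fun n => ?_).trans_eq ?_
  · rw [meanUpTo_sub, meanUpTo_sub, muSeq, phiQ, phiQ, ← hφ12,
      show avg J n = meanUpTo (fun m => (J m : ℝ)) n from rfl]
    ring
  · rw [sigSeq, sigSeq, phiQ, phiQ, phiQ, phiQ, hi']
    congr 1
    ring

end
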